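/- arXiv:1804.11302 — 2 statements merged into one kernel-verified Lean document; each statement's English description precedes it below -/
import Mathlib

section
/- For every integer s ≥ 4, the ratio f_{s+1,s+3}(n)/f_{s,s+3}(n) tends to infinity as n → ∞. -/
/-- The Erdős–Rogers function `f_{s,t}(n)`: the minimum over all `K_t`-free graphs `G`
on `n` vertices of the maximum size of a vertex subset inducing a `K_s`-free subgraph. -/
noncomputable def erdosRogers (s t n : ℕ) : ℕ :=
  sInf { k : ℕ | ∃ G : SimpleGraph (Fin n), G.CliqueFree t ∧
    k = sSup { m : ℕ | ∃ A : Finset (Fin n), A.card = m ∧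
      (G.induce (A : Set (Fin n))).CliqueFree s } }


section ModPA1
open Finset

theorem count_fix {V : Type*} [Fintype V] [DecidableEq V] (k : ℕ) (A : Finset V) :
    (k+1)^A.card * (univ.filter (fun χ : V → Fin (k+1) => ∀ v ∈ A, χ v = 0)).card
      = (k+1)^(Fintype.card V) := by
  have h : (univ.filter (fun χ : V → Fin (k+1) => ∀ v ∈ A, χ v = 0))
      = Fintype.piFinset (fun v => if v ∈ A then {0} else univ) := by
    ext χ
    simp only [mem_filter, mem_univ, true_and, Fintype.mem_piFinset]
    refine forall_congr' fun v => ?_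
    by_cases hv : v ∈ A <;> simp [hv]
  rw [h, Fintype.card_piFinset]
  have : ∀ v : V, (if v ∈ A then ({0} : Finset (Fin (k+1))) else univ).card = if v ∈ A then 1 else (k+1) := by
    intro v; split_ifs <;> simp
  simp only [this]
  rw [Finset.prod_ite]
  simp only [prod_const, one_pow, one_mul]
  rw [← pow_add]
  congr 1
  have := Finset.card_add_card_compl A
  rw [← this]
  congr 2
  ext; simp

/-- Random sampling and deletion. -/
theorem color_lemma {V : Type*} [Fintype V] [DecidableEq V] (r k : ℕ) (hk : 1 ≤ k) (U : Finset V)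
    (F : Finset (Finset V)) (hr : 1 ≤ r) (hF : ∀ A ∈ F, A.card = r) :
    ∃ W ⊆ U, (∀ A ∈ F, ¬ A ⊆ W) ∧ k^(r-1) * U.card ≤ k^r * W.card + F.card := by
  obtain ⟨k, rfl⟩ : ∃ k', k = k'+1 := ⟨k-1, by omega⟩
  set Z : (V → Fin (k+1)) → Finset V := fun χ => univ.filter (fun v => χ v = 0) with hZ
  have key : ∃ χ : V → Fin (k+1), (k+1)^(r-1) * U.card + (k+1)^r * (F.filter (fun A => A ⊆ Z χ)).card
       ≤ (k+1)^r * (U ∩ Z χ).card + F.card := by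
    have : ∑ χ : V → Fin (k+1), ((k+1)^(r-1) * U.card + (k+1)^r * (F.filter (fun A => A ⊆ Z χ)).card)
       ≤ ∑ χ : V → Fin (k+1), ((k+1)^r * (U ∩ Z χ).card + F.card) := by
      simp only [sum_add_distrib, ← mul_sum]
      have e1 : (k+1) * ∑ χ : V → Fin (k+1), (U ∩ Z χ).card = U.card * (k+1)^(Fintype.card V) := by
        have : ∀ χ : V → Fin (k+1), (U ∩ Z χ).card = ∑ v ∈ U, if χ v = 0 then 1 else 0 := by
          intro χ
          rw [← card_filter]; congr 1; ext; simp [hZ]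
        simp only [this]
        rw [sum_comm, mul_sum, Finset.card_eq_sum_ones, sum_mul]
        refine sum_congr rfl fun v _ => ?_
        have := count_fix k ({v} : Finset V)
        simp at this
        rw [← card_filter, this, one_mul]
      have e2 : (k+1)^r * ∑ χ : V → Fin (k+1), (F.filter (fun A => A ⊆ Z χ)).card
          = F.card * (k+1)^(Fintype.card V) := by
        simp only [card_filter]
        rw [sum_comm, mul_sum]
        rw [Finset.sum_congr rfl (g := fun _ => (k+1)^(Fintype.card V)), sum_const, smul_eq_mul]
        intro A hA
        rw [← count_fix k A, hF A hA, ← card_filter]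
        congr 2
        ext χ; simp [hZ, subset_iff]
      have e3 : (k+1)^r = (k+1)^(r-1) * (k+1) := by
        rw [← pow_succ]; congr 1; omega
      have e4 : (k+1)^r * ∑ χ : V → Fin (k+1), (U ∩ Z χ).card = (k+1)^(r-1) * (U.card * (k+1)^(Fintype.card V)) := by
        rw [← e1, e3]; ring
      rw [e2, e4]
      simp
      apply le_of_eq; ring
    obtain ⟨χ, -, h⟩ := Finset.exists_le_of_sum_le (s := univ) ⟨fun _ => 0, mem_univ _⟩ this
    exact ⟨χ, h⟩
  obtain ⟨χ, hχ⟩ := key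
  have hne : ∀ A ∈ F, A.Nonempty := fun A hA => by
    rw [← card_pos, hF A hA]; omega
  rcases isEmpty_or_nonempty V with hV | hV
  · refine ⟨∅, empty_subset _, fun A hA _ => ?_, ?_⟩
    · exact isEmptyElim (hne A hA).choose
    · rw [Finset.eq_empty_of_isEmpty U]; simp
  classical
  choose! g hg using hne
  set B := (F.filter (fun A => A ⊆ Z χ)).image g
  refine ⟨(U ∩ Z χ) \ B, ?_, ?_, ?_⟩
  · exact sdiff_subset.trans inter_subset_left
  · intro A hA hAW
    have h1 : A ⊆ Z χ := hAW.trans (sdiff_subset.trans inter_subset_right)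
    have h2 := hAW (hg A hA)
    rw [mem_sdiff] at h2
    exact h2.2 (mem_image_of_mem _ (mem_filter.2 ⟨hA, h1⟩))
  · have hB : B.card ≤ (F.filter (fun A => A ⊆ Z χ)).card := card_image_le
    have h3 : (U ∩ Z χ).card ≤ ((U ∩ Z χ) \ B).card + B.card := by
      have := le_card_sdiff B (U ∩ Z χ); omega
    have h4 : (k+1)^r * (U ∩ Z χ).card ≤ (k+1)^r * (((U ∩ Z χ) \ B).card + (F.filter (fun A => A ⊆ Z χ)).card) :=
      Nat.mul_le_mul_left _ (by omega)
    rw [mul_add] at h4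
    omega
end ModPA1

section ModPA2
open Finset

section
variable {V : Type*} [Fintype V] [DecidableEq V] (G : SimpleGraph V) [DecidableRel G.Adj]

theorem common_card_le (r m : ℕ) (hG : G.CliqueFree (r+2))
    (hm : ∀ A : Finset V, G.CliqueFreeOn A r → A.card ≤ m) (x y : V) (h : G.Adj x y) :
    (G.neighborFinset x ∩ G.neighborFinset y).card ≤ m := by
  apply hm
  intro t ht hc
  have h1 : G.IsNClique (r+1) (insert y t) := hc.insert (fun b hb => by
    have := ht hb; simp at this; exact this.2)
  have h2 : G.IsNClique (r+1+1) (insert x (insert y t)) := h1.insert (fun b hb => by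
    rcases mem_insert.1 hb with rfl | hb
    · exact h
    · have := ht hb; simp at this; exact this.1)
  exact hG _ h2

theorem clique_count_succ (m j : ℕ) (hj : 2 ≤ j)
    (hc : ∀ x y, G.Adj x y → (G.neighborFinset x ∩ G.neighborFinset y).card ≤ m) :
    (G.cliqueFinset (j+1)).card ≤ (G.cliqueFinset j).card * m := by
  have hsub : G.cliqueFinset (j+1) ⊆ (G.cliqueFinset j).biUnion
      (fun K => (univ.filter (fun v => ∀ u ∈ K, G.Adj v u)).image (fun v => insert v K)) := by
    intro T hT
    rw [SimpleGraph.mem_cliqueFinset_iff] at hT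
    have hne : T.Nonempty := by rw [← card_pos, hT.2]; omega
    obtain ⟨v, hv⟩ := hne
    rw [mem_biUnion]
    refine ⟨T.erase v, ?_, ?_⟩
    · rw [SimpleGraph.mem_cliqueFinset_iff]
      refine ⟨?_, by rw [card_erase_of_mem hv, hT.2]; omega⟩
      exact hT.1.subset (by simp)
    · rw [mem_image]
      refine ⟨v, ?_, insert_erase hv⟩
      simp only [mem_filter, mem_univ, true_and, mem_erase]
      rintro u ⟨hu, huT⟩
      exact hT.1 hv huT hu.symm
  refine (card_le_card hsub).trans ?_
  refine card_biUnion_le_card_mul _ _ _ fun K hK => card_image_le.trans ?_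
  rw [SimpleGraph.mem_cliqueFinset_iff] at hK
  obtain ⟨x, hx, y, hy, hxy⟩ := Finset.one_lt_card.1 (by rw [hK.2]; omega : 1 < K.card)
  refine le_trans (card_le_card ?_) (hc x y (hK.1 hx hy hxy))
  intro v hv
  simp at hv ⊢
  exact ⟨(hv x hx).symm, (hv y hy).symm⟩

theorem clique_count (m j : ℕ) 
    (hc : ∀ x y, G.Adj x y → (G.neighborFinset x ∩ G.neighborFinset y).card ≤ m) :
    (G.cliqueFinset (j+2)).card ≤ (G.cliqueFinset 2).card * m^j := by
  induction j with
  | zero => simp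
  | succ j ih =>
    calc _ ≤ (G.cliqueFinset (j+2)).card * m := clique_count_succ G m (j+2) (by omega) hc
      _ ≤ _ := by rw [pow_succ, ← mul_assoc]; gcongr

/-- ordered adjacent pairs -/
def adjPairs : Finset (V × V) := univ.filter (fun p => G.Adj p.1 p.2)

theorem clique2_le : (G.cliqueFinset 2).card ≤ (adjPairs G).card := by
  have : G.cliqueFinset 2 ⊆ (adjPairs G).image (fun p => {p.1, p.2}) := by
    intro T hT
    rw [SimpleGraph.mem_cliqueFinset_iff] at hT
    obtain ⟨x, y, hxy, rfl⟩ := card_eq_two.1 hT.2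
    rw [mem_image]
    exact ⟨(x,y), by simp [adjPairs]; exact hT.1 (by simp) (by simp) hxy, rfl⟩
  exact (card_le_card this).trans card_image_le

theorem step2 (t m k : ℕ) (hk : 1 ≤ k) (hG : G.CliqueFree (t+2+2))
    (hm : ∀ A : Finset V, G.CliqueFreeOn A (t+2) → A.card ≤ m) :
    k^(t+1) * Fintype.card V ≤ k^(t+2) * m + (adjPairs G).card * m^t := by
  obtain ⟨W, -, hW, h⟩ := color_lemma (t+2) k hk univ (G.cliqueFinset (t+2)) (by omega)
    (fun A hA => ((SimpleGraph.mem_cliqueFinset_iff (G := G)).1 hA).2)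
  have h1 := hm W (fun T hT hc => hW T ((SimpleGraph.mem_cliqueFinset_iff (G := G)).2 hc) (by exact_mod_cast hT))
  have h2 := clique_count G m t (common_card_le G _ m hG hm)
  have h3 := clique2_le G
  simp only [card_univ, show t+2-1 = t+1 by omega] at h
  refine h.trans (add_le_add (Nat.mul_le_mul_left _ h1) (h2.trans (Nat.mul_le_mul_right _ h3)))

theorem step1 (t m k : ℕ) (hk : 1 ≤ k) (hG : G.CliqueFree (t+2+2))
    (hm : ∀ A : Finset V, G.CliqueFreeOn A (t+2) → A.card ≤ m) :
    k * (adjPairs G).card^2 ≤ k^2 * m * (Fintype.card V)^3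
      + Fintype.card V * (adjPairs G).card * m^2 := by
  have hc := common_card_le G _ m hG hm
  set U : V → V → Finset V := fun a b => G.neighborFinset a ∩ G.neighborFinset b with hU
  have h1 : ∀ a b, k * (U a b).card ≤ k^2 * m + ((G.cliqueFinset 2).filter (fun e => e ⊆ U a b)).card := by
    intro a b
    obtain ⟨W, hWU, hW, h⟩ := color_lemma 2 k hk (U a b) ((G.cliqueFinset 2).filter (fun e => e ⊆ U a b)) (by omega)
      (fun A hA => ((SimpleGraph.mem_cliqueFinset_iff (G := G)).1 (mem_filter.1 hA).1).2)
    have : W.card ≤ m := by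
      apply hm
      have h2 : G.CliqueFreeOn W 2 := by
        intro T hT hc
        have hT : T ⊆ W := by exact_mod_cast hT
        exact hW T (mem_filter.2 ⟨(SimpleGraph.mem_cliqueFinset_iff (G := G)).2 hc, hT.trans hWU⟩) hT
      exact SimpleGraph.CliqueFreeOn.mono G (by omega) h2
    simp at h
    exact h.trans (add_le_add (Nat.mul_le_mul_left _ this) le_rfl)
  have h2 : ∑ a, ∑ b, k * (U a b).card ≤ ∑ a : V, ∑ b : V, (k^2 * m + ((G.cliqueFinset 2).filter (fun e => e ⊆ U a b)).card) :=
    sum_le_sum fun a _ => sum_le_sum fun b _ => h1 a b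
  have e0 : (adjPairs G).card = ∑ v, G.degree v := by
    rw [adjPairs, card_filter, ← univ_product_univ, sum_product]
    refine sum_congr rfl fun v _ => ?_
    rw [← card_filter, ← SimpleGraph.card_neighborFinset_eq_degree]
    congr 1; ext; simp
  have e1 : ∑ a, ∑ b, (U a b).card = ∑ v, (G.degree v)^2 := by
    have : ∀ a b, (U a b).card = ∑ v, (if G.Adj a v then 1 else 0) * (if G.Adj b v then 1 else 0) := by
      intro a b
      simp only [← ite_and, mul_ite, mul_one, mul_zero]
      rw [← card_filter]; congr 1; ext; simp [hU]; tauto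
    simp only [this]
    rw [Finset.sum_congr rfl (fun a _ => sum_comm), sum_comm]
    refine sum_congr rfl fun v _ => ?_
    have : G.degree v = ∑ a, if G.Adj a v then 1 else 0 := by
      rw [← card_filter, ← SimpleGraph.card_neighborFinset_eq_degree]
      congr 1; ext; simp [G.adj_comm]
    rw [this, sq, sum_mul_sum]
  have e2 : ∑ a : V, ∑ b : V, ((G.cliqueFinset 2).filter (fun e => e ⊆ U a b)).card ≤ (adjPairs G).card * m^2 := by
    simp only [card_filter]
    rw [Finset.sum_congr rfl (fun a _ => sum_comm), sum_comm]
    refine le_trans (sum_le_card_nsmul _ _ (m^2) ?_) (by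
      rw [smul_eq_mul]; exact Nat.mul_le_mul_right _ (clique2_le G))
    intro e he
    rw [SimpleGraph.mem_cliqueFinset_iff] at he
    obtain ⟨x, y, hxy, rfl⟩ := card_eq_two.1 he.2
    have hadj : G.Adj x y := he.1 (by simp) (by simp) hxy
    calc ∑ a, ∑ b, (if {x, y} ⊆ U a b then 1 else 0) ≤ 
        ∑ a, ∑ b, (if a ∈ G.neighborFinset x ∩ G.neighborFinset y then 1 else 0) *
          (if b ∈ G.neighborFinset x ∩ G.neighborFinset y then 1 else 0) := by
          refine sum_le_sum fun a _ => sum_le_sum fun b _ => ?_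
          simp only [← ite_and, mul_ite, mul_one, mul_zero]
          apply le_of_eq
          congr 1
          simp [hU, insert_subset_iff, G.adj_comm]; tauto
      _ = (G.neighborFinset x ∩ G.neighborFinset y).card^2 := by
          rw [← sum_mul_sum, ← card_filter, sq, filter_mem_eq_inter, univ_inter]
      _ ≤ m^2 := Nat.pow_le_pow_left (hc x y hadj) 2
  have e3 : (∑ v, G.degree v)^2 ≤ Fintype.card V * ∑ v, (G.degree v)^2 := by
    have := sq_sum_le_card_mul_sum_sq (s := (univ : Finset V)) (f := fun v => G.degree v)
    simpa using this
  simp only [sum_add_distrib, ← mul_sum, sum_const, card_univ, smul_eq_mul] at h2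
  rw [e1] at h2
  rw [← e0] at e3
  set N := Fintype.card V
  set D := (adjPairs G).card
  calc k * D^2 ≤ k * (N * ∑ v, (G.degree v)^2) := Nat.mul_le_mul_left _ e3
    _ = N * (k * ∑ v, (G.degree v)^2) := by ring
    _ ≤ N * (N * (N * (k^2*m)) + D * m^2) := Nat.mul_le_mul_left _ (h2.trans (by nlinarith [e2]))
    _ = _ := by ring
end

theorem partA_num (t N m D : ℕ) (hm : 1 ≤ m) (h1 : ∀ k, 1 ≤ k → k * D^2 ≤ k^2 * m * N^3 + N * D * m^2)
    (h2 : ∀ k, 1 ≤ k → k^(t+1) * N ≤ k^(t+2) * m + D * m^t) :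
    N^(3*t+2) ≤ (4*(2*4^(t+1))^2)^(3*t+2) * 8 * (2*4^(t+1))^3 * m^(6*t+6) := by
  set C := 2*4^(t+1) with hC
  have hC1 : 1 ≤ C := by
    have : 0 < 4^(t+1) := by positivity
    omega
  by_cases hN : N < 2*m
  · calc N^(3*t+2) ≤ (2*m)^(3*t+2) := Nat.pow_le_pow_left hN.le _
      _ = 2^(3*t+2) * m^(3*t+2) := by rw [mul_pow]
      _ ≤ (4*C^2)^(3*t+2) * m^(6*t+6) := by
        refine Nat.mul_le_mul (Nat.pow_le_pow_left (by nlinarith) _) (Nat.pow_le_pow_right hm (by omega))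
      _ ≤ _ := by
        gcongr
        rw [mul_assoc]
        exact Nat.le_mul_of_pos_right _ (by positivity)
  push Not at hN
  have hN0 : 0 < N := by omega
  have A2 : N^(t+2) ≤ C * D * m^(2*t+1) := by
    set k := N/(2*m) with hk
    have hk1 : 1 ≤ k := (Nat.one_le_div_iff (by omega)).2 hN
    have a1 : k * (2*m) ≤ N := Nat.div_mul_le_self _ _
    have a2 : N ≤ k * (4*m) := by
      have := Nat.lt_div_mul_add (a := N) (b := 2*m) (by omega)
      nlinarith
    have a3 := h2 k hk1
    have a4 : k^(t+1) * N ≤ 2 * (D * m^t) := by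
      have : 2 * (k^(t+2)*m) ≤ k^(t+1) * N := by
        calc 2 * (k^(t+2)*m) = k^(t+1) * (k * (2*m)) := by ring
          _ ≤ _ := Nat.mul_le_mul_left _ a1
      omega
    calc N^(t+2) = N^(t+1) * N := by ring
      _ ≤ (k*(4*m))^(t+1) * N := by gcongr
      _ = (4*m)^(t+1) * (k^(t+1) * N) := by ring
      _ ≤ (4*m)^(t+1) * (2 * (D * m^t)) := by gcongr
      _ = _ := by rw [hC]; ring
  have hD : 0 < D := by
    rcases Nat.eq_zero_or_pos D with h | h
    · rw [h] at A2; simp at A2; omega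
    · exact h
  have A1 : D^3 ≤ 8 * N^4 * m^3 ∨ D^2 ≤ 4 * m * N^3 := by
    set k := 2*N*m^2/D + 1 with hk
    have a1 : 2*N*m^2 ≤ k * D := by
      have := Nat.lt_div_mul_add (a := 2*N*m^2) (b := D) hD
      rw [hk]; nlinarith
    have a2 : k * D ≤ 2*N*m^2 + D := by
      have := Nat.div_mul_le_self (2*N*m^2) D
      rw [hk]; nlinarith
    have hk1 : 1 ≤ k := by rw [hk]; exact Nat.le_add_left _ _
    have a3 := h1 k hk1
    have a4 : D^2 ≤ 2 * k * m * N^3 := by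
      have : 2 * (N * D * m^2) ≤ k * D^2 := by nlinarith
      have : k * D^2 ≤ k * (2 * k * m * N^3) := by nlinarith
      exact Nat.le_of_mul_le_mul_left this hk1
    have a5 : D^3 ≤ 4 * N^4*m^3 + 2*m*N^3*D := by
      calc D^3 = D^2 * D := by ring
        _ ≤ 2 * k * m * N^3 * D := Nat.mul_le_mul_right _ a4
        _ = (k * D) * (2*m*N^3) := by ring
        _ ≤ (2*N*m^2 + D) * (2*m*N^3) := Nat.mul_le_mul_right _ a2
        _ = _ := by ring
    by_cases h : 4 * N^4*m^3 ≤ 2*m*N^3*D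
    · right
      have : D * D^2 ≤ D * (4 * m * N^3) := by nlinarith
      exact Nat.le_of_mul_le_mul_left this hD
    · left; nlinarith
  rcases A1 with A1 | A1
  · have : N^4 * N^(3*t+2) ≤ N^4 * (8 * C^3 * m^(6*t+6)) := by
      calc N^4 * N^(3*t+2) = (N^(t+2))^3 := by ring
        _ ≤ (C * D * m^(2*t+1))^3 := Nat.pow_le_pow_left A2 3
        _ = C^3 * D^3 * m^(6*t+3) := by ring
        _ ≤ C^3 * (8 * N^4 * m^3) * m^(6*t+3) := by gcongr
        _ = _ := by ring
    have := Nat.le_of_mul_le_mul_left this (by positivity)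
    refine this.trans ?_
    gcongr
    exact Nat.le_mul_of_pos_left _ (by positivity)
  · have : N^3 * N^(2*t+1) ≤ N^3 * (4 * C^2 * m^(4*t+3)) := by
      calc N^3 * N^(2*t+1) = (N^(t+2))^2 := by ring
        _ ≤ (C * D * m^(2*t+1))^2 := Nat.pow_le_pow_left A2 2
        _ = C^2 * D^2 * m^(4*t+2) := by ring
        _ ≤ C^2 * (4 * m * N^3) * m^(4*t+2) := by gcongr
        _ = _ := by ring
    have h3 := Nat.le_of_mul_le_mul_left this (by positivity)
    have h4 : (N^(3*t+2))^(2*t+1) ≤ ((4*C^2)^(3*t+2) * m^(6*t+6))^(2*t+1) := by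
      calc (N^(3*t+2))^(2*t+1) = (N^(2*t+1))^(3*t+2) := by rw [← pow_mul, ← pow_mul, mul_comm]
        _ ≤ (4 * C^2 * m^(4*t+3))^(3*t+2) := Nat.pow_le_pow_left h3 _
        _ = (4*C^2)^(3*t+2) * m^((4*t+3)*(3*t+2)) := by rw [mul_pow, ← pow_mul m]
        _ ≤ ((4*C^2)^(3*t+2))^(2*t+1) * m^((6*t+6)*(2*t+1)) := by
          refine Nat.mul_le_mul (Nat.le_self_pow (by omega) _) (Nat.pow_le_pow_right hm (by nlinarith))
        _ = _ := by rw [pow_mul m, ← mul_pow]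
    have h5 := (Nat.pow_le_pow_iff_left (by omega)).1 h4
    refine h5.trans ?_
    gcongr
    rw [mul_assoc]
    exact Nat.le_mul_of_pos_right _ (by positivity)

theorem partA (t : ℕ) : ∃ C : ℕ, 0 < C ∧ ∀ (n m : ℕ) (G : SimpleGraph (Fin n)), 1 ≤ n → G.CliqueFree (t+4) →
    (∀ A : Finset (Fin n), G.CliqueFreeOn A (t+2) → A.card ≤ m) → n^(3*t+2) ≤ C * m^(6*t+6) := by
  classical
  refine ⟨(4*(2*4^(t+1))^2)^(3*t+2) * 8 * (2*4^(t+1))^3, by positivity, ?_⟩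
  intro n m G hn hG hm
  have hm1 : 1 ≤ m := by
    have := hm {⟨0, hn⟩} (by
      intro T hT hc
      have h1 := Finset.card_le_card (show T ⊆ {⟨0, hn⟩} by exact_mod_cast hT)
      rw [hc.2] at h1; simp at h1)
    simpa using this
  refine partA_num t n m (adjPairs G).card hm1 ?_ ?_
  · intro k hk
    simpa using step1 G t m k hk hG hm
  · intro k hk
    simpa using step2 G t m k hk hG hm
end ModPA2

section ModPD
open Finset

theorem er_bdd {n : ℕ} (G : SimpleGraph (Fin n)) (s : ℕ) :
    BddAbove { m : ℕ | ∃ A : Finset (Fin n), A.card = m ∧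
      (G.induce (A : Set (Fin n))).CliqueFree s } := by
  refine ⟨n, ?_⟩
  rintro m ⟨A, rfl, -⟩
  simpa using Finset.card_le_univ A

theorem er_le (s t n k : ℕ) (G : SimpleGraph (Fin n)) (hG : G.CliqueFree t)
    (h : ∀ A : Finset (Fin n), G.CliqueFreeOn A s → A.card ≤ k) : erdosRogers s t n ≤ k := by
  unfold erdosRogers
  refine le_trans (Nat.sInf_le ⟨G, hG, rfl⟩) ?_
  apply csSup_le'
  rintro m ⟨A, rfl, hA⟩
  exact h A ((SimpleGraph.cliqueFree_induce_iff _ _ _).1 hA)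

theorem er_attained (s t n : ℕ) (ht : 2 ≤ t) : ∃ G : SimpleGraph (Fin n), G.CliqueFree t ∧
    ∀ A : Finset (Fin n), G.CliqueFreeOn A s → A.card ≤ erdosRogers s t n := by
  have hne : { k : ℕ | ∃ G : SimpleGraph (Fin n), G.CliqueFree t ∧
    k = sSup { m : ℕ | ∃ A : Finset (Fin n), A.card = m ∧
      (G.induce (A : Set (Fin n))).CliqueFree s } }.Nonempty :=
    ⟨_, ⊥, SimpleGraph.cliqueFree_bot ht, rfl⟩
  obtain ⟨G, hG, h⟩ := Nat.sInf_mem hne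
  refine ⟨G, hG, fun A hA => ?_⟩
  have : erdosRogers s t n = _ := h
  rw [this]
  exact le_csSup (er_bdd G s) ⟨A, rfl, (SimpleGraph.cliqueFree_induce_iff _ _ _).2 hA⟩

theorem er_pos (s t n : ℕ) (hs : 2 ≤ s) (ht : 2 ≤ t) (hn : 1 ≤ n) : 1 ≤ erdosRogers s t n := by
  obtain ⟨G, -, h⟩ := er_attained s t n ht
  have := h {⟨0, hn⟩} (by
      intro T hT hc
      have h1 := Finset.card_le_card (show T ⊆ {⟨0, hn⟩} by exact_mod_cast hT)
      rw [hc.2] at h1; simp at h1; omega)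
  simpa using this

theorem er_le_of_le (s t n N k : ℕ) (hn : n ≤ N) (G : SimpleGraph (Fin N)) (hG : G.CliqueFree t)
    (h : ∀ A : Finset (Fin N), G.CliqueFreeOn A s → A.card ≤ k) : erdosRogers s t n ≤ k := by
  refine er_le s t n k (G.comap (Fin.castLEEmb hn)) ?_ ?_
  · exact SimpleGraph.CliqueFree.comap (SimpleGraph.Embedding.comap (Fin.castLEEmb hn) G).isContained hG
  · intro A hA
    rw [← card_map (Fin.castLEEmb hn)]
    apply h
    intro T hT hc
    have hT : T ⊆ A.map (Fin.castLEEmb hn) := by exact_mod_cast hT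
    obtain ⟨B, hB, rfl⟩ := Finset.subset_map_iff.1 hT
    refine hA (t := B) (by exact_mod_cast hB) ?_
    refine ⟨?_, by rw [← hc.2, card_map]⟩
    intro x hx y hy hxy
    exact hc.1 (by simpa using hx) (by simpa using hy) (by simpa using hxy)

theorem finish (s : ℕ) (hs : 4 ≤ s)
    (hB : ∃ a μ : ℕ, 0 < a ∧ 6*s*μ < (3*s-1)*a ∧ ∃ Z : ℕ, ∀ z ≥ Z, ∃ G : SimpleGraph (Fin (z^a)),
      G.CliqueFree (s+3) ∧ ∀ A : Finset (Fin (z^a)), G.CliqueFreeOn A s → A.card ≤ z^μ) :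
    Filter.Tendsto (fun n : ℕ => (erdosRogers (s + 1) (s + 3) n : ℝ) / (erdosRogers s (s + 3) n : ℝ))
      Filter.atTop Filter.atTop := by
  obtain ⟨a, μ, ha, haμ, Z, hZ⟩ := hB
  obtain ⟨C, hC, hA⟩ := partA (s-1)
  rw [Filter.tendsto_atTop]
  intro R
  obtain ⟨R', hR'⟩ := exists_nat_ge R
  set z0 := max (max Z 1) (R'^(6*s)*C*2^(6*s*μ)+1) with hz0
  filter_upwards [Filter.eventually_ge_atTop (z0^a)] with n hn
  have hz01 : 1 ≤ z0 := (le_max_right Z 1).trans (le_max_left _ _)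
  have hn1 : 1 ≤ n := (Nat.one_le_pow _ _ hz01).trans hn
  -- find z
  obtain ⟨z, hz, hz1, hz2⟩ : ∃ z, z0 ≤ z ∧ z^a ≤ n ∧ n ≤ (z+1)^a := by
    have hex : ∃ k, n < (k+1)^a := ⟨n, lt_of_lt_of_le (Nat.lt_succ_self n) (Nat.le_self_pow (by omega) _)⟩
    refine ⟨Nat.find hex, ?_, ?_, (Nat.find_spec hex).le⟩
    · by_contra hlt
      push Not at hlt
      have h1 := Nat.find_spec hex
      have : (Nat.find hex + 1)^a ≤ z0^a := Nat.pow_le_pow_left hlt a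
      omega
    · by_contra hlt
      push Not at hlt
      rcases Nat.eq_zero_or_pos (Nat.find hex) with h0 | h0
      · rw [h0, zero_pow (by omega)] at hlt; omega
      · exact Nat.find_min hex (m := Nat.find hex - 1) (by omega) (by rwa [Nat.sub_add_cancel h0])
  have hf2 : erdosRogers s (s+3) n ≤ (z+1)^μ := by
    obtain ⟨G, hG, h⟩ := hZ (z+1) (by have := le_max_left Z 1; have := le_max_left (max Z 1) (R'^(6*s)*C*2^(6*s*μ)+1); omega)
    exact er_le_of_le s (s+3) n _ _ hz2 G hG h
  have hf1 : n^(3*s-1) ≤ C * (erdosRogers (s+1) (s+3) n)^(6*s) := by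
    obtain ⟨G, hG, h⟩ := er_attained (s+1) (s+3) n (by omega)
    have := hA n (erdosRogers (s+1) (s+3) n) G hn1 (by rwa [show s-1+4 = s+3 by omega])
      (by rwa [show s-1+2 = s+1 by omega])
    rwa [show 3*(s-1)+2 = 3*s-1 by omega, show 6*(s-1)+6 = 6*s by omega] at this
  have hpos := er_pos s (s+3) n (by omega) (by omega) hn1
  have key : R' * erdosRogers s (s+3) n ≤ erdosRogers (s+1) (s+3) n := by
    by_contra hlt
    push Not at hlt
    have hz3 : R'^(6*s)*C*2^(6*s*μ) + 1 ≤ z := (le_max_right _ _).trans hz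
    have h1 : (erdosRogers (s+1) (s+3) n)^(6*s) ≤ (R' * (z+1)^μ)^(6*s) :=
      Nat.pow_le_pow_left (hlt.le.trans (Nat.mul_le_mul_left _ hf2)) _
    have hz0' : 1 ≤ z := hz01.trans hz
    have h2 : (R' * (z+1)^μ)^(6*s) ≤ R'^(6*s) * (2^(6*s*μ) * z^(6*s*μ)) := by
      rw [mul_pow, ← pow_mul, ← mul_pow, mul_comm μ]
      exact Nat.mul_le_mul_left _ (Nat.pow_le_pow_left (by omega) _)
    have h3 : z * z^(6*s*μ) ≤ n^(3*s-1) := by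
      calc z * z^(6*s*μ) = z^(6*s*μ+1) := by ring
        _ ≤ z^((3*s-1)*a) := Nat.pow_le_pow_right hz0' haμ
        _ = (z^a)^(3*s-1) := by rw [← pow_mul, mul_comm]
        _ ≤ _ := Nat.pow_le_pow_left hz1 _
    have h4 : z * z^(6*s*μ) ≤ (R'^(6*s)*C*2^(6*s*μ)) * z^(6*s*μ) := by
      calc z * z^(6*s*μ) ≤ C * (R'^(6*s) * (2^(6*s*μ) * z^(6*s*μ))) :=
            h3.trans (hf1.trans (Nat.mul_le_mul_left _ (h1.trans h2)))
        _ = _ := by ring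
    have := Nat.le_of_mul_le_mul_right h4 (by positivity)
    omega
  rw [le_div_iff₀ (by exact_mod_cast hpos)]
  calc R * (erdosRogers s (s+3) n : ℝ) ≤ R' * (erdosRogers s (s+3) n : ℝ) := by gcongr
    _ ≤ _ := by exact_mod_cast key
end ModPD

section ModPProb
open Finset

/-- uniform expectation over a finite type -/
noncomputable def Ex {Ω : Type*} [Fintype Ω] (f : Ω → ℝ) : ℝ := (∑ ω, f ω) / Fintype.card Ω

section
variable {Ω : Type*} [Fintype Ω]

theorem Ex_mono {f g : Ω → ℝ} (h : ∀ ω, f ω ≤ g ω) : Ex f ≤ Ex g := by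
  unfold Ex
  gcongr with ω
  exact h ω

theorem Ex_nonneg {f : Ω → ℝ} (h : ∀ ω, 0 ≤ f ω) : 0 ≤ Ex f := by
  unfold Ex
  have := Finset.sum_nonneg (s := univ) (fun ω _ => h ω)
  positivity

theorem Ex_const [Nonempty Ω] (c : ℝ) : Ex (fun _ : Ω => c) = c := by
  unfold Ex
  have : (Fintype.card Ω : ℝ) ≠ 0 := by exact_mod_cast Fintype.card_ne_zero
  simp

theorem Ex_le_const [Nonempty Ω] {f : Ω → ℝ} {c : ℝ} (h : ∀ ω, f ω ≤ c) : Ex f ≤ c :=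
  (Ex_mono h).trans (Ex_const c).le

theorem Ex_add (f g : Ω → ℝ) : Ex (fun ω => f ω + g ω) = Ex f + Ex g := by
  unfold Ex; rw [sum_add_distrib, add_div]

theorem Ex_sub (f g : Ω → ℝ) : Ex (fun ω => f ω - g ω) = Ex f - Ex g := by
  unfold Ex; rw [sum_sub_distrib, sub_div]

theorem Ex_mul_left (c : ℝ) (f : Ω → ℝ) : Ex (fun ω => c * f ω) = c * Ex f := by
  unfold Ex; rw [← mul_sum, mul_div_assoc]

theorem Ex_mul_right (c : ℝ) (f : Ω → ℝ) : Ex (fun ω => f ω * c) = Ex f * c := by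
  unfold Ex; rw [← sum_mul]; ring

theorem Ex_sum {κ : Type*} (s : Finset κ) (f : κ → Ω → ℝ) :
    Ex (fun ω => ∑ k ∈ s, f k ω) = ∑ k ∈ s, Ex (f k) := by
  unfold Ex; rw [sum_comm, sum_div]

theorem Ex_comm {Ω' : Type*} [Fintype Ω'] (f : Ω → Ω' → ℝ) :
    Ex (fun ω => Ex (fun ω' => f ω ω')) = Ex (fun ω' => Ex (fun ω => f ω ω')) := by
  unfold Ex
  simp only [← sum_div]
  rw [sum_comm, div_right_comm]

theorem exists_lt_of_Ex_lt {f : Ω → ℝ} {c : ℝ} [Nonempty Ω] (h : Ex f < c) : ∃ ω, f ω < c := by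
  by_contra hc
  push Not at hc
  have := Ex_mono hc
  rw [Ex_const] at this
  linarith

theorem Ex_prod {ι α : Type*} [Fintype ι] [DecidableEq ι] [Fintype α] (f : ι → α → ℝ) :
    Ex (fun ω : ι → α => ∏ i, f i (ω i)) = ∏ i, Ex (f i) := by
  unfold Ex
  rw [prod_div_distrib, Finset.prod_univ_sum]
  simp [Fintype.piFinset_univ]

theorem Ex_equiv {Ω' : Type*} [Fintype Ω'] (e : Ω ≃ Ω') (f : Ω' → ℝ) :
    Ex (fun ω => f (e ω)) = Ex f := by
  unfold Ex
  rw [Fintype.card_congr e, Equiv.sum_comp e f]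

theorem Ex_resample {ι α : Type*} [Fintype ι] [DecidableEq ι] [Fintype α] (U : Finset ι)
    (F : (ι → α) → ℝ) :
    Ex F = Ex (fun ω => Ex (fun ω' => F (U.piecewise ω' ω))) := by
  rcases isEmpty_or_nonempty (ι → α) with hE | hE
  · unfold Ex; simp
  have hc : (Fintype.card (ι → α) : ℝ) ≠ 0 := by exact_mod_cast Fintype.card_ne_zero
  have key : ∑ p : (ι → α) × (ι → α), F (U.piecewise p.2 p.1) = ∑ p : (ι → α) × (ι → α), F p.1 := by
    let e : ((ι → α) × (ι → α)) ≃ ((ι → α) × (ι → α)) :=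
      { toFun := fun p => (U.piecewise p.2 p.1, U.piecewise p.1 p.2)
        invFun := fun p => (U.piecewise p.2 p.1, U.piecewise p.1 p.2)
        left_inv := by
          intro p; ext i
          · by_cases hi : i ∈ U <;> simp [Finset.piecewise, hi]
          · by_cases hi : i ∈ U <;> simp [Finset.piecewise, hi]
        right_inv := by
          intro p; ext i
          · by_cases hi : i ∈ U <;> simp [Finset.piecewise, hi]
          · by_cases hi : i ∈ U <;> simp [Finset.piecewise, hi] }
    exact Equiv.sum_comp e (fun p => F p.1)
  rw [Fintype.sum_prod_type, Fintype.sum_prod_type] at key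
  simp only [sum_const, card_univ, nsmul_eq_mul, ← mul_sum] at key
  unfold Ex
  rw [← sum_div, key]
  field_simp

theorem Ex_indep {ι α : Type*} [Fintype ι] [DecidableEq ι] [Fintype α] [Nonempty α] (U : Finset ι)
    (f g : (ι → α) → ℝ) (hf : ∀ ω ω', (∀ i ∈ U, ω i = ω' i) → f ω = f ω')
    (hg : ∀ ω ω', (∀ i ∉ U, ω i = ω' i) → g ω = g ω') :
    Ex (fun ω => f ω * g ω) = Ex f * Ex g := by
  rw [Ex_resample U]
  have : ∀ ω ω' : ι → α, f (U.piecewise ω' ω) * g (U.piecewise ω' ω) = f ω' * g ω := by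
    intro ω ω'
    rw [hf (U.piecewise ω' ω) ω' (fun i hi => by simp [hi]),
      hg (U.piecewise ω' ω) ω (fun i hi => by simp [hi])]
  simp only [this]
  simp only [Ex_mul_right, Ex_mul_left]

theorem Ex_prod_disjoint {ι α κ : Type*} [Fintype ι] [DecidableEq ι] [Fintype α] [Nonempty α]
    [DecidableEq κ]
    (I : Finset κ) (N : κ → Finset ι) (hN : ∀ i ∈ I, ∀ j ∈ I, i ≠ j → Disjoint (N i) (N j))
    (f : κ → (ι → α) → ℝ) (hf : ∀ k ∈ I, ∀ ω ω', (∀ i ∈ N k, ω i = ω' i) → f k ω = f k ω') :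
    Ex (fun ω => ∏ k ∈ I, f k ω) = ∏ k ∈ I, Ex (f k) := by
  induction I using Finset.induction_on with
  | empty => simp [Ex_const]
  | insert a I ha ih =>
    simp only [prod_insert ha]
    rw [Ex_indep (N a) (f a) (fun ω => ∏ k ∈ I, f k ω) (hf a (mem_insert_self _ _))]
    · rw [ih (fun i hi j hj => hN i (mem_insert_of_mem hi) j (mem_insert_of_mem hj))
        (fun k hk => hf k (mem_insert_of_mem hk))]
    · intro ω ω' h
      refine prod_congr rfl fun k hk => hf k (mem_insert_of_mem hk) _ _ fun i hi => h i ?_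
      have := hN k (mem_insert_of_mem hk) a (mem_insert_self _ _) (by rintro rfl; exact ha hk)
      exact fun hia => (Finset.disjoint_left.1 this) hi hia
end
end ModPProb

section ModPBits
set_option linter.unusedSectionVars false
open Finset

section greedy
variable {κ : Type*} [DecidableEq κ]
theorem greedy_indep (I : Finset κ) (conf : κ → κ → Prop) [DecidableRel conf]
    (hsymm : ∀ i j, conf i j → conf j i) (Q : ℕ)
    (hdeg : ∀ i ∈ I, (I.filter (fun j => conf i j)).card ≤ Q) :
    ∃ J ⊆ I, (∀ i ∈ J, ∀ j ∈ J, i ≠ j → ¬ conf i j) ∧ I.card ≤ (Q+1) * J.card := by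
  set F := I.powerset.filter (fun J => ∀ i ∈ J, ∀ j ∈ J, i ≠ j → ¬ conf i j) with hF
  obtain ⟨J, hJ, hmax⟩ := Finset.exists_max_image F Finset.card ⟨∅, by simp [hF]⟩
  rw [hF, mem_filter, mem_powerset] at hJ
  refine ⟨J, hJ.1, hJ.2, ?_⟩
  have hcov : I ⊆ J.biUnion (fun i => insert i (I.filter (fun j => conf i j))) := by
    intro x hx
    by_contra hcon
    simp only [mem_biUnion, mem_insert, mem_filter, not_exists, not_and, not_or] at hcon
    have hxJ : x ∉ J := fun h => (hcon x h).1 rfl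
    have hmem : insert x J ∈ F := by
      rw [hF, mem_filter, mem_powerset]
      refine ⟨insert_subset hx hJ.1, ?_⟩
      intro i hi j hj hij
      rw [mem_insert] at hi hj
      rcases hi with rfl | hi <;> rcases hj with rfl | hj
      · exact absurd rfl hij
      · exact fun h => (hcon j hj).2 hx (hsymm _ _ h)
      · exact fun h => (hcon i hi).2 hx h
      · exact hJ.2 i hi j hj hij
    have := hmax _ hmem
    rw [card_insert_of_notMem hxJ] at this
    omega
  refine (card_le_card hcov).trans ?_
  rw [mul_comm]
  refine card_biUnion_le_card_mul _ _ _ fun i hi => ?_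
  exact (card_insert_le _ _).trans (by have := hdeg i (hJ.1 hi); omega)
end greedy

section bits
variable {V : Type*} [Fintype V] [DecidableEq V]

/-- unordered pairs of distinct elements of P -/
def prs (P : Finset V) : Finset (Sym2 V) := P.sym2.filter (fun e => ¬ e.IsDiag)

theorem mem_prs {P : Finset V} {x y : V} : s(x,y) ∈ prs P ↔ x ∈ P ∧ y ∈ P ∧ x ≠ y := by
  simp [prs, and_assoc]

theorem prs_card (P : Finset V) : (prs P).card ≤ P.card^2 := by
  refine (card_filter_le _ _).trans ?_
  rw [Finset.card_sym2, Nat.choose_two_right]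
  rcases Nat.eq_zero_or_pos P.card with h | h
  · simp [h]
  · apply Nat.div_le_of_le_mul
    simp only [Nat.add_sub_cancel]
    nlinarith

/-- pairs relevant for R -/
def relp (PP : Finset (Finset V)) (R : Finset V) : Finset (Sym2 V) :=
  prs R ∪ (PP.filter (fun P => (prs P ∩ prs R).Nonempty)).biUnion prs

theorem relp_card (PP : Finset (Finset V)) (R : Finset V) (D t s : ℕ) (hR : R.card = s)
    (hPt : ∀ P ∈ PP, P.card ≤ t)
    (hD : ∀ e : Sym2 V, (PP.filter (fun P => e ∈ prs P)).card ≤ D) :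
    (relp PP R).card ≤ s^2 + s^2*D*t^2 := by
  refine (card_union_le _ _).trans (add_le_add (hR ▸ prs_card R) ?_)
  refine (card_biUnion_le_card_mul _ _ (t^2) fun P hP => ?_).trans ?_
  · exact (prs_card P).trans (Nat.pow_le_pow_left (hPt P (mem_filter.1 hP).1) 2)
  · refine Nat.mul_le_mul_right _ ?_
    have hsub : PP.filter (fun P => (prs P ∩ prs R).Nonempty) ⊆
        (prs R).biUnion (fun e => PP.filter (fun P => e ∈ prs P)) := by
      intro P hP
      rw [mem_filter] at hP
      obtain ⟨e, he⟩ := hP.2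
      rw [mem_inter] at he
      exact mem_biUnion.2 ⟨e, he.2, mem_filter.2 ⟨hP.1, he.1⟩⟩
    refine (card_le_card hsub).trans ((card_biUnion_le_card_mul _ _ D fun e _ => hD e).trans ?_)
    exact Nat.mul_le_mul_right _ (hR ▸ prs_card R)

theorem relp_deg (PP : Finset (Finset V)) (RR : Finset (Finset V)) (D t : ℕ)
    (hPt : ∀ P ∈ PP, P.card ≤ t)
    (hD : ∀ e : Sym2 V, (PP.filter (fun P => e ∈ prs P)).card ≤ D)
    (hRR : ∀ R ∈ RR, ∀ R' ∈ RR, R ≠ R' → Disjoint (prs R) (prs R')) (e : Sym2 V) :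
    (RR.filter (fun R => e ∈ relp PP R)).card ≤ 1 + D * t^2 := by
  have h1 : ∀ e : Sym2 V, (RR.filter (fun R => e ∈ prs R)).card ≤ 1 := by
    intro e
    rw [card_le_one]
    intro R hR R' hR'
    rw [mem_filter] at hR hR'
    by_contra hne
    exact (Finset.disjoint_left.1 (hRR R hR.1 R' hR'.1 hne)) hR.2 hR'.2
  have hsub : RR.filter (fun R => e ∈ relp PP R) ⊆ RR.filter (fun R => e ∈ prs R) ∪
      (PP.filter (fun P => e ∈ prs P)).biUnion (fun P => (prs P).biUnion (fun e' => RR.filter (fun R => e' ∈ prs R))) := by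
    intro R hR
    rw [mem_filter] at hR
    rw [relp, mem_union] at hR
    rcases hR with ⟨hR, h | h⟩
    · exact mem_union_left _ (mem_filter.2 ⟨hR, h⟩)
    · apply mem_union_right
      rw [mem_biUnion] at h
      obtain ⟨P, hP, heP⟩ := h
      rw [mem_filter] at hP
      obtain ⟨e', he'⟩ := hP.2
      rw [mem_inter] at he'
      exact mem_biUnion.2 ⟨P, mem_filter.2 ⟨hP.1, heP⟩, mem_biUnion.2 ⟨e', he'.1, mem_filter.2 ⟨hR, he'.2⟩⟩⟩
  refine (card_le_card hsub).trans ((card_union_le _ _).trans (add_le_add (h1 e) ?_))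
  refine (card_biUnion_le_card_mul _ _ (t^2) fun P hP => ?_).trans (Nat.mul_le_mul_right _ (hD e))
  refine (card_biUnion_le_card_mul _ _ 1 fun e' _ => h1 e').trans ?_
  rw [mul_one]
  exact (prs_card P).trans (Nat.pow_le_pow_left (hPt P (mem_filter.1 hP).1) 2)

/-- the favourable event for R -/
def favor (PP : Finset (Finset V)) (R : Finset V) (η : Sym2 V → Bool) : Prop :=
  ∀ e ∈ relp PP R, η e = decide (e ∉ prs R)

instance (PP : Finset (Finset V)) (R : Finset V) (η : Sym2 V → Bool) : Decidable (favor PP R η) := by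
  unfold favor; infer_instance

theorem Ex_favor (PP : Finset (Finset V)) (R : Finset V) :
    Ex (fun η : Sym2 V → Bool => if favor PP R η then (1:ℝ) else 0) = (1/2)^(relp PP R).card := by
  have h : ∀ η : Sym2 V → Bool, (if favor PP R η then (1:ℝ) else 0) =
      ∏ e, (if e ∈ relp PP R then (if η e = decide (e ∉ prs R) then 1 else 0) else 1) := by
    intro η
    rw [Finset.prod_ite, prod_const_one, mul_one, filter_mem_eq_inter, univ_inter, Finset.prod_ite_zero]
    simp [favor]
  simp only [h]
  rw [Ex_prod (fun (e : Sym2 V) (b : Bool) => if e ∈ relp PP R then (if b = decide (e ∉ prs R) then (1:ℝ) else 0) else 1)]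
  have : ∀ e : Sym2 V, Ex (fun b : Bool => if e ∈ relp PP R then (if b = decide (e ∉ prs R) then (1:ℝ) else 0) else 1)
      = if e ∈ relp PP R then 1/2 else 1 := by
    intro e
    split_ifs
    · unfold Ex
      generalize decide (e ∉ prs R) = c
      cases c <;> simp
    · exact Ex_const 1
  simp only [this]
  rw [Finset.prod_ite, prod_const_one, mul_one, filter_mem_eq_inter, univ_inter, prod_const]

/-- The final graph. -/
def finalG (G0 : SimpleGraph V) (PP : Finset (Finset V)) (η : Sym2 V → Bool) : SimpleGraph V where
  Adj x y := G0.Adj x y ∧ η s(x,y) = false ∧ ∀ P ∈ PP, x ∈ P → y ∈ P → ∃ e ∈ prs P, η e = true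
  symm := ⟨by
    rintro x y ⟨h1, h2, h3⟩
    exact ⟨h1.symm, by rwa [Sym2.eq_swap], fun P hP hy hx => h3 P hP hx hy⟩⟩
  loopless := ⟨fun x h => G0.loopless.1 x h.1⟩

theorem finalG_free (G0 : SimpleGraph V) (PP : Finset (Finset V)) (η : Sym2 V → Bool) (k : ℕ)
    (h2 : ∀ P ∈ PP, 2 ≤ P.card)
    (hcl : ∀ T : Finset V, G0.IsNClique k T → ∃ P ∈ PP, P ⊆ T) : (finalG G0 PP η).CliqueFree k := by
  intro T hT
  obtain ⟨P, hP, hPT⟩ := hcl T ⟨fun x hx y hy hxy => (hT.1 hx hy hxy).1, hT.2⟩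
  obtain ⟨x, hx, y, hy, hxy⟩ := Finset.one_lt_card.1 (h2 P hP)
  obtain ⟨e, he, h⟩ := (hT.1 (hPT hx) (hPT hy) hxy).2.2 P hP hx hy
  induction e using Sym2.ind with
  | _ u v =>
    rw [mem_prs] at he
    have := (hT.1 (hPT he.1) (hPT he.2.1) he.2.2).2.1
    rw [this] at h; simp at h

theorem favor_clique (G0 : SimpleGraph V) (PP : Finset (Finset V)) (η : Sym2 V → Bool) (s : ℕ)
    (R : Finset V) (hR : G0.IsNClique s R) (hP : ∀ P ∈ PP, ¬ P ⊆ R) (hf : favor PP R η) :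
    (finalG G0 PP η).IsNClique s R := by
  refine ⟨?_, hR.2⟩
  intro x hx y hy hxy
  have hmem : s(x,y) ∈ prs R := mem_prs.2 ⟨hx, hy, hxy⟩
  refine ⟨hR.1 hx hy hxy, ?_, ?_⟩
  · rw [hf _ (mem_union_left _ hmem)]; simp [hmem]
  · intro P hPP hxP hyP
    obtain ⟨w, hwP, hwR⟩ := Finset.not_subset.1 (hP P hPP)
    have hxw : x ≠ w := by rintro rfl; exact hwR hx
    refine ⟨s(x,w), mem_prs.2 ⟨hxP, hwP, hxw⟩, ?_⟩
    rw [hf]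
    · simp [mem_prs, hwR]
    · apply mem_union_right
      rw [mem_biUnion]
      refine ⟨P, mem_filter.2 ⟨hPP, ⟨s(x,y), mem_inter.2 ⟨mem_prs.2 ⟨hxP, hyP, hxy⟩, hmem⟩⟩⟩, mem_prs.2 ⟨hxP, hwP, hxw⟩⟩

theorem bits (G0 : SimpleGraph V) (PP : Finset (Finset V)) (s k t D m M : ℕ) (hs : 2 ≤ s)
    (h2 : ∀ P ∈ PP, 2 ≤ P.card) (hPt : ∀ P ∈ PP, P.card ≤ t)
    (hcl : ∀ T : Finset V, G0.IsNClique k T → ∃ P ∈ PP, P ⊆ T)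
    (hD : ∀ e : Sym2 V, (PP.filter (fun P => e ∈ prs P)).card ≤ D)
    (hS : ∀ S : Finset V, S.card = m → ∃ RR : Finset (Finset V), M ≤ RR.card ∧
      (∀ R ∈ RR, R ⊆ S ∧ G0.IsNClique s R ∧ ∀ P ∈ PP, ¬ P ⊆ R) ∧
      (∀ R ∈ RR, ∀ R' ∈ RR, R ≠ R' → Disjoint (prs R) (prs R')))
    (hnum : ((Fintype.card V : ℝ)^m) *
      (1 - (1/2)^(s^2 + s^2*D*t^2))^(M/((s^2+s^2*D*t^2)*(1+D*t^2)+1)) < 1) :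
    ∃ G : SimpleGraph V, G.CliqueFree k ∧ ∀ S : Finset V, S.card = m → ¬ G.CliqueFreeOn S s := by
  set Q0 := s^2 + s^2*D*t^2 with hQ0
  set Q1 := Q0*(1+D*t^2)+1 with hQ1
  have key : ∀ S : Finset V, ∃ f : (Sym2 V → Bool) → ℝ, (∀ η, 0 ≤ f η) ∧
     (S.card = m → (∀ η, (finalG G0 PP η).CliqueFreeOn S s → 1 ≤ f η) ∧ Ex f ≤ (1 - (1/2)^Q0)^(M/Q1)) := by
    intro S
    by_cases hSm : S.card = m
    swap
    · exact ⟨fun _ => 0, fun _ => le_rfl, fun h => absurd h hSm⟩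
    obtain ⟨RR, hM, hR, hdis⟩ := hS S hSm
    obtain ⟨J, hJ, hJind, hJcard⟩ := greedy_indep RR (fun R R' => (relp PP R ∩ relp PP R').Nonempty)
      (fun i j h => by rwa [inter_comm]) (Q0*(1+D*t^2)) (by
        intro R hRR
        have hsub : RR.filter (fun R' => (relp PP R ∩ relp PP R').Nonempty) ⊆
            (relp PP R).biUnion (fun e => RR.filter (fun R' => e ∈ relp PP R')) := by
          intro R' h
          rw [mem_filter] at h
          obtain ⟨e, he⟩ := h.2
          rw [mem_inter] at he
          exact mem_biUnion.2 ⟨e, he.1, mem_filter.2 ⟨h.1, he.2⟩⟩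
        refine (card_le_card hsub).trans ?_
        refine (card_biUnion_le_card_mul _ _ _ (fun e _ => relp_deg PP RR D t hPt hD hdis e)).trans ?_
        exact Nat.mul_le_mul_right _ (relp_card PP R D t s (hR R hRR).2.1.2 hPt hD))
    refine ⟨fun η => ∏ R ∈ J, (1 - if favor PP R η then (1:ℝ) else 0), ?_, fun _ => ⟨?_, ?_⟩⟩
    · intro η
      refine prod_nonneg fun R _ => ?_
      split_ifs <;> norm_num
    · intro η hη
      show (1:ℝ) ≤ ∏ R ∈ J, (1 - if favor PP R η then (1:ℝ) else 0)
      rw [prod_congr rfl (g := fun _ => (1:ℝ))]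
      · simp
      · intro R hRJ
        obtain ⟨hRS, hRc, hRP⟩ := hR R (hJ hRJ)
        have : ¬ favor PP R η := fun hf =>
          hη (by exact_mod_cast hRS) (favor_clique G0 PP η s R hRc hRP hf)
        simp [this]
    · rw [Ex_prod_disjoint J (relp PP)]
      · have hle : ∀ R ∈ J, Ex (fun η : Sym2 V → Bool => 1 - if favor PP R η then (1:ℝ) else 0) ≤ 1 - (1/2)^Q0 := by
          intro R hRJ
          rw [Ex_sub, Ex_const, Ex_favor]
          have := relp_card PP R D t s (hR R (hJ hRJ)).2.1.2 hPt hD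
          have := pow_le_pow_of_le_one (show (0:ℝ) ≤ 1/2 by norm_num) (by norm_num) this
          linarith
        have h0 : ∀ R ∈ J, 0 ≤ Ex (fun η : Sym2 V → Bool => 1 - if favor PP R η then (1:ℝ) else 0) := by
          intro R _
          refine Ex_nonneg fun η => ?_
          split_ifs <;> norm_num
        refine (prod_le_prod h0 hle).trans ?_
        rw [prod_const]
        apply pow_le_pow_of_le_one
        · have : (1/2:ℝ)^Q0 ≤ 1 := pow_le_one₀ (by norm_num) (by norm_num)
          linarith
        · have : (0:ℝ) ≤ (1/2:ℝ)^Q0 := by positivity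
          linarith
        · apply Nat.div_le_of_le_mul
          exact hM.trans hJcard
      · intro i hi j hj hij
        have := hJind i hi j hj hij
        rw [not_nonempty_iff_eq_empty] at this
        exact disjoint_iff_inter_eq_empty.2 this
      · intro R _ η η' h
        have : favor PP R η ↔ favor PP R η' := by
          unfold favor
          exact forall_congr' fun e => forall_congr' fun he => by rw [h e he]
        simp [this]
  choose f hf0 hf using key
  have hE : Ex (fun η => ∑ S ∈ univ.powersetCard m, f S η) < 1 := by
    rw [Ex_sum]
    refine lt_of_le_of_lt (sum_le_card_nsmul _ _ ((1 - (1/2)^Q0)^(M/Q1)) ?_) ?_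
    · intro S hS
      exact (hf S (mem_powersetCard.1 hS).2).2
    · rw [card_powersetCard, card_univ, nsmul_eq_mul]
      refine lt_of_le_of_lt ?_ hnum
      have h01 : (0:ℝ) ≤ 1 - (1/2)^Q0 := by
        have : (1/2:ℝ)^Q0 ≤ 1 := pow_le_one₀ (by norm_num) (by norm_num)
        linarith
      have : ((Fintype.card V).choose m : ℝ) ≤ (Fintype.card V : ℝ)^m := by
        exact_mod_cast Nat.choose_le_pow _ _
      gcongr
  obtain ⟨η, hη⟩ := exists_lt_of_Ex_lt hE
  refine ⟨finalG G0 PP η, finalG_free G0 PP η k h2 hcl, ?_⟩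
  intro S hSm hfree
  have h1 := (hf S hSm).1 η hfree
  have h2 : f S η ≤ ∑ S ∈ univ.powersetCard m, f S η :=
    single_le_sum (f := fun S => f S η) (fun S _ => hf0 S η) (mem_powersetCard.2 ⟨subset_univ _, hSm⟩)
  linarith
end bits
end ModPBits

section ModPC
set_option linter.unusedSectionVars false
set_option linter.unusedVariables false
open Finset

theorem num_main (k o M0 : ℤ) (hk : 2 ≤ k) (ho : 3 ≤ o) (hs : 7 ≤ k + o)
    (hM : (k + o = 7 ∧ M0 = 6) ∨ (8 ≤ k + o ∧ M0 = k + o)) :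
    1 ≤ min k o * ((3*(k+o)-8)*(k-2) + (k+o)*k*o - 6*(k+o-3)*(k+o-2)) + M0 * (o*(o-1)) := by
  rcases hM with ⟨h7, rfl⟩ | ⟨h8, rfl⟩
  · obtain rfl : o = 7 - k := by linarith
    have : k ≤ 4 := by linarith
    interval_cases k <;> norm_num
  · rcases le_total k o with hko | hko
    · rw [min_eq_left hko]
      by_cases h6 : 6 ≤ k
      · have h1 : 0 ≤ (k-6)*(o-6) := mul_nonneg (by linarith) (by linarith)
        have h2 : 0 ≤ (3*(k+o)-8)*(k-2) + (k+o)*k*o - 6*(k+o-3)*(k+o-2) := by nlinarith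
        have h3 := mul_nonneg (show 0 ≤ k by linarith) h2
        have h4 : 0 < o*(o-1) := mul_pos (by linarith) (by linarith)
        have h5 : 0 < (k+o)*(o*(o-1)) := mul_pos (by linarith) h4
        linarith
      · push Not at h6
        interval_cases k
        · nlinarith [sq_nonneg (2*o-7), mul_nonneg (show 0 ≤ o - 6 by linarith) (sq_nonneg (2*o-7))]
        · nlinarith [mul_nonneg (show 0 ≤ o - 5 by linarith) (sq_nonneg (o-5)), sq_nonneg (o-5)]
        · nlinarith [mul_nonneg (show 0 ≤ o - 4 by linarith) (sq_nonneg (o-4)), sq_nonneg (o-4)]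
        · nlinarith [mul_nonneg (show 0 ≤ o - 5 by linarith) (sq_nonneg (o-5)), sq_nonneg (o-5)]
    · rw [min_eq_right hko]
      by_cases h6 : 6 ≤ o
      · have h1 : 0 ≤ (k-6)*(o-6) := mul_nonneg (by linarith) (by linarith)
        have h2 : 0 ≤ (3*(k+o)-8)*(k-2) + (k+o)*k*o - 6*(k+o-3)*(k+o-2) := by nlinarith
        have h3 := mul_nonneg (show 0 ≤ o by linarith) h2
        have h4 : 0 < o*(o-1) := mul_pos (by linarith) (by linarith)
        have h5 : 0 < (k+o)*(o*(o-1)) := mul_pos (by linarith) h4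
        linarith
      · push Not at h6
        interval_cases o
        · nlinarith
        · nlinarith
        · nlinarith

/-- numeric inequality with perturbation -/
theorem num_pert (s k o dd H h K a M : ℤ) (hs : 4 ≤ s) (hk : 2 ≤ k) (ho : 3 ≤ o) (hko : k + o = s + 3)
    (hdd : dd = min k o) (hH : 10*(s+3)^4 ≤ H)
    (hh : h = (3*s+1)*H) (hK : K = (s+3)*H - 2*s) (ha : a = 2*h - (2*H+3)) (hM : M = min K (h-K)) :
    dd * (a * (s+1)) < dd * (h*(k-2) + K*(k*o)) + M * (o*(o-1)) := by
  obtain ⟨M0, hM0, hM1⟩ : ∃ M0 : ℤ, ((k + o = 7 ∧ M0 = 6) ∨ (8 ≤ k + o ∧ M0 = k + o)) ∧ M0*H - 2*s ≤ M := by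
    have hH0 : 0 ≤ H := le_trans (by positivity) hH
    by_cases h4 : s = 4
    · refine ⟨6, Or.inl ⟨by linarith, rfl⟩, ?_⟩
      rw [hM, hK, hh, h4]
      refine le_min ?_ ?_ <;> linarith
    · refine ⟨k+o, Or.inr ⟨by omega, rfl⟩, ?_⟩
      have : 5 ≤ s := by omega
      rw [hM, hK, hh, hko]
      refine le_min ?_ ?_ 
      · linarith
      · nlinarith
  have hm := num_main k o M0 hk ho (by omega) hM0
  rw [← hdd] at hm
  have hd1 : 2 ≤ dd := by rw [hdd]; exact le_min hk (by linarith)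
  have hdk : dd ≤ k := by rw [hdd]; exact min_le_left _ _
  have hH0 : 0 ≤ H := le_trans (by positivity) hH
  have hoo : 0 ≤ o*(o-1) := mul_nonneg (by linarith) (by linarith)
  have e1 : (M0*H - 2*s) * (o*(o-1)) ≤ M * (o*(o-1)) := mul_le_mul_of_nonneg_right hM1 hoo
  have hsk : s = k + o - 3 := by linarith
  have e2 : H ≤ H * (dd * ((3*(k+o)-8)*(k-2) + (k+o)*k*o - 6*(k+o-3)*(k+o-2)) + M0 * (o*(o-1))) := by
    nlinarith
  have e3 : dd * (h*(k-2) + K*(k*o)) + (M0*H - 2*s) * (o*(o-1)) - dd * (a*(s+1))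
     = H * (dd * ((3*(k+o)-8)*(k-2) + (k+o)*k*o - 6*(k+o-3)*(k+o-2)) + M0 * (o*(o-1)))
       + 3*dd*(s+1) - 2*s*dd*(k*o) - 2*s*(o*(o-1)) := by
    rw [ha, hK, hh, hsk]; ring
  -- bound on perturbation
  have hn : 7 ≤ s + 3 := by linarith
  have hks : k ≤ s+3 := by linarith
  have hos : o ≤ s+3 := by linarith
  have p1 : k*o ≤ (s+3)^2 := by nlinarith
  have p2 : o*(o-1) ≤ (s+3)^2 := by nlinarith
  have p3 : dd*(k*o) ≤ (s+3)^3 := by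
    have : dd*(k*o) ≤ (s+3)*(s+3)^2 := mul_le_mul (by linarith) p1 (by nlinarith) (by linarith)
    linarith [this, show (s+3)*(s+3)^2 = (s+3)^3 by ring]
  have p4 : 2*s*dd*(k*o) ≤ 2*(s+3)^4 := by
    have : s*(dd*(k*o)) ≤ (s+3)*(s+3)^3 := mul_le_mul (by linarith) p3 (by positivity) (by linarith)
    linarith [this, show (s+3)*(s+3)^3 = (s+3)^4 by ring, show 2*s*dd*(k*o) = 2*(s*(dd*(k*o))) by ring]
  have p5 : 2*s*(o*(o-1)) ≤ 2*(s+3)^4 := by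
    have h1 : s*(o*(o-1)) ≤ (s+3)*(s+3)^2 := mul_le_mul (by linarith) p2 hoo (by linarith)
    have h2 : (s+3)^3 ≤ (s+3)^4 := pow_le_pow_right₀ (by linarith) (by norm_num)
    linarith [show (s+3)*(s+3)^2 = (s+3)^3 by ring, show 2*s*(o*(o-1)) = 2*(s*(o*(o-1))) by ring]
  have p6 : 0 ≤ 3*dd*(s+1) := by positivity
  have p7 : 0 < (s+3)^4 := by positivity
  linarith

section
variable {V ι : Type*} [Fintype V] [DecidableEq V] [Fintype ι] [DecidableEq ι]

/-- every two points of P lie in exactly one block -/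
def Lin (B : ι → Finset V) (P : Finset V) : Prop :=
  ∀ x ∈ P, ∀ y ∈ P, x ≠ y → (univ.filter (fun b => x ∈ B b ∧ y ∈ B b)).card = 1

/-- the weight -/
def wt (a bL h : ℤ) (B : ι → Finset V) (P : Finset V) : ℤ :=
  a * P.card + ∑ b, if 2 ≤ (P ∩ B b).card then bL - h * (P ∩ B b).card else 0

theorem Lin.mono {B : ι → Finset V} {P Q : Finset V} (h : Lin B P) (hQ : Q ⊆ P) : Lin B Q :=
  fun x hx y hy => h x (hQ hx) y (hQ hy)

theorem Lin.uniq {B : ι → Finset V} {P : Finset V} (h : Lin B P) {x y : V} (hx : x ∈ P) (hy : y ∈ P)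
    (hxy : x ≠ y) {b c : ι} (h1 : x ∈ B b) (h2 : y ∈ B b) (h3 : x ∈ B c) (h4 : y ∈ B c) : b = c := by
  have := card_le_one.1 (h x hx y hy hxy).le
  exact this b (by simp [h1, h2]) c (by simp [h3, h4])

theorem count_cross (B : ι → Finset V) (T X Y : Finset V) (hT : Lin B T) (hX : X ⊆ T) (hY : Y ⊆ T)
    (hd : Disjoint X Y) : ∑ b, (X ∩ B b).card * (Y ∩ B b).card = X.card * Y.card := by
  have : ∀ b, (X ∩ B b).card * (Y ∩ B b).card = ∑ p ∈ X ×ˢ Y, if p.1 ∈ B b ∧ p.2 ∈ B b then 1 else 0 := by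
    intro b
    rw [← card_product, ← card_filter]
    congr 1
    ext p; simp; tauto
  simp only [this]
  rw [sum_comm, ← card_product, card_eq_sum_ones]
  refine sum_congr rfl fun p hp => ?_
  rw [mem_product] at hp
  rw [← card_filter]
  exact hT p.1 (hX hp.1) p.2 (hY hp.2) (fun h => Finset.disjoint_left.1 hd hp.1 (h ▸ hp.2))

theorem count_off (B : ι → Finset V) (T X : Finset V) (hT : Lin B T) (hX : X ⊆ T) :
    ∑ b, (X ∩ B b).offDiag.card = X.offDiag.card := by
  have : ∀ b, (X ∩ B b).offDiag.card = ∑ p ∈ X.offDiag, if p.1 ∈ B b ∧ p.2 ∈ B b then 1 else 0 := by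
    intro b
    rw [← card_filter]
    congr 1
    ext p; simp; tauto
  simp only [this]
  rw [sum_comm, card_eq_sum_ones]
  refine sum_congr rfl fun p hp => ?_
  rw [mem_offDiag] at hp
  rw [← card_filter]
  exact hT p.1 (hX hp.1) p.2 (hX hp.2.1) hp.2.2

theorem offDiag_card_int (X : Finset V) : (X.offDiag.card : ℤ) = (X.card : ℤ) * (X.card - 1) := by
  rw [offDiag_card, Nat.cast_sub (Nat.le_mul_self _)]
  push_cast; ring

theorem per_block (h K M dd j e : ℤ) (hM : M = min K (h-K)) (hM0 : 0 ≤ M) (hh : 0 ≤ h) (hK : 0 ≤ K)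
    (hj0 : 0 ≤ j) (hjd : j ≤ dd) (he0 : 0 ≤ e) (he1 : e ≤ 1) :
    dd * (K * (e * j)) + M * (j*(j-1)) ≤ dd * (if 2 ≤ e + j then h*(e + j - 2) + K else 0) := by
  have hMK : M ≤ K := hM ▸ min_le_left _ _
  have hMh : M ≤ h - K := hM ▸ min_le_right _ _
  have hMh' : M ≤ h := by linarith
  have he : e = 0 ∨ e = 1 := by omega
  rcases he with rfl | rfl
  · by_cases h2 : 2 ≤ j
    · rw [if_pos (by linarith)]
      have h1 : M * (j-1) ≤ h*(j-2) + K := by nlinarith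
      have h3 : 0 ≤ M * (j-1) := mul_nonneg hM0 (by linarith)
      have h4 : j * (M*(j-1)) ≤ dd * (h*(j-2)+K) := mul_le_mul hjd h1 h3 (by linarith)
      nlinarith
    · rw [if_neg (by linarith)]
      have : j = 0 ∨ j = 1 := by omega
      rcases this with rfl | rfl <;> simp
  · by_cases h2 : 1 ≤ j
    · rw [if_pos (by linarith)]
      have h1 : M * (j-1) ≤ h*(j-1) + K - K*j := by nlinarith
      have h3 : 0 ≤ M * (j-1) := mul_nonneg hM0 (by linarith)
      have h4 : j * (M*(j-1)) ≤ dd * (h*(j-1) + K - K*j) := mul_le_mul hjd h1 h3 (by linarith)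
      nlinarith
    · rw [if_neg (by linarith)]
      have : j = 0 := by omega
      subst this; simp

theorem config_ineq (s H h K a : ℤ) (hs : 4 ≤ s) (hH : 10*(s+3)^4 ≤ H)
    (hh : h = (3*s+1)*H) (hK : K = (s+3)*H - 2*s) (ha : a = 2*h - (2*H+3))
    (B : ι → Finset V) (T : Finset V) (hTc : (T.card : ℤ) = s + 3) (hT : Lin B T)
    (hB : ∀ b, ((T ∩ B b).card : ℤ) ≤ s) :
    wt a (2*h - K) h B T < 2*a - K := by
  have hH0 : 0 < H := lt_of_lt_of_le (by positivity) hH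
  have hHs : s ≤ H := by
    have : (s+3)^1 ≤ (s+3)^4 := pow_le_pow_right₀ (by linarith) (by norm_num)
    linarith
  set M := min K (h-K) with hM
  have hK0 : 0 ≤ K := by rw [hK]; nlinarith
  have hhK : 0 ≤ h - K := by rw [hK, hh]; nlinarith
  have hM0 : 0 ≤ M := le_min hK0 hhK
  have hh0 : 0 ≤ h := by linarith
  obtain ⟨x, hx, y, hy, hxy⟩ := Finset.one_lt_card.1 (show 1 < T.card by omega)
  have hcard := hT x hx y hy hxy
  obtain ⟨b0, hb0⟩ : (univ.filter (fun b => x ∈ B b ∧ y ∈ B b)).Nonempty := by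
    rw [← card_pos, hcard]; norm_num
  simp only [mem_filter, mem_univ, true_and] at hb0
  obtain ⟨b1, -, hmax⟩ := Finset.exists_max_image univ (fun b => (T ∩ B b).card) ⟨b0, mem_univ _⟩
  set X := T ∩ B b1 with hX
  set O := T \ B b1 with hO
  have hXT : X ⊆ T := inter_subset_left
  have hOT : O ⊆ T := sdiff_subset
  have hd : Disjoint X O := by
    rw [Finset.disjoint_left]; intro v hv hv'
    simp [hX, hO] at hv hv'; tauto
  have hXO : X.card + O.card = T.card := by
    rw [hX, hO]; exact card_inter_add_card_sdiff T (B b1)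
  have hk2 : 2 ≤ X.card := by
    have h1 : ({x,y} : Finset V) ⊆ T ∩ B b0 := by
      intro v hv; simp at hv; rcases hv with rfl | rfl <;> simp [hx, hy, hb0]
    have h2 := card_le_card h1
    rw [card_pair hxy] at h2
    exact h2.trans (hmax b0 (mem_univ _))
  set k : ℤ := (X.card : ℤ) with hk
  set o : ℤ := (O.card : ℤ) with ho
  have hko : k + o = s + 3 := by rw [hk, ho, ← hTc]; exact_mod_cast hXO
  have hk2' : 2 ≤ k := by rw [hk]; exact_mod_cast hk2
  have hks : k ≤ s := hB b1
  have hnum := num_pert s k o (min k o) H h K a M hs hk2' (by linarith) hko rfl hH hh hK ha rfl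
  set dd := min k o with hdd
  have hdd2 : 2 ≤ dd := le_min hk2' (by linarith)
  -- decomposition of blocks
  have hsplit : ∀ b, ((T ∩ B b).card : ℤ) = (X ∩ B b).card + (O ∩ B b).card := by
    intro b
    have : T ∩ B b = (X ∩ B b) ∪ (O ∩ B b) := by
      ext v; simp [hX, hO]; tauto
    rw [this, card_union_of_disjoint (hd.mono inter_subset_left inter_subset_left)]
    push_cast; ring
  set φ : ι → ℤ := fun b => if 2 ≤ ((T ∩ B b).card : ℤ) then h * ((T ∩ B b).card - 2) + K else 0 with hφ
  have hper : ∀ b ∈ univ.erase b1, dd * (K * (((X ∩ B b).card : ℤ) * (O ∩ B b).card)) + M * ((O ∩ B b).card * ((O ∩ B b).card - 1))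
      ≤ dd * φ b := by
    intro b hb
    have hne : b ≠ b1 := (mem_erase.1 hb).1
    rw [hφ]; simp only []
    rw [hsplit b]
    refine per_block h K M dd _ _ rfl hM0 hh0 hK0 (by positivity) ?_ (by positivity) ?_
    · apply le_min
      · have h1 := hmax b (mem_univ _)
        have h2 := hsplit b
        have h3 : (0:ℤ) ≤ (X ∩ B b).card := by positivity
        have h4 : ((T ∩ B b).card : ℤ) ≤ k := by rw [hk]; exact_mod_cast h1
        linarith
      · rw [ho]; exact_mod_cast card_le_card inter_subset_left
    · have : (X ∩ B b).card ≤ 1 := by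
        rw [card_le_one]
        intro u hu v hv
        by_contra huv
        simp [hX] at hu hv
        exact hne (hT.uniq hu.1 hv.1 huv hu.2.2 hv.2.2 hu.2.1 hv.2.1)
      exact_mod_cast this
  have hO1 : O ∩ B b1 = ∅ := by
    ext v; simp [hO]
  have hsum1 : ∑ b ∈ univ.erase b1, (dd * (K * (((X ∩ B b).card : ℤ) * (O ∩ B b).card)) + M * ((O ∩ B b).card * ((O ∩ B b).card - 1)))
      = dd * (K * (k * o)) + M * (o * (o-1)) := by
    have hz : dd * (K * (((X ∩ B b1).card : ℤ) * (O ∩ B b1).card)) + M * ((O ∩ B b1).card * ((O ∩ B b1).card - 1)) = 0 := by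
      rw [hO1]; simp
    have := Finset.add_sum_erase univ (fun b => dd * (K * (((X ∩ B b).card : ℤ) * (O ∩ B b).card)) + M * ((O ∩ B b).card * ((O ∩ B b).card - 1))) (mem_univ b1)
    simp only [hz, zero_add] at this
    rw [this, sum_add_distrib, ← mul_sum, ← mul_sum, ← mul_sum]
    have c1 := count_cross B T X O hT hXT hOT hd
    have c2 := count_off B T O hT hOT
    have c1' : ∑ b, (((X ∩ B b).card : ℤ) * (O ∩ B b).card) = k * o := by
      rw [hk, ho]; exact_mod_cast c1
    have c2' : ∑ b, (((O ∩ B b).card : ℤ) * ((O ∩ B b).card - 1)) = o * (o-1) := by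
      simp only [← offDiag_card_int]
      rw [ho, ← offDiag_card_int]
      exact_mod_cast c2
    rw [c1', c2']
  have hφ1 : φ b1 = h * (k - 2) + K := by
    rw [hφ]; simp only []
    rw [if_pos]; exact hk2'
  have htot : dd * (h*(k-2) + K) + (dd * (K * (k * o)) + M * (o * (o-1))) ≤ dd * ∑ b, φ b := by
    rw [← Finset.add_sum_erase univ φ (mem_univ b1), hφ1, ← hsum1]
    have := sum_le_sum hper
    rw [← mul_sum] at this
    nlinarith
  have hwt : wt a (2*h-K) h B T = a * (s+3) - ∑ b, φ b := by
    rw [wt, hTc, sub_eq_add_neg (a * (s+3)), ← sum_neg_distrib]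
    congr 1
    refine sum_congr rfl fun b _ => ?_
    rw [hφ]; simp only []
    by_cases h2 : 2 ≤ (T ∩ B b).card
    · rw [if_pos h2, if_pos (by exact_mod_cast h2)]; ring
    · rw [if_neg h2, if_neg (by exact_mod_cast h2)]; ring
  have hfin : dd * (a*(s+1) + K) < dd * ∑ b, φ b := by nlinarith
  have := lt_of_mul_lt_mul_left hfin (by linarith)
  rw [hwt]; linarith
end
end ModPC

section ModPCrit
set_option linter.unusedSectionVars false
set_option linter.unusedVariables false
open Finset

section
variable {V ι : Type*} [Fintype V] [DecidableEq V] [Fintype ι] [DecidableEq ι]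

structure Crit (a bL h : ℤ) (t : ℕ) (B : ι → Finset V) (P : Finset V) : Prop where
  two : 2 ≤ P.card
  le : P.card ≤ t
  lin : Lin B P
  min : ∀ P', P' ⊂ P → 2 ≤ P'.card → wt a bL h B P < wt a bL h B P'
  nb : ∀ b, ¬ P ⊆ B b

theorem wt_block (a bL h : ℤ) (B : ι → Finset V) (P : Finset V) (hP : Lin B P) (h2 : 2 ≤ P.card)
    (b : ι) (hb : P ⊆ B b) : wt a bL h B P = a * P.card + bL - h * P.card := by
  obtain ⟨x, hx, y, hy, hxy⟩ := Finset.one_lt_card.1 (show 1 < P.card by omega)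
  rw [wt, Finset.sum_eq_single b]
  · rw [inter_eq_left.2 hb, if_pos h2]; ring
  · intro c _ hc
    rw [if_neg]
    intro h3
    obtain ⟨u, hu, v, hv, huv⟩ := Finset.one_lt_card.1 (show 1 < (P ∩ B c).card by omega)
    rw [mem_inter] at hu hv
    exact hc (hP.uniq hu.1 hv.1 huv hu.2 hv.2 (hb hu.1) (hb hv.1))
  · simp

theorem crit_exists (a bL h : ℤ) (t : ℕ) (B : ι → Finset V) (T : Finset V) (hT : Lin B T)
    (hTt : T.card = t) (ht : 2 ≤ t) (hah : h ≤ a)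
    (hw : wt a bL h B T < 2*a + bL - 2*h) : ∃ P, P ⊆ T ∧ Crit a bL h t B P := by
  set S := T.powerset.filter (fun Q => 2 ≤ Q.card) with hS
  have hTS : T ∈ S := by simp [hS, hTt, ht]
  obtain ⟨Q, hQ, hmin⟩ := exists_min_image S (wt a bL h B) ⟨T, hTS⟩
  set S' := S.filter (fun P => wt a bL h B P = wt a bL h B Q) with hS'
  obtain ⟨P, hP, hminP⟩ := exists_min_image S' card ⟨Q, by simp [hS', hQ]⟩
  have hP' := mem_filter.1 hP
  have hPS := mem_filter.1 hP'.1
  have hPT := mem_powerset.1 hPS.1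
  have hstrict : ∀ P', P' ⊂ P → 2 ≤ P'.card → wt a bL h B P < wt a bL h B P' := by
    intro P' hsub h2
    have hmem : P' ∈ S := mem_filter.2 ⟨mem_powerset.2 (hsub.1.trans hPT), h2⟩
    have h1 := hmin P' hmem
    rw [← hP'.2] at h1
    refine lt_of_le_of_ne h1 fun he => ?_
    have := hminP P' (mem_filter.2 ⟨hmem, by rw [← he, hP'.2]⟩)
    exact absurd (card_lt_card hsub) (by omega)
  refine ⟨P, hPT, hPS.2, hTt ▸ card_le_card hPT, hT.mono hPT, hstrict, ?_⟩
  intro b hb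
  have h1 := hmin T hTS
  have h2 := wt_block a bL h B P (hT.mono hPT) hPS.2 b hb
  rw [← hP'.2, h2] at h1
  have : (2:ℤ) ≤ P.card := by exact_mod_cast hPS.2
  nlinarith

/-- flags of P -/
def flg (B : ι → Finset V) (P : Finset V) : Finset (V × ι) :=
  univ.filter fun x => x.1 ∈ P ∧ x.1 ∈ B x.2 ∧ 2 ≤ (P ∩ B x.2).card

def WW (a bL h : ℤ) (u v : V) (A : Finset (V × ι)) : ℤ :=
  a * (A.image Prod.fst ∪ {u, v}).card + bL * (A.image Prod.snd).card - h * A.card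

theorem WW_eq (a bL h : ℤ) (u v : V) (A : Finset (V × ι)) :
    WW a bL h u v A = a * (A.image Prod.fst ∪ {u, v}).card +
      ∑ b, if 0 < (A.filter (fun x => x.2 = b)).card then bL - h * (A.filter (fun x => x.2 = b)).card else 0 := by
  have h1 : ∀ b : ι, (if 0 < (A.filter (fun x => x.2 = b)).card then bL - h * (A.filter (fun x => x.2 = b)).card else 0)
      = bL * (if b ∈ A.image Prod.snd then 1 else 0) - h * (A.filter (fun x => x.2 = b)).card := by
    intro b
    by_cases hb : b ∈ A.image Prod.snd
    · rw [if_pos hb, if_pos]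
      · ring
      · obtain ⟨x, hx, rfl⟩ := mem_image.1 hb
        exact card_pos.2 ⟨x, by simp [hx]⟩
    · rw [if_neg hb]
      have : A.filter (fun x => x.2 = b) = ∅ := by
        rw [filter_eq_empty_iff]; intro x hx he; exact hb (mem_image.2 ⟨x, hx, he⟩)
      rw [this]; simp
  rw [sum_congr rfl fun b _ => h1 b, sum_sub_distrib, ← mul_sum, ← mul_sum]
  have h2 : (A.card : ℤ) = ∑ b : ι, ((A.filter (fun x => x.2 = b)).card : ℤ) := by
    have := card_eq_sum_card_fiberwise (s := A) (t := univ) (f := fun x : V × ι => x.2) (by intro x _; simp)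
    exact_mod_cast this
  have h3 : ((A.image Prod.snd).card : ℤ) = ∑ b : ι, (if b ∈ A.image Prod.snd then 1 else 0) := by
    rw [sum_boole]; congr 2; ext; simp
  rw [WW, h2, h3]; ring

theorem flg_pts {B : ι → Finset V} {P : Finset V} (hP : Lin B P) (h2 : 2 ≤ P.card) :
    (flg B P).image Prod.fst = P := by
  ext w
  constructor
  · intro hw
    obtain ⟨x, hx, rfl⟩ := mem_image.1 hw
    exact (mem_filter.1 hx).2.1
  · intro hw
    obtain ⟨w', hw', hne⟩ := exists_mem_ne (show 1 < P.card by omega) w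
    have := hP w hw w' hw' hne.symm
    obtain ⟨b, hb⟩ : (univ.filter (fun b => w ∈ B b ∧ w' ∈ B b)).Nonempty := by
      rw [← card_pos, this]; norm_num
    simp only [mem_filter, mem_univ, true_and] at hb
    refine mem_image.2 ⟨(w, b), ?_, rfl⟩
    simp only [flg, mem_filter, mem_univ, true_and]
    refine ⟨hw, hb.1, ?_⟩
    have : ({w, w'} : Finset V) ⊆ P ∩ B b := by
      intro x hx; simp at hx; rcases hx with rfl | rfl <;> simp [hw, hw', hb]
    have := card_le_card this
    rwa [card_pair hne.symm] at this

theorem flg_fib (B : ι → Finset V) (P : Finset V) (b : ι) :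
    ((flg B P).filter (fun x => x.2 = b)).card = if 2 ≤ (P ∩ B b).card then (P ∩ B b).card else 0 := by
  by_cases h2 : 2 ≤ (P ∩ B b).card
  · rw [if_pos h2]
    symm
    refine card_bij (fun v _ => (v, b)) ?_ ?_ ?_
    · intro v hv
      rw [mem_inter] at hv
      simp [flg, hv, h2]
    · intro v _ w _ h; exact (Prod.mk.inj h).1
    · intro x hx
      simp only [flg, mem_filter, mem_univ, true_and] at hx
      obtain ⟨⟨h3, h4, h5⟩, rfl⟩ := hx
      exact ⟨x.1, by simp [h3, h4], rfl⟩
  · rw [if_neg h2, card_eq_zero, filter_eq_empty_iff]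
    rintro x hx rfl
    simp only [flg, mem_filter, mem_univ, true_and] at hx
    exact h2 hx.2.2

theorem flg_card {B : ι → Finset V} {P : Finset V} (hP : Lin B P) : (flg B P).card ≤ P.card ^ 2 := by
  have h1 := card_eq_sum_card_fiberwise (s := flg B P) (t := univ) (f := fun x : V × ι => x.2) (by intro x _; simp)
  have h2 := count_off B P P hP subset_rfl
  rw [h1]
  calc _ ≤ ∑ b, (P ∩ B b).offDiag.card := by
        refine sum_le_sum fun b _ => ?_
        rw [flg_fib, offDiag_card]
        split_ifs with h
        · have : 2 * (P ∩ B b).card ≤ (P ∩ B b).card * (P ∩ B b).card := Nat.mul_le_mul_right _ h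
          omega
        · exact Nat.zero_le _
    _ ≤ _ := by rw [h2, offDiag_card, sq]; omega

theorem crit_flg {a bL h : ℤ} {t : ℕ} {B : ι → Finset V} {P : Finset V} (hP : Crit a bL h t B P)
    (h0 : 0 < h) (h1 : h < bL) (h2 : bL < 2*h) {u v : V} (hu : u ∈ P) (hv : v ∈ P) (huv : u ≠ v)
    (A : Finset (V × ι)) (hA : A ⊂ flg B P) : WW a bL h u v (flg B P) < WW a bL h u v A := by
  have huvP : ({u, v} : Finset V) ⊆ P := by
    intro x hx; simp at hx; rcases hx with rfl | rfl <;> assumption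
  have e1 : WW a bL h u v (flg B P) = wt a bL h B P := by
    rw [WW_eq, wt, flg_pts hP.lin hP.two, union_eq_left.2 huvP]
    congr 1
    refine sum_congr rfl fun b _ => ?_
    rw [flg_fib]
    split_ifs with h3 h4 h5 <;> first | rfl | omega
  set P' := A.image Prod.fst ∪ {u, v} with hP'
  have hsub : P' ⊆ P := by
    refine union_subset ?_ huvP
    rw [← flg_pts hP.lin hP.two]
    exact image_subset_image hA.1
  have hcard : 2 ≤ P'.card := by
    rw [← card_pair huv]; exact card_le_card subset_union_right
  -- fibres
  have hfib : ∀ b, (A.filter (fun x => x.2 = b)).card ≤ (P' ∩ B b).card := by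
    intro b
    refine card_le_card_of_injOn Prod.fst ?_ ?_
    · intro x hx
      simp only [coe_filter, Set.mem_setOf_eq] at hx
      obtain ⟨hx, rfl⟩ := hx
      have := hA.1 hx
      simp only [flg, mem_filter, mem_univ, true_and] at this
      simp only [coe_inter, Set.mem_inter_iff, mem_coe]
      exact ⟨mem_union_left _ (mem_image_of_mem _ hx), this.2.1⟩
    · intro x hx y hy hxy
      simp only [coe_filter, Set.mem_setOf_eq] at hx hy
      exact Prod.ext hxy (hx.2.trans hy.2.symm)
  have hterm : ∀ b, (if 2 ≤ (P' ∩ B b).card then bL - h * (P' ∩ B b).card else 0) ≤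
      (if 0 < (A.filter (fun x => x.2 = b)).card then bL - h * (A.filter (fun x => x.2 = b)).card else 0) := by
    intro b
    have h3 := hfib b
    have h3' : ((A.filter (fun x => x.2 = b)).card : ℤ) ≤ (P' ∩ B b).card := by exact_mod_cast h3
    split_ifs with h4 h5 h5
    · nlinarith
    · have : (2:ℤ) ≤ (P' ∩ B b).card := by exact_mod_cast h4
      nlinarith
    · have h6 : ((A.filter (fun x => x.2 = b)).card : ℤ) ≤ 1 := by
        have : (A.filter (fun x => x.2 = b)).card ≤ 1 := by omega
        exact_mod_cast this
      nlinarith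
    · exact le_rfl
  have hge : wt a bL h B P' ≤ WW a bL h u v A := by
    rw [WW_eq, wt]
    have := sum_le_sum (fun b (_ : b ∈ univ) => hterm b)
    linarith
  by_cases hPP : P' = P
  · have hlt : wt a bL h B P' < WW a bL h u v A := by
      rw [WW_eq, wt]
      obtain ⟨x, hx, hxA⟩ := exists_of_ssubset hA
      have := sum_lt_sum (fun b (_ : b ∈ univ) => hterm b) ⟨x.2, mem_univ _, ?_⟩
      · linarith
      have hx' := (mem_filter.1 hx).2
      have hc : 2 ≤ (P' ∩ B x.2).card := by rw [hPP]; exact hx'.2.2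
      have hfl : (A.filter (fun y => y.2 = x.2)).card < (P' ∩ B x.2).card := by
        rw [hPP]
        have h5 := flg_fib B P x.2
        rw [if_pos hx'.2.2] at h5
        rw [← h5]
        refine card_lt_card ⟨filter_subset_filter _ hA.1, fun hh => ?_⟩
        have : x ∈ A.filter (fun y => y.2 = x.2) := hh (by simp [hx])
        exact hxA (mem_filter.1 this).1
      have hfl' : ((A.filter (fun y => y.2 = x.2)).card : ℤ) + 1 ≤ (P' ∩ B x.2).card := by exact_mod_cast hfl
      rw [if_pos hc]
      have : (2:ℤ) ≤ (P' ∩ B x.2).card := by exact_mod_cast hc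
      split_ifs with h6
      · nlinarith
      · nlinarith
    rw [e1]; rwa [hPP] at hlt
  · rw [e1]
    exact (hP.min P' (lt_of_le_of_ne hsub hPP) hcard).trans_le hge
end
end ModPCrit

section ModPDeg
set_option linter.unusedSectionVars false
set_option linter.unusedVariables false
open Finset

theorem sum_small {V : Type*} [Fintype V] [DecidableEq V] (f n : ℕ) (hn : Fintype.card V ≤ n) :
    ∑ X ∈ (univ : Finset (Finset V)).filter (fun X => X.card ≤ f), ((n:ℝ)⁻¹)^X.card ≤ f + 1 := by
  rw [← sum_fiberwise_of_maps_to (s := (univ : Finset (Finset V)).filter (fun X => X.card ≤ f)) (t := range (f+1)) (g := card)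
    (fun X hX => by simp at hX ⊢; omega)]
  calc _ ≤ ∑ k ∈ range (f+1), (1:ℝ) := by
        refine sum_le_sum fun k hk => ?_
        have h1 : ∑ X ∈ ((univ : Finset (Finset V)).filter (fun X => X.card ≤ f)).filter (fun X => X.card = k), ((n:ℝ)⁻¹)^X.card
            ≤ ∑ X ∈ powersetCard k (univ : Finset V), ((n:ℝ)⁻¹)^k := by
          rw [sum_congr rfl (g := fun _ => ((n:ℝ)⁻¹)^k) (fun X hX => by rw [(mem_filter.1 hX).2])]
          refine sum_le_sum_of_subset_of_nonneg ?_ (fun _ _ _ => by positivity)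
          intro X hX
          simp at hX ⊢; exact hX.2
        refine h1.trans ?_
        rw [sum_const, card_powersetCard, nsmul_eq_mul, card_univ]
        have h2 : ((Fintype.card V).choose k : ℝ) ≤ (n:ℝ)^k := by
          have : (Fintype.card V).choose k ≤ n^k := (Nat.choose_le_pow _ _).trans (Nat.pow_le_pow_left hn k)
          exact_mod_cast this
        rcases Nat.eq_zero_or_pos n with rfl | hn0
        · rcases Nat.eq_zero_or_pos k with rfl | hk
          · simp
          · simp [hk.ne']
        · calc _ ≤ (n:ℝ)^k * ((n:ℝ)⁻¹)^k := by gcongr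
            _ = 1 := by rw [← mul_pow, mul_inv_cancel₀ (by positivity), one_pow]
    _ = f + 1 := by simp

section
variable {V ι : Type*} [Fintype V] [DecidableEq V] [Fintype ι] [DecidableEq ι]

def CA (a bL h : ℤ) (f : ℕ) (u v : V) : Finset (Finset (V × ι)) :=
  univ.filter fun A => A.card ≤ f ∧ ∀ A' ∈ A.powerset, A' ≠ A → WW a bL h u v A < WW a bL h u v A'

theorem per_A (a bL h z f : ℕ) (hz : 1 ≤ z) (u v : V) (U A : Finset (V × ι))
    (hA : A ∈ CA (ι := ι) (a:ℤ) bL h f u v) (hU : ¬ A ⊆ U) :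
    ((z:ℝ)^h)⁻¹ ^ (A \ U).card ≤ (z:ℝ)⁻¹ *
      ((((z^a : ℕ):ℝ)⁻¹)^((A.image Prod.fst ∪ {u,v}) \ ((A ∩ U).image Prod.fst ∪ {u,v})).card *
       (((z^bL : ℕ):ℝ)⁻¹)^(A.image Prod.snd \ (A ∩ U).image Prod.snd).card) := by
  have h1 := (mem_filter.1 hA).2.2 (A ∩ U) (by simp) (fun he => hU (inter_eq_left.1 he))
  have c1 := card_sdiff_add_card_eq_card (s := (A ∩ U).image Prod.fst ∪ {u,v}) (t := A.image Prod.fst ∪ {u,v})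
    (union_subset_union (image_subset_image inter_subset_left) subset_rfl)
  have c2 := card_sdiff_add_card_eq_card (s := (A ∩ U).image Prod.snd) (t := A.image Prod.snd)
    (image_subset_image inter_subset_left)
  have c3 := card_inter_add_card_sdiff A U
  unfold WW at h1
  set x := ((A.image Prod.fst ∪ {u,v}) \ ((A ∩ U).image Prod.fst ∪ {u,v})).card
  set y := (A.image Prod.snd \ (A ∩ U).image Prod.snd).card
  set d := (A \ U).card
  rw [← c1, ← c2, ← c3] at h1
  push_cast at h1
  have h2 : 1 + a * x + bL * y ≤ h * d := by
    zify; nlinarith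
  have hz' : (1:ℝ) ≤ z := by exact_mod_cast hz
  have h3 : (z:ℝ) * ((z^a)^x * (z^bL)^y) ≤ (z^h)^d := by
    rw [← pow_mul, ← pow_mul, ← pow_mul, ← pow_add, ← pow_succ']
    exact pow_le_pow_right₀ hz' (by omega)
  push_cast
  rw [inv_pow, inv_pow, inv_pow, ← mul_inv, ← mul_inv]
  exact inv_anti₀ (by positivity) h3

theorem one_step (a bL h z f : ℕ) (hz : 1 ≤ z) (hV : Fintype.card V ≤ z^a) (hι : Fintype.card ι ≤ z^bL)
    (u v : V) (U : Finset (V × ι)) :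
    ∑ A ∈ (CA (ι := ι) (a:ℤ) bL h f u v).filter (fun A => ¬ A ⊆ U), ((z:ℝ)^h)⁻¹ ^ (A \ U).card
      ≤ 2^U.card * ((f+1)^2 * 2^((2*f+2)*(2*f))) / z := by
  set S := (CA (ι := ι) (a:ℤ) bL h f u v).filter (fun A => ¬ A ⊆ U) with hS
  set w : Finset (V × ι) × Finset V × Finset ι → ℝ := fun p => (((z^a : ℕ):ℝ)⁻¹)^p.2.1.card * (((z^bL : ℕ):ℝ)⁻¹)^p.2.2.card with hw
  set g : Finset (V × ι) → Finset (V × ι) × Finset V × Finset ι := fun A =>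
    (A ∩ U, (A.image Prod.fst ∪ {u,v}) \ ((A ∩ U).image Prod.fst ∪ {u,v}), A.image Prod.snd \ (A ∩ U).image Prod.snd) with hg
  set I := (U.powerset.filter (fun A => A.card ≤ f)) ×ˢ ((univ : Finset (Finset V)).filter (fun X => X.card ≤ f)) ×ˢ ((univ : Finset (Finset ι)).filter (fun X => X.card ≤ f)) with hI
  have hw0 : ∀ p, 0 ≤ w p := fun p => by rw [hw]; positivity
  have hmaps : ∀ A ∈ S, g A ∈ I := by
    intro A hA
    have hc : A.card ≤ f := (mem_filter.1 (mem_filter.1 hA).1).2.1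
    simp only [hI, hg, mem_product, mem_filter, mem_univ, true_and, mem_powerset]
    refine ⟨⟨inter_subset_right, (card_le_card inter_subset_left).trans hc⟩, ?_, ?_⟩
    · refine le_trans (card_le_card (t := A.image Prod.fst) ?_) (card_image_le.trans hc)
      intro x hx
      simp only [mem_sdiff, mem_union, not_or] at hx
      tauto
    · exact (card_le_card sdiff_subset).trans (card_image_le.trans hc)
  have h1 : ∑ A ∈ S, ((z:ℝ)^h)⁻¹ ^ (A \ U).card ≤ (z:ℝ)⁻¹ * ∑ A ∈ S, w (g A) := by
    rw [mul_sum]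
    refine sum_le_sum fun A hA => ?_
    exact per_A a bL h z f hz u v U A (mem_filter.1 hA).1 (mem_filter.1 hA).2
  have h2 : ∑ A ∈ S, w (g A) ≤ ∑ p ∈ I, 2^((2*f+2)*(2*f)) * w p := by
    rw [← sum_fiberwise_of_maps_to hmaps]
    refine sum_le_sum fun p hp => ?_
    rw [sum_congr rfl (g := fun _ => w p) (fun A hA => by rw [(mem_filter.1 hA).2]), sum_const, nsmul_eq_mul]
    refine mul_le_mul_of_nonneg_right ?_ (hw0 p)
    simp only [hI, mem_product, mem_filter, mem_univ, true_and, mem_powerset] at hp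
    have h3 : S.filter (fun A => g A = p) ⊆ ((p.1.image Prod.fst ∪ {u,v} ∪ p.2.1) ×ˢ (p.1.image Prod.snd ∪ p.2.2)).powerset := by
      intro A hA
      obtain ⟨-, rfl⟩ := mem_filter.1 hA
      rw [mem_powerset]
      intro x hx
      have e1 : x.1 ∈ A.image Prod.fst := mem_image_of_mem _ hx
      have e2 : x.2 ∈ A.image Prod.snd := mem_image_of_mem _ hx
      simp only [hg, mem_product, mem_union, mem_sdiff]
      tauto
    have h4 := card_le_card h3
    rw [card_powerset, card_product] at h4
    have h5 : (p.1.image Prod.fst ∪ {u,v} ∪ p.2.1).card ≤ 2*f+2 := by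
      have e1 := card_union_le (p.1.image Prod.fst ∪ {u,v}) p.2.1
      have e2 := card_union_le (p.1.image Prod.fst) {u,v}
      have e3 : ({u,v}:Finset V).card ≤ 2 := card_le_two
      have e4 := card_image_le (s := p.1) (f := Prod.fst)
      omega
    have h6 : (p.1.image Prod.snd ∪ p.2.2).card ≤ 2*f := by
      have e1 := card_union_le (p.1.image Prod.snd) p.2.2
      have e4 := card_image_le (s := p.1) (f := Prod.snd)
      omega
    have h7 := h4.trans (Nat.pow_le_pow_right (by norm_num) (Nat.mul_le_mul h5 h6))
    exact_mod_cast h7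
  have h3 : ∑ p ∈ I, w p ≤ 2^U.card * ((f+1)*(f+1)) := by
    rw [hI, sum_product]
    simp only [hw]
    rw [sum_const, nsmul_eq_mul, sum_product]
    simp only [← mul_sum]
    rw [← sum_mul]
    have e1 : (((U.powerset.filter (fun A => A.card ≤ f)).card : ℕ) : ℝ) ≤ 2^U.card := by
      have := card_le_card (filter_subset (fun A : Finset (V × ι) => A.card ≤ f) U.powerset)
      rw [card_powerset] at this
      exact_mod_cast this
    have e2 := sum_small (V := V) f _ hV
    have e3 := sum_small (V := ι) f _ hι
    gcongr
  have hz' : (0:ℝ) < z := by exact_mod_cast hz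
  refine h1.trans ?_
  rw [div_eq_inv_mul]
  refine mul_le_mul_of_nonneg_left ?_ (by positivity)
  rw [← mul_sum] at h2
  refine h2.trans ?_
  calc _ ≤ (2:ℝ)^((2*f+2)*(2*f)) * (2^U.card * ((f+1)*(f+1))) := by gcongr
    _ = _ := by ring

end

section
variable {E : Type*} [DecidableEq E]

def Nr (S : Finset (Finset E)) (F : Finset E) : ℕ → Finset E → ℕ
  | 0, _ => 1
  | r+1, U => ∑ A ∈ S.filter (fun A => ¬ A ⊆ U), if A ⊆ F then Nr S F r (U ∪ A) else 0

theorem Nr_zero (S : Finset (Finset E)) (F : Finset E) (f : ℕ) (hS : ∀ A ∈ S, A.card ≤ f) (r : ℕ) :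
    ∀ U, Nr S F r U = 0 → ∃ U', U'.card ≤ U.card + r * f ∧ ∀ A ∈ S, A ⊆ F → A ⊆ U' := by
  induction r with
  | zero => intro U h; simp [Nr] at h
  | succ r ih =>
    intro U h
    by_cases hc : ∀ A ∈ S, A ⊆ F → A ⊆ U
    · exact ⟨U, by omega, hc⟩
    · push Not at hc
      obtain ⟨A, hA, hAF, hAU⟩ := hc
      rw [Nr, sum_eq_zero_iff] at h
      have := h A (mem_filter.2 ⟨hA, hAU⟩)
      rw [if_pos hAF] at this
      obtain ⟨U', h1, h2⟩ := ih _ this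
      refine ⟨U', ?_, h2⟩
      have := card_union_le U A
      have := hS A hA
      rw [add_mul]; omega

theorem Nr_Ex {Ω : Type*} [Fintype Ω] (F : Ω → Finset E) (S : Finset (Finset E)) (x c : ℝ) (hx : 0 ≤ x) (hc : 0 ≤ c)
    (f R : ℕ) (hS : ∀ A ∈ S, A.card ≤ f)
    (hF : ∀ U : Finset E, Ex (fun ω => if U ⊆ F ω then (1:ℝ) else 0) ≤ x^U.card)
    (hstep : ∀ U : Finset E, U.card ≤ R * f → ∑ A ∈ S.filter (fun A => ¬ A ⊆ U), x^(A \ U).card ≤ c) (r : ℕ) (hr : r ≤ R) :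
    ∀ U : Finset E, U.card ≤ (R - r) * f → Ex (fun ω => if U ⊆ F ω then (Nr S (F ω) r U : ℝ) else 0) ≤ x^U.card * c^r := by
  induction r with
  | zero => intro U _; simpa [Nr] using hF U
  | succ r ih =>
    intro U hU
    have h1 : ∀ ω, (if U ⊆ F ω then (Nr S (F ω) (r+1) U : ℝ) else 0) =
        ∑ A ∈ S.filter (fun A => ¬ A ⊆ U), if U ∪ A ⊆ F ω then (Nr S (F ω) r (U ∪ A) : ℝ) else 0 := by
      intro ω
      by_cases h : U ⊆ F ω
      · rw [if_pos h, Nr]; push_cast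
        refine sum_congr rfl fun A _ => ?_
        by_cases hA : A ⊆ F ω
        · rw [if_pos hA, if_pos (union_subset h hA)]
        · rw [if_neg hA, if_neg (fun hh => hA (subset_union_right.trans hh))]
      · rw [if_neg h]; symm
        refine sum_eq_zero fun A _ => if_neg fun hh => h (subset_union_left.trans hh)
    simp only [h1]
    rw [Ex_sum]
    have hRr : (R - r) * f = (R - (r+1)) * f + f := by
      rw [show R - r = (R - (r+1)) + 1 by omega]; ring
    calc _ ≤ ∑ A ∈ S.filter (fun A => ¬ A ⊆ U), x^U.card * c^r * x^(A \ U).card := by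
          refine sum_le_sum fun A hA => ?_
          have hA' := hS A (mem_filter.1 hA).1
          refine (ih (by omega) (U ∪ A) ?_).trans ?_
          · have := card_union_le U A
            omega
          · have : (U ∪ A).card = U.card + (A \ U).card := by
              rw [← union_sdiff_self_eq_union, card_union_of_disjoint disjoint_sdiff]
            rw [this, pow_add]
            exact le_of_eq (by ring)
      _ = x^U.card * c^r * ∑ A ∈ S.filter (fun A => ¬ A ⊆ U), x^(A \ U).card := by rw [mul_sum]
      _ ≤ x^U.card * c^r * c := by
          refine mul_le_mul_of_nonneg_left (hstep U ?_) (by positivity)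
          exact hU.trans (Nat.mul_le_mul_right _ (by omega))
      _ = _ := by rw [pow_succ]; ring
end

/-- main degree lemma: expected number of bad things -/
theorem deg_main {V ι Ω : Type*} [Fintype V] [DecidableEq V] [Fintype ι] [DecidableEq ι] [Fintype Ω]
    (a bL h z f R : ℕ) (hz : 1 ≤ z) (hV : Fintype.card V ≤ z^a) (hι : Fintype.card ι ≤ z^bL)
    (F : Ω → Finset (V × ι))
    (hF : ∀ U : Finset (V × ι), Ex (fun ω => if U ⊆ F ω then (1:ℝ) else 0) ≤ (((z:ℝ)^h)⁻¹)^U.card)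
    (Good : Ω → Prop) [DecidablePred Good]
    (hGood : ∀ ω, (∀ u v : V, ((CA (ι := ι) (a:ℤ) bL h f u v).filter (fun A => A ⊆ F ω)).card ≤ 2^(R*f)) → Good ω) :
    Ex (fun ω => if Good ω then (0:ℝ) else 1) ≤ (z:ℝ)^(2*a) * ((2^(R*f) * ((f+1)^2 * 2^((2*f+2)*(2*f)))) / z)^R := by
  set c : ℝ := (2^(R*f) * ((f+1)^2 * 2^((2*f+2)*(2*f)))) / z with hc
  have hc0 : 0 ≤ c := by positivity
  have hz' : (0:ℝ) < z := by exact_mod_cast hz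
  have hle : ∀ ω, (if Good ω then (0:ℝ) else 1) ≤ ∑ u : V, ∑ v : V, (Nr (CA (ι := ι) (a:ℤ) bL h f u v) (F ω) R ∅ : ℝ) := by
    intro ω
    split_ifs with hg
    · positivity
    · by_contra hlt
      push Not at hlt
      apply hg
      apply hGood
      intro u v
      have h1 : (Nr (CA (ι := ι) (a:ℤ) bL h f u v) (F ω) R ∅) = 0 := by
        have h2 : ∑ u : V, ∑ v : V, Nr (CA (ι := ι) (a:ℤ) bL h f u v) (F ω) R ∅ < 1 := by exact_mod_cast hlt
        have h3 : ∑ u : V, ∑ v : V, Nr (CA (ι := ι) (a:ℤ) bL h f u v) (F ω) R ∅ = 0 := by omega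
        rw [sum_eq_zero_iff] at h3
        have h4 := h3 u (mem_univ _)
        rw [sum_eq_zero_iff] at h4
        exact h4 v (mem_univ _)
      obtain ⟨U', h2, h3⟩ := Nr_zero _ _ f (fun A hA => (mem_filter.1 hA).2.1) R ∅ h1
      have : (CA (ι := ι) (a:ℤ) bL h f u v).filter (fun A => A ⊆ F ω) ⊆ U'.powerset := by
        intro A hA
        rw [mem_filter] at hA
        exact mem_powerset.2 (h3 A hA.1 hA.2)
      refine (card_le_card this).trans ?_
      rw [card_powerset]
      refine Nat.pow_le_pow_right (by norm_num) (by simpa using h2)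
  refine (Ex_mono hle).trans ?_
  simp only [Ex_sum]
  calc _ ≤ ∑ u : V, ∑ v : V, c^R := by
        refine sum_le_sum fun u _ => sum_le_sum fun v _ => ?_
        have := Nr_Ex F (CA (ι := ι) (a:ℤ) bL h f u v) (((z:ℝ)^h)⁻¹) c (by positivity) hc0 f R
          (fun A hA => (mem_filter.1 hA).2.1) hF ?_ R le_rfl ∅ (by simp)
        · simpa using this
        · intro U hU
          refine (one_step a bL h z f hz hV hι u v U).trans ?_
          rw [hc]
          gcongr
          norm_num
    _ = (Fintype.card V : ℝ)^2 * c^R := by simp [card_univ]; ring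
    _ ≤ _ := by
        have : (Fintype.card V : ℝ) ≤ (z:ℝ)^a := by exact_mod_cast hV
        rw [pow_mul', ]
        gcongr
end ModPDeg

section ModPT1
set_option linter.unusedSectionVars false
set_option linter.unusedVariables false
open Finset

section
variable {ι X : Type*} [Fintype ι] [DecidableEq ι] [Fintype X] [Nonempty X]

theorem Ex_exp_ind (Y : X → Prop) [DecidablePred Y] (t : ℝ) :
    Ex (fun x => Real.exp (t * if Y x then 1 else 0)) = 1 + (Real.exp t - 1) * Ex (fun x => if Y x then (1:ℝ) else 0) := by
  rw [← Ex_mul_left, ← Ex_const (Ω := X) 1, ← Ex_add, Ex_const]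
  congr 1; ext x
  split_ifs <;> simp

theorem chern_low (Y : X → Prop) [DecidablePred Y] (ρ : ℝ) (hρ : ρ ≤ Ex (fun x => if Y x then (1:ℝ) else 0)) (h0 : 0 ≤ ρ) :
    Ex (fun ω : ι → X => if ((univ.filter (fun i => Y (ω i))).card : ℝ) ≤ ρ * Fintype.card ι / 4 then (1:ℝ) else 0)
      ≤ Real.exp (-(ρ * Fintype.card ι / 4)) := by
  have h1 : ∀ ω : ι → X, (if ((univ.filter (fun i => Y (ω i))).card : ℝ) ≤ ρ * Fintype.card ι / 4 then (1:ℝ) else 0) ≤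
      Real.exp (ρ * Fintype.card ι / 4) * ∏ i, Real.exp ((-1) * if Y (ω i) then 1 else 0) := by
    intro ω
    rw [← Real.exp_sum, ← Real.exp_add, ← mul_sum, sum_boole]
    split_ifs with h
    · exact Real.one_le_exp (by linarith)
    · positivity
  refine (Ex_mono h1).trans ?_
  rw [Ex_mul_left, Ex_prod (fun _ x => Real.exp ((-1) * if Y x then 1 else 0)), prod_const, card_univ, Ex_exp_ind]
  have he : Real.exp (-1) ≤ 1/2 := by
    rw [Real.exp_neg]
    rw [one_div]; refine inv_anti₀ (by norm_num) ?_
    have := Real.add_one_le_exp 1; linarith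
  have h2 : 1 + (Real.exp (-1) - 1) * Ex (fun x => if Y x then (1:ℝ) else 0) ≤ Real.exp (-(ρ/2)) := by
    have := Real.add_one_le_exp (-(ρ/2))
    nlinarith
  have h3 : 0 ≤ 1 + (Real.exp (-1) - 1) * Ex (fun x => if Y x then (1:ℝ) else 0) := by
    rw [← Ex_exp_ind]; exact Ex_nonneg fun _ => (Real.exp_pos _).le
  calc _ ≤ Real.exp (ρ * Fintype.card ι / 4) * (Real.exp (-(ρ/2)))^Fintype.card ι := by gcongr
    _ = _ := by
      rw [← Real.exp_nat_mul, ← Real.exp_add]; congr 1; ring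

theorem chern_up (g : X → ℝ) (θ κ T : ℝ) (hθ : 0 ≤ θ) (hκ : Ex (fun x => Real.exp (θ * g x)) ≤ 1 + κ) :
    Ex (fun ω : ι → X => if T ≤ ∑ i, g (ω i) then (1:ℝ) else 0)
      ≤ Real.exp (Fintype.card ι * κ - θ * T) := by
  have h1 : ∀ ω : ι → X, (if T ≤ ∑ i, g (ω i) then (1:ℝ) else 0) ≤
      Real.exp (-(θ * T)) * ∏ i, Real.exp (θ * g (ω i)) := by
    intro ω
    rw [← Real.exp_sum, ← Real.exp_add, ← mul_sum]
    split_ifs with h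
    · rw [← Real.exp_zero]; refine Real.exp_le_exp.2 ?_
      have := mul_le_mul_of_nonneg_left h hθ
      linarith
    · positivity
  refine (Ex_mono h1).trans ?_
  rw [Ex_mul_left, Ex_prod (fun _ x => Real.exp (θ * g x)), prod_const, card_univ]
  have h3 : 0 ≤ Ex (fun x => Real.exp (θ * g x)) := Ex_nonneg fun _ => (Real.exp_pos _).le
  have h4 : Ex (fun x => Real.exp (θ * g x)) ≤ Real.exp κ := hκ.trans (by linarith [Real.add_one_le_exp κ])
  calc _ ≤ Real.exp (-(θ * T)) * (Real.exp κ)^Fintype.card ι := by gcongr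
    _ = _ := by
      rw [← Real.exp_nat_mul, ← Real.exp_add]; congr 1; ring

theorem jensen_exp {Ω : Type*} [Fintype Ω] [Nonempty Ω] (f : Ω → ℝ) : Real.exp (Ex f) ≤ Ex (fun ω => Real.exp (f ω)) := by
  have h1 : ∀ ω, Real.exp (Ex f) * (1 + (f ω - Ex f)) ≤ Real.exp (f ω) := by
    intro ω
    have : Real.exp (f ω) = Real.exp (Ex f) * Real.exp (f ω - Ex f) := by rw [← Real.exp_add]; congr 1; ring
    rw [this]
    have := Real.add_one_le_exp (f ω - Ex f)
    gcongr; linarith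
  have := Ex_mono h1
  rw [Ex_mul_left, Ex_add, Ex_sub, Ex_const, Ex_const] at this
  linarith

/-- probability that i ∈ U, j ∉ U -/
theorem Ex_split (i j : ι) (hij : i ≠ j) :
    Ex (fun U : ι → Bool => if U i = true ∧ U j = false then (1:ℝ) else 0) = 1/4 := by
  have : ∀ U : ι → Bool, (if U i = true ∧ U j = false then (1:ℝ) else 0) =
      ∏ k, (if k = i then (if U k = true then 1 else 0) else if k = j then (if U k = false then 1 else 0) else 1) := by
    intro U
    rw [← mul_prod_erase univ _ (mem_univ i), ← mul_prod_erase (univ.erase i) _ (mem_erase.2 ⟨hij.symm, mem_univ j⟩)]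
    rw [prod_eq_one]
    · rw [if_pos rfl, if_neg hij.symm, if_pos rfl]
      split_ifs <;> simp_all
    · intro k hk
      simp only [mem_erase, mem_univ, and_true] at hk
      rw [if_neg hk.2, if_neg hk.1]
  simp only [this]
  rw [Ex_prod (fun k (b : Bool) => (if k = i then (if b = true then (1:ℝ) else 0) else if k = j then (if b = false then 1 else 0) else 1))]
  rw [← mul_prod_erase univ _ (mem_univ i), ← mul_prod_erase (univ.erase i) _ (mem_erase.2 ⟨hij.symm, mem_univ j⟩)]
  rw [prod_eq_one]
  · simp only [if_true, if_neg hij.symm]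
    simp [Ex]; norm_num
  · intro k hk
    simp only [mem_erase, mem_univ, and_true] at hk
    simp only [if_neg hk.2, if_neg hk.1]
    exact Ex_const 1

open Classical in
/-- hits -/
theorem hit_lemma (Y : X → Prop) (hh : X → X → Prop) (ε k0 : ℝ) (hε : 0 ≤ ε) :
    Ex (fun ω : ι → X => if Ex (fun c => if Y c ∧ ∃ j, hh c (ω j) then (1:ℝ) else 0) ≤ ε ∧
        k0 ≤ ((univ.filter (fun i => Y (ω i) ∧ ∃ j, j ≠ i ∧ hh (ω i) (ω j))).card : ℝ) then (1:ℝ) else 0)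
      ≤ Real.exp (2 * ε * Fintype.card ι - k0/4) := by
  set D : (ι → X) → (ι → Bool) → ℝ := fun ω U => ∑ i, if U i = true ∧ Y (ω i) ∧ ∃ j, U j = false ∧ hh (ω i) (ω j) then (1:ℝ) else 0 with hD
  set K : (ι → X) → ℝ := fun ω => ((univ.filter (fun i => Y (ω i) ∧ ∃ j, j ≠ i ∧ hh (ω i) (ω j))).card : ℝ) with hK
  set cov : (ι → X) → Prop := fun ω => Ex (fun c => if Y c ∧ ∃ j, hh c (ω j) then (1:ℝ) else 0) ≤ ε with hcov
  have h1 : ∀ ω, K ω / 4 ≤ Ex (D ω) := by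
    intro ω
    simp only [hD, hK]
    rw [Ex_sum, ← sum_boole, sum_div]
    refine sum_le_sum fun i _ => ?_
    by_cases hi : Y (ω i) ∧ ∃ j, j ≠ i ∧ hh (ω i) (ω j)
    · rw [if_pos hi]
      obtain ⟨hY, j, hj, hhj⟩ := hi
      rw [← Ex_split i j hj.symm]
      refine Ex_mono fun U => ?_
      split_ifs with h2 h3 h3
      · exact le_rfl
      · exact absurd ⟨h2.1, hY, j, h2.2, hhj⟩ h3
      · norm_num
      · exact le_rfl
    · rw [if_neg hi, zero_div]
      exact Ex_nonneg fun U => by split_ifs <;> norm_num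
  have h2 : ∀ ω, (if cov ω ∧ k0 ≤ K ω then (1:ℝ) else 0) ≤ Real.exp (-(k0/4)) * Ex (fun U => if cov ω then Real.exp (D ω U) else 0) := by
    intro ω
    by_cases hc : cov ω ∧ k0 ≤ K ω
    · rw [if_pos hc]
      simp only [if_pos hc.1]
      have h3 := jensen_exp (D ω)
      have h4 : Real.exp (k0/4) ≤ Ex (fun U => Real.exp (D ω U)) :=
        (Real.exp_le_exp.2 (by linarith [h1 ω, hc.2])).trans h3
      calc (1:ℝ) = Real.exp (-(k0/4)) * Real.exp (k0/4) := by rw [← Real.exp_add]; simp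
        _ ≤ _ := by gcongr
    · rw [if_neg hc]
      refine mul_nonneg (by positivity) (Ex_nonneg fun U => ?_)
      split_ifs <;> positivity
  refine (Ex_mono h2).trans ?_
  rw [Ex_mul_left, Ex_comm]
  have h5 : ∀ U : ι → Bool, Ex (fun ω => if cov ω then Real.exp (D ω U) else 0) ≤ Real.exp (2 * ε * Fintype.card ι) := by
    intro U
    set W : Finset ι := univ.filter (fun i => U i = true) with hW
    set eU : (ι → X) → ℝ := fun ω => Ex (fun c => if Y c ∧ ∃ j, U j = false ∧ hh c (ω j) then (1:ℝ) else 0) with heU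
    have h6 : ∀ ω, (if cov ω then Real.exp (D ω U) else 0) ≤ (if eU ω ≤ ε then Real.exp (D ω U) else 0) := by
      intro ω
      by_cases hc : cov ω
      · rw [if_pos hc, if_pos]
        refine le_trans (Ex_mono fun c => ?_) hc
        split_ifs with a1 a2 a2
        · exact le_rfl
        · obtain ⟨b1, j, b2, b3⟩ := a1
          exact absurd ⟨b1, j, b3⟩ a2
        · norm_num
        · exact le_rfl
      · rw [if_neg hc]; split_ifs <;> positivity
    refine (Ex_mono h6).trans ?_
    rw [Ex_resample W]
    refine Ex_le_const fun ω => ?_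
    have hin : ∀ (ω' : ι → X) i, U i = true → W.piecewise ω' ω i = ω' i := fun ω' i hi =>
      piecewise_eq_of_mem _ _ _ (by simp [hW, hi])
    have hout : ∀ (ω' : ι → X) i, U i = false → W.piecewise ω' ω i = ω i := fun ω' i hi =>
      piecewise_eq_of_notMem _ _ _ (by simp [hW, hi])
    have h7 : ∀ ω', eU (W.piecewise ω' ω) = eU ω := by
      intro ω'
      simp only [heU]
      congr 1; ext c
      have : (∃ j, U j = false ∧ hh c (W.piecewise ω' ω j)) ↔ (∃ j, U j = false ∧ hh c (ω j)) := by
        refine exists_congr fun j => and_congr_right fun hj => ?_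
        rw [hout ω' j hj]
      simp only [this]
    have h8 : ∀ ω', D (W.piecewise ω' ω) U = ∑ i, if U i = true ∧ Y (ω' i) ∧ ∃ j, U j = false ∧ hh (ω' i) (ω j) then (1:ℝ) else 0 := by
      intro ω'
      simp only [hD]
      refine sum_congr rfl fun i _ => ?_
      by_cases hi : U i = true
      · have : (∃ j, U j = false ∧ hh (ω' i) (W.piecewise ω' ω j)) ↔ (∃ j, U j = false ∧ hh (ω' i) (ω j)) := by
          refine exists_congr fun j => and_congr_right fun hj => ?_
          rw [hout ω' j hj]
        rw [hin ω' i hi]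
        simp only [this]
      · simp [hi]
    simp only [h7, h8]
    by_cases hc : eU ω ≤ ε
    · simp only [if_pos hc, Real.exp_sum]
      rw [Ex_prod (fun i x => Real.exp (if U i = true ∧ Y x ∧ ∃ j, U j = false ∧ hh x (ω j) then (1:ℝ) else 0))]
      have h9 : ∀ i, Ex (fun x => Real.exp (if U i = true ∧ Y x ∧ ∃ j, U j = false ∧ hh x (ω j) then (1:ℝ) else 0)) ≤ Real.exp (2*ε) := by
        intro i
        have := Ex_exp_ind (fun x => U i = true ∧ Y x ∧ ∃ j, U j = false ∧ hh x (ω j)) 1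
        simp only [one_mul] at this
        rw [this]
        have h10 : Ex (fun x => if U i = true ∧ Y x ∧ ∃ j, U j = false ∧ hh x (ω j) then (1:ℝ) else 0) ≤ ε := by
          refine le_trans (Ex_mono fun c => ?_) hc
          split_ifs with a1 a2 a2
          · exact le_rfl
          · exact absurd a1.2 a2
          · norm_num
          · exact le_rfl
        have h11 := Real.exp_one_lt_d9
        have h12 := Real.add_one_le_exp (2*ε)
        have h13 := Real.add_one_le_exp (1:ℝ)
        nlinarith
      refine (prod_le_prod (fun i _ => Ex_nonneg fun _ => (Real.exp_pos _).le) (fun i _ => h9 i)).trans ?_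
      rw [prod_const, card_univ, ← Real.exp_nat_mul]
      exact (Real.exp_le_exp.2 (by linarith))
    · simp only [if_neg hc]
      rw [Ex_const]; positivity
  calc _ ≤ Real.exp (-(k0/4)) * Real.exp (2 * ε * Fintype.card ι) := by
        gcongr; exact Ex_le_const h5
    _ = _ := by rw [← Real.exp_add]; congr 1; ring
end
end ModPT1

section ModPT2
set_option linter.unusedSectionVars false
set_option linter.unusedVariables false
open Finset

section
variable {V : Type*} [Fintype V] [DecidableEq V] {s q : ℕ}

def prs0 (x : Fin s × Fin q) : Prop := (x.2 : ℕ) = 0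

instance : DecidablePred (prs0 (s := s) (q := q)) := fun x => by unfold prs0; infer_instance

def Bl (c : V → Fin s × Fin q) : Finset V := univ.filter (fun v => prs0 (c v))

theorem Ex_pres (hs : 0 < s) (hq : 0 < q) : Ex (fun x : Fin s × Fin q => if prs0 x then (1:ℝ) else 0) = (q:ℝ)⁻¹ := by
  unfold Ex
  rw [sum_boole, Fintype.card_prod, Fintype.card_fin, Fintype.card_fin]
  have : (univ.filter (fun x : Fin s × Fin q => prs0 x)) = univ ×ˢ {⟨0, hq⟩} := by
    ext x
    rw [mem_filter]
    simp only [prs0, mem_univ, true_and, mem_product, mem_singleton, Fin.ext_iff]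
  rw [this, card_product]
  simp only [card_univ, Fintype.card_fin, card_singleton, mul_one]
  push_cast
  have h1 : (s:ℝ) ≠ 0 := by positivity
  have h2 : (q:ℝ) ≠ 0 := by positivity
  field_simp

theorem Ex_eq (hs : 0 < s) (hq : 0 < q) (k : Fin s) :
    Ex (fun x : Fin s × Fin q => if prs0 x ∧ x.1 = k then (1:ℝ) else 0) = ((s:ℝ) * q)⁻¹ := by
  unfold Ex
  rw [sum_boole, Fintype.card_prod, Fintype.card_fin, Fintype.card_fin]
  have : (univ.filter (fun x : Fin s × Fin q => prs0 x ∧ x.1 = k)) = {(k, ⟨0, hq⟩)} := by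
    ext x; rw [mem_filter]; simp [prs0, Fin.ext_iff, Prod.ext_iff, and_comm]
  rw [this]
  simp

theorem col_nonempty (hs : 0 < s) (hq : 0 < q) : Nonempty (Fin s × Fin q) := ⟨(⟨0, hs⟩, ⟨0, hq⟩)⟩

theorem Ex_npres (hs : 0 < s) (hq : 0 < q) : Ex (fun x : Fin s × Fin q => if prs0 x then (0:ℝ) else 1) = 1 - (q:ℝ)⁻¹ := by
  have := col_nonempty hs hq
  rw [← Ex_pres hs hq, ← Ex_const (Ω := Fin s × Fin q) 1, ← Ex_sub, Ex_const]
  congr 1; ext x; split_ifs <;> simp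

theorem Ex_two (hs : 0 < s) (hq : 0 < q) : Ex (fun x : Fin s × Fin q => if prs0 x then (2:ℝ) else 1) = 1 + (q:ℝ)⁻¹ := by
  have := col_nonempty hs hq
  rw [← Ex_pres hs hq, ← Ex_const (Ω := Fin s × Fin q) 1, ← Ex_add, Ex_const]
  congr 1; ext x; split_ifs <;> norm_num

theorem Ex_two0 (hs : 0 < s) (hq : 0 < q) : Ex (fun x : Fin s × Fin q => if prs0 x then (2:ℝ) else 0) = 2 * (q:ℝ)⁻¹ := by
  rw [← Ex_pres hs hq, ← Ex_mul_left]
  congr 1; ext x; split_ifs <;> norm_num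

theorem prod_ite_card (U : Finset V) (x : ℝ) : ∏ v, (if v ∈ U then x else 1) = x ^ U.card := by
  rw [prod_ite_mem, univ_inter, prod_const]

theorem Ex_ite (P : Prop) [Decidable P] {Ω : Type*} [Fintype Ω] (f g : Ω → ℝ) :
    Ex (fun x => if P then f x else g x) = if P then Ex f else Ex g := by
  split_ifs <;> rfl

theorem Ex_sub_Bl (hs : 0 < s) (hq : 0 < q) (U : Finset V) :
    Ex (fun c : V → Fin s × Fin q => if U ⊆ Bl c then (1:ℝ) else 0) = ((q:ℝ)⁻¹)^U.card := by
  have := col_nonempty hs hq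
  have h : ∀ c : V → Fin s × Fin q, (if U ⊆ Bl c then (1:ℝ) else 0) = ∏ v, if v ∈ U then (if prs0 (c v) then (1:ℝ) else 0) else 1 := by
    intro c
    split_ifs with h
    · symm; refine prod_eq_one fun v _ => ?_
      split_ifs with h1 h2
      · rfl
      · exact absurd (mem_filter.1 (h h1)).2 h2
      · rfl
    · rw [not_subset] at h
      obtain ⟨v, hv, hv2⟩ := h
      symm; refine prod_eq_zero (mem_univ v) ?_
      rw [if_pos hv, if_neg]
      simpa [Bl] using hv2
  simp only [h]
  rw [Ex_prod (fun v x => if v ∈ U then (if prs0 x then (1:ℝ) else 0) else 1)]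
  simp only [Ex_ite, Ex_pres hs hq, Ex_const]
  exact prod_ite_card U _

theorem two_pow_Bl (S : Finset V) (c : V → Fin s × Fin q) :
    (2:ℝ)^(S ∩ Bl c).card = ∏ v, if v ∈ S then (if prs0 (c v) then (2:ℝ) else 1) else 1 := by
  rw [← prod_ite_card]
  refine prod_congr rfl fun v _ => ?_
  by_cases h1 : v ∈ S <;> by_cases h2 : prs0 (c v) <;> simp [Bl, h1, h2]

theorem Ex_pow_Bl (hs : 0 < s) (hq : 0 < q) (S : Finset V) :
    Ex (fun c : V → Fin s × Fin q => (2:ℝ)^(S ∩ Bl c).card) = (1 + (q:ℝ)⁻¹)^S.card := by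
  have := col_nonempty hs hq
  simp only [two_pow_Bl]
  rw [Ex_prod (fun v x => if v ∈ S then (if prs0 x then (2:ℝ) else 1) else 1)]
  simp only [Ex_ite, Ex_two hs hq, Ex_const]
  exact prod_ite_card S _

theorem Ex_pair (hs : 0 < s) (hq : 0 < q) (S : Finset V) (u v : V) (hu : u ∈ S) (hv : v ∈ S) (huv : u ≠ v) :
    Ex (fun c : V → Fin s × Fin q => if u ∈ Bl c ∧ v ∈ Bl c then (2:ℝ)^(S ∩ Bl c).card else 0)
      ≤ (2 * (q:ℝ)⁻¹)^2 * (1 + (q:ℝ)⁻¹)^S.card := by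
  have := col_nonempty hs hq
  have h : ∀ c : V → Fin s × Fin q, (if u ∈ Bl c ∧ v ∈ Bl c then (2:ℝ)^(S ∩ Bl c).card else 0) =
      ∏ w, if w = u ∨ w = v then (if prs0 (c w) then (2:ℝ) else 0) else if w ∈ S then (if prs0 (c w) then (2:ℝ) else 1) else 1 := by
    intro c
    split_ifs with h
    · rw [two_pow_Bl]
      refine prod_congr rfl fun w _ => ?_
      simp only [Bl, mem_filter, mem_univ, true_and] at h
      by_cases hw : w = u ∨ w = v
      · have h1 : w ∈ S := by rcases hw with rfl | rfl <;> assumption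
        have h2 : prs0 (c w) := by rcases hw with rfl | rfl; exacts [h.1, h.2]
        simp [hw, h1, h2]
      · simp [hw]
    · symm
      by_cases h1 : u ∈ Bl c
      · refine prod_eq_zero (mem_univ v) ?_
        have : v ∉ Bl c := fun h2 => h ⟨h1, h2⟩
        rw [if_pos (Or.inr rfl), if_neg]
        simpa [Bl] using this
      · refine prod_eq_zero (mem_univ u) ?_
        rw [if_pos (Or.inl rfl), if_neg]
        simpa [Bl] using h1
  simp only [h]
  rw [Ex_prod (fun w x => if w = u ∨ w = v then (if prs0 x then (2:ℝ) else 0) else if w ∈ S then (if prs0 x then (2:ℝ) else 1) else 1)]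
  simp only [Ex_ite, Ex_two hs hq, Ex_two0 hs hq, Ex_const]
  rw [← mul_prod_erase univ _ (mem_univ u), ← mul_prod_erase (univ.erase u) _ (mem_erase.2 ⟨huv.symm, mem_univ v⟩)]
  rw [if_pos (Or.inl rfl), if_pos (Or.inr rfl), ← mul_assoc, ← sq]
  refine mul_le_mul_of_nonneg_left ?_ (by positivity)
  rw [← prod_ite_card S]
  rw [prod_congr (g := fun w => if w ∈ S then 1 + (q:ℝ)⁻¹ else 1) rfl (fun w hw => by
    simp only [mem_erase] at hw
    rw [if_neg (by tauto)])]
  rw [← mul_prod_erase univ (fun w => if w ∈ S then 1 + (q:ℝ)⁻¹ else 1) (mem_univ u), ← mul_prod_erase (univ.erase u) _ (mem_erase.2 ⟨huv.symm, mem_univ v⟩)]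
  rw [if_pos hu, if_pos hv]
  have h0 : 0 ≤ ∏ w ∈ (univ.erase u).erase v, (if w ∈ S then 1 + (q:ℝ)⁻¹ else 1) :=
    prod_nonneg fun x _ => by split_ifs <;> positivity
  have h1 : 0 ≤ (q:ℝ)⁻¹ := by positivity
  have h2 : 1 ≤ (1 + (q:ℝ)⁻¹) * (1 + (q:ℝ)⁻¹) := by nlinarith
  calc _ = 1 * ∏ w ∈ (univ.erase u).erase v, (if w ∈ S then 1 + (q:ℝ)⁻¹ else 1) := by rw [one_mul]
    _ ≤ ((1 + (q:ℝ)⁻¹) * (1 + (q:ℝ)⁻¹)) * ∏ w ∈ (univ.erase u).erase v, (if w ∈ S then 1 + (q:ℝ)⁻¹ else 1) :=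
        mul_le_mul_of_nonneg_right h2 h0
    _ = _ := by ring

theorem Ex_off (hs : 0 < s) (hq : 0 < q) (S : Finset V) :
    Ex (fun c : V → Fin s × Fin q => ((S ∩ Bl c).offDiag.card : ℝ) * (2:ℝ)^(S ∩ Bl c).card)
      ≤ (S.card:ℝ)^2 * ((2 * (q:ℝ)⁻¹)^2 * (1 + (q:ℝ)⁻¹)^S.card) := by
  have h : ∀ c : V → Fin s × Fin q, ((S ∩ Bl c).offDiag.card : ℝ) * (2:ℝ)^(S ∩ Bl c).card =
      ∑ p ∈ S.offDiag, if p.1 ∈ Bl c ∧ p.2 ∈ Bl c then (2:ℝ)^(S ∩ Bl c).card else 0 := by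
    intro c
    rw [← sum_filter, sum_const, nsmul_eq_mul]
    congr 3
    ext p; simp; tauto
  simp only [h]
  rw [Ex_sum]
  refine (sum_le_sum fun p hp => ?_ : _ ≤ ∑ p ∈ S.offDiag, ((2 * (q:ℝ)⁻¹)^2 * (1 + (q:ℝ)⁻¹)^S.card)).trans ?_
  · rw [mem_offDiag] at hp
    exact Ex_pair hs hq S p.1 p.2 hp.1 hp.2.1 hp.2.2
  · rw [sum_const, nsmul_eq_mul]
    refine mul_le_mul_of_nonneg_right ?_ (by positivity)
    have : S.offDiag.card ≤ S.card^2 := by rw [offDiag_card, sq]; omega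
    exact_mod_cast this

/-- rainbow s-type columns -/
def typ (S : Finset V) (c : V → Fin s × Fin q) : Prop :=
  (S ∩ Bl c).card = s ∧ ∀ u ∈ S ∩ Bl c, ∀ v ∈ S ∩ Bl c, u ≠ v → (c u).1 ≠ (c v).1

open Classical in
theorem Ex_typ (hs : 0 < s) (hq : 0 < q) (S : Finset V) :
    (S.card.choose s : ℝ) * ((((s:ℝ) * q)⁻¹)^s * (1 - (q:ℝ)⁻¹)^S.card)
    ≤ Ex (fun c : V → Fin s × Fin q => if typ S c then (1:ℝ) else 0) := by
  have := col_nonempty hs hq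
  have hcol : ∀ R : Finset V, ∃ k : V → Fin s, R.card = s → ∀ u ∈ R, ∀ v ∈ R, u ≠ v → k u ≠ k v := by
    intro R
    by_cases hR : R.card = s
    · have e := (R.equivFin).trans (finCongr hR)
      refine ⟨fun v => if h : v ∈ R then e ⟨v, h⟩ else ⟨0, hs⟩, fun _ u hu v hv huv => ?_⟩
      simp only [hu, hv, dif_pos]
      intro he
      have := e.injective he
      exact huv (Subtype.mk.inj this)
    · exact ⟨fun _ => ⟨0, hs⟩, fun h => absurd h hR⟩
  choose k hk using hcol
  set g : Finset V → V → Fin s × Fin q → ℝ := fun R v x =>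
    if v ∈ R then (if prs0 x ∧ x.1 = k R v then 1 else 0) else if v ∈ S then (if prs0 x then 0 else 1) else 1 with hg
  have hg0 : ∀ R v x, 0 ≤ g R v x := by
    intro R v x; simp only [hg]; split_ifs <;> norm_num
  have h1 : ∀ c : V → Fin s × Fin q, ∑ R ∈ powersetCard s S, ∏ v, g R v (c v) ≤ if typ S c then (1:ℝ) else 0 := by
    intro c
    -- nonzero implies R = S ∩ Bl c and typ
    have h2 : ∀ R ∈ powersetCard s S, ∏ v, g R v (c v) ≠ 0 → R = S ∩ Bl c ∧ typ S c := by
      intro R hR hne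
      rw [mem_powersetCard] at hR
      rw [prod_ne_zero_iff] at hne
      have hin : ∀ v ∈ R, prs0 (c v) ∧ (c v).1 = k R v := by
        intro v hv
        by_contra hc
        have := hne v (mem_univ _)
        simp only [hg, if_pos hv, if_neg hc] at this
        exact this rfl
      have hout : ∀ v ∈ S, v ∉ R → ¬ prs0 (c v) := by
        intro v hv hvR hc
        have := hne v (mem_univ _)
        simp only [hg, if_neg hvR, if_pos hv, if_pos hc] at this
        exact this rfl
      have hRe : R = S ∩ Bl c := by
        ext v
        simp only [mem_inter, Bl, mem_filter, mem_univ, true_and]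
        constructor
        · intro hv; exact ⟨hR.1 hv, (hin v hv).1⟩
        · rintro ⟨hv, hp⟩; by_contra hvR; exact hout v hv hvR hp
      refine ⟨hRe, ?_⟩
      unfold typ
      rw [← hRe]
      refine ⟨hR.2, fun u hu v hv huv => ?_⟩
      rw [(hin u hu).2, (hin v hv).2]
      exact hk R hR.2 u hu v hv huv
    have hle1 : ∀ R, ∏ v, g R v (c v) ≤ 1 := by
      intro R
      refine prod_le_one (fun v _ => hg0 _ _ _) fun v _ => ?_
      simp only [hg]; split_ifs <;> norm_num
    by_cases hall : ∀ R ∈ powersetCard s S, ∏ v, g R v (c v) = 0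
    · rw [sum_eq_zero hall]; split_ifs <;> norm_num
    · push Not at hall
      obtain ⟨R0, hR0, hne0⟩ := hall
      obtain ⟨e0, ht⟩ := h2 R0 hR0 hne0
      rw [if_pos ht, sum_eq_single R0]
      · exact hle1 R0
      · intro R hR hneR
        by_contra hc
        exact hneR ((h2 R hR hc).1.trans e0.symm)
      · intro h; exact absurd hR0 h
  refine le_trans ?_ (Ex_mono h1)
  rw [Ex_sum, ← card_powersetCard, ← nsmul_eq_mul, ← sum_const]
  refine sum_le_sum fun R hR => ?_
  rw [mem_powersetCard] at hR
  rw [Ex_prod (g R)]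
  simp only [hg, Ex_ite, Ex_npres hs hq, Ex_eq hs hq, Ex_const]
  have hq1 : (q:ℝ)⁻¹ ≤ 1 := inv_le_one_of_one_le₀ (by exact_mod_cast hq)
  have hq0 : 0 ≤ (q:ℝ)⁻¹ := by positivity
  calc _ = ∏ v, ((if v ∈ R then ((s:ℝ)*q)⁻¹ else 1) * (if v ∈ S then (1 - (q:ℝ)⁻¹) else 1)) := by
        rw [prod_mul_distrib, prod_ite_card, prod_ite_card, hR.2]
    _ ≤ _ := by
        refine prod_le_prod (fun v _ => ?_) fun v _ => ?_
        · refine mul_nonneg ?_ ?_ <;> split_ifs <;> first | positivity | linarith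
        · by_cases hv : v ∈ R
          · rw [if_pos hv, if_pos hv, if_pos (hR.1 hv)]
            have : 0 ≤ ((s:ℝ)*q)⁻¹ := by positivity
            nlinarith
          · rw [if_neg hv, if_neg hv, one_mul]

open Classical in
theorem Ex_hit (hs : 2 ≤ s) (hq : 0 < q) (S : Finset V) (u v : V) (hu : u ∈ S) (hv : v ∈ S) (huv : u ≠ v) :
    Ex (fun c : V → Fin s × Fin q => if typ S c ∧ u ∈ Bl c ∧ v ∈ Bl c then (1:ℝ) else 0)
      ≤ (S.card:ℝ)^(s-2) * ((q:ℝ)⁻¹)^s := by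
  set I := (powersetCard s S).filter (fun R => u ∈ R ∧ v ∈ R) with hI
  have h1 : ∀ c : V → Fin s × Fin q, (if typ S c ∧ u ∈ Bl c ∧ v ∈ Bl c then (1:ℝ) else 0) ≤ ∑ R ∈ I, if R ⊆ Bl c then (1:ℝ) else 0 := by
    intro c
    have hnn : ∀ R ∈ I, (0:ℝ) ≤ if R ⊆ Bl c then (1:ℝ) else 0 := by intro R _; split_ifs <;> norm_num
    split_ifs with h
    · have hm : S ∩ Bl c ∈ I := by
        simp only [hI, mem_filter, mem_powersetCard, mem_inter]
        exact ⟨⟨inter_subset_left, h.1.1⟩, ⟨hu, h.2.1⟩, hv, h.2.2⟩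
      refine le_trans ?_ (single_le_sum hnn hm)
      rw [if_pos inter_subset_right]
    · exact sum_nonneg hnn
  refine (Ex_mono h1).trans ?_
  rw [Ex_sum]
  rw [sum_congr rfl (g := fun _ => ((q:ℝ)⁻¹)^s) (fun R hR => by
    rw [Ex_sub_Bl (by omega) hq, (mem_powersetCard.1 (mem_filter.1 hR).1).2])]
  rw [sum_const, nsmul_eq_mul]
  refine mul_le_mul_of_nonneg_right ?_ (by positivity)
  have : I.card ≤ (powersetCard (s-2) S).card := by
    refine card_le_card_of_injOn (fun R => (R.erase u).erase v) ?_ ?_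
    · intro R hR
      simp only [hI, coe_filter, mem_powersetCard, Set.mem_ofPred_eq] at hR
      rw [mem_coe, mem_powersetCard]
      refine ⟨((erase_subset _ _).trans (erase_subset _ _)).trans hR.1.1, ?_⟩
      rw [card_erase_of_mem (mem_erase.2 ⟨huv.symm, hR.2.2⟩), card_erase_of_mem hR.2.1, hR.1.2]; omega
    · intro R hR R' hR' he
      simp only [hI, coe_filter, mem_powersetCard, Set.mem_ofPred_eq] at hR hR'
      have h3 : insert u (insert v ((R.erase u).erase v)) = R := by
        rw [insert_erase (mem_erase.2 ⟨huv.symm, hR.2.2⟩), insert_erase hR.2.1]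
      have h4 : insert u (insert v ((R'.erase u).erase v)) = R' := by
        rw [insert_erase (mem_erase.2 ⟨huv.symm, hR'.2.2⟩), insert_erase hR'.2.1]
      simp only at he
      rw [← h3, ← h4, he]
  rw [card_powersetCard] at this
  have := this.trans (Nat.choose_le_pow _ _)
  exact_mod_cast this
end
end ModPT2

section ModPT3
set_option linter.unusedSectionVars false
set_option linter.unusedVariables false
open Finset

section
variable {V ι : Type*} [Fintype V] [DecidableEq V] [Fintype ι] [DecidableEq ι] {s q : ℕ}

def hit (S : Finset V) (c c' : V → Fin s × Fin q) : Prop :=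
  ∃ u v, u ∈ S ∧ v ∈ S ∧ u ≠ v ∧ (u ∈ Bl c ∧ v ∈ Bl c) ∧ (u ∈ Bl c' ∧ v ∈ Bl c')

open Classical in
theorem cov_bound (hs : 2 ≤ s) (hq : 0 < q) (S : Finset V) (ω : ι → V → Fin s × Fin q) (δ : ℝ)
    (h : ∑ j, ((S ∩ Bl (ω j)).offDiag.card : ℝ) ≤ δ * (S.card:ℝ)^2) :
    Ex (fun c : V → Fin s × Fin q => if typ S c ∧ ∃ j, hit S c (ω j) then (1:ℝ) else 0) ≤ δ * ((S.card:ℝ) * (q:ℝ)⁻¹)^s := by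
  have h1 : ∀ c : V → Fin s × Fin q, (if typ S c ∧ ∃ j, hit S c (ω j) then (1:ℝ) else 0) ≤
      ∑ j, ∑ p ∈ (S ∩ Bl (ω j)).offDiag, if typ S c ∧ p.1 ∈ Bl c ∧ p.2 ∈ Bl c then (1:ℝ) else 0 := by
    intro c
    have hnn : ∀ p : V × V, (0:ℝ) ≤ if typ S c ∧ p.1 ∈ Bl c ∧ p.2 ∈ Bl c then (1:ℝ) else 0 := by
      intro p; split_ifs <;> norm_num
    split_ifs with hh
    · obtain ⟨ht, j, u, v, hu, hv, huv, h2, h3⟩ := hh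
      have hm : (u, v) ∈ (S ∩ Bl (ω j)).offDiag := by
        simp [hu, hv, huv, h3]
      have e1 := single_le_sum (f := fun p : V × V => if typ S c ∧ p.1 ∈ Bl c ∧ p.2 ∈ Bl c then (1:ℝ) else 0) (fun p _ => hnn p) hm
      have e2 := single_le_sum (f := fun j => ∑ p ∈ (S ∩ Bl (ω j)).offDiag, if typ S c ∧ p.1 ∈ Bl c ∧ p.2 ∈ Bl c then (1:ℝ) else 0)
        (fun j _ => sum_nonneg fun p _ => hnn p) (mem_univ j)
      refine le_trans ?_ (e1.trans e2)
      simp only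
      rw [if_pos ⟨ht, h2⟩]
    · exact sum_nonneg fun j _ => sum_nonneg fun p _ => hnn p
  refine (Ex_mono h1).trans ?_
  simp only [Ex_sum]
  calc _ ≤ ∑ j, ∑ p ∈ (S ∩ Bl (ω j)).offDiag, (S.card:ℝ)^(s-2) * ((q:ℝ)⁻¹)^s := by
        refine sum_le_sum fun j _ => sum_le_sum fun p hp => ?_
        simp only [mem_offDiag, mem_inter] at hp
        exact Ex_hit hs hq S p.1 p.2 hp.1.1 hp.2.1.1 hp.2.2
    _ = (∑ j, ((S ∩ Bl (ω j)).offDiag.card : ℝ)) * ((S.card:ℝ)^(s-2) * ((q:ℝ)⁻¹)^s) := by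
        rw [sum_mul]; refine sum_congr rfl fun j _ => ?_
        rw [sum_const, nsmul_eq_mul]
    _ ≤ δ * (S.card:ℝ)^2 * ((S.card:ℝ)^(s-2) * ((q:ℝ)⁻¹)^s) := by gcongr
    _ = _ := by
        obtain ⟨t, rfl⟩ := Nat.exists_eq_add_of_le hs
        rw [Nat.add_sub_cancel_left, mul_pow, pow_add (S.card:ℝ)]; ring

theorem exp_moment (hs : 0 < s) (hq : 0 < q) (S : Finset V) (N : ℕ) (θ : ℝ) (hθ : 0 ≤ θ) (hN : θ * N ≤ 1/2)
    (hmp : (S.card:ℝ) * (q:ℝ)⁻¹ ≤ 1) :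
    Ex (fun c : V → Fin s × Fin q => Real.exp (θ * if (S ∩ Bl c).card ≤ N then ((S ∩ Bl c).offDiag.card : ℝ) else 0))
      ≤ 1 + 12 * θ * ((S.card:ℝ) * (q:ℝ)⁻¹)^2 := by
  have := col_nonempty hs hq
  have h1 : ∀ c : V → Fin s × Fin q, Real.exp (θ * if (S ∩ Bl c).card ≤ N then ((S ∩ Bl c).offDiag.card : ℝ) else 0)
      ≤ 1 + θ * (((S ∩ Bl c).offDiag.card : ℝ) * (2:ℝ)^(S ∩ Bl c).card) := by
    intro c
    split_ifs with h
    · set x := (S ∩ Bl c).card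
      set y := ((S ∩ Bl c).offDiag.card : ℝ) with hy
      have hyx : y ≤ x * x := by
        have : (S ∩ Bl c).offDiag.card ≤ x * x := by rw [offDiag_card]; exact Nat.sub_le _ _
        rw [hy]; exact_mod_cast this
      have hy0 : 0 ≤ y := by positivity
      have hx : (x:ℝ) ≤ N := by exact_mod_cast h
      have h2 : θ * y ≤ x * (1/2) := by
        have : θ * y ≤ θ * (x * x) := mul_le_mul_of_nonneg_left hyx hθ
        have h3 : θ * x ≤ 1/2 := (mul_le_mul_of_nonneg_left hx hθ).trans hN
        nlinarith [show (0:ℝ) ≤ x by positivity]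
      have h3 : Real.exp (θ*y) ≤ 2^x := by
        refine (Real.exp_le_exp.2 h2).trans ?_
        rw [Real.exp_nat_mul]
        refine pow_le_pow_left₀ (Real.exp_pos _).le ?_ _
        have h4 := Real.exp_one_lt_d9
        have h5 : Real.exp (1/2) * Real.exp (1/2) = Real.exp 1 := by rw [← Real.exp_add]; norm_num
        nlinarith [Real.exp_pos (1/2)]
      have h6 : Real.exp (θ*y) ≤ 1 + θ*y*Real.exp (θ*y) := by
        have := Real.add_one_le_exp (-(θ*y))
        rw [Real.exp_neg] at this
        have h7 := Real.exp_pos (θ*y)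
        have := mul_le_mul_of_nonneg_right this h7.le
        rw [inv_mul_cancel₀ h7.ne'] at this
        linarith
      have h7 : θ*y*Real.exp (θ*y) ≤ θ*y*2^x := mul_le_mul_of_nonneg_left h3 (by positivity)
      linarith
    · rw [mul_zero, Real.exp_zero]
      have : 0 ≤ θ * (((S ∩ Bl c).offDiag.card : ℝ) * (2:ℝ)^(S ∩ Bl c).card) := by positivity
      linarith
  refine (Ex_mono h1).trans ?_
  rw [Ex_add, Ex_const, Ex_mul_left]
  have h2 := Ex_off hs hq S
  have h3 : (1 + (q:ℝ)⁻¹)^S.card ≤ 3 := by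
    have e1 : 1 + (q:ℝ)⁻¹ ≤ Real.exp ((q:ℝ)⁻¹) := by linarith [Real.add_one_le_exp ((q:ℝ)⁻¹)]
    refine (pow_le_pow_left₀ (by positivity) e1 _).trans ?_
    rw [← Real.exp_nat_mul]
    refine (Real.exp_le_exp.2 hmp).trans ?_
    linarith [Real.exp_one_lt_d9]
  have h4 : (S.card:ℝ)^2 * ((2 * (q:ℝ)⁻¹)^2 * (1 + (q:ℝ)⁻¹)^S.card) ≤ (S.card:ℝ)^2 * ((2 * (q:ℝ)⁻¹)^2 * 3) := by gcongr
  have h5 := mul_le_mul_of_nonneg_left (h2.trans h4) hθ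
  linarith [show θ * ((S.card:ℝ)^2 * ((2 * (q:ℝ)⁻¹)^2 * 3)) = 12 * θ * ((S.card:ℝ) * (q:ℝ)⁻¹)^2 by ring]

open Classical in
theorem fixS (hs : 2 ≤ s) (hq : 0 < q) (S : Finset V) (N : ℕ) (θ δ ρ : ℝ) (hθ : 0 ≤ θ) (hN : θ * N ≤ 1/2)
    (hδ : 0 ≤ δ) (hρ0 : 0 ≤ ρ) (hmp : (S.card:ℝ) * (q:ℝ)⁻¹ ≤ 1)
    (hρ : ρ ≤ (S.card.choose s : ℝ) * ((((s:ℝ) * q)⁻¹)^s * (1 - (q:ℝ)⁻¹)^S.card))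
    (hδρ : 128 * (δ * ((S.card:ℝ) * (q:ℝ)⁻¹)^s) ≤ ρ) :
    Ex (fun ω : ι → V → Fin s × Fin q => if (∀ j, (Bl (ω j)).card ≤ N) ∧
        ((univ.filter (fun i => typ S (ω i) ∧ ∀ j, j ≠ i → ¬ hit S (ω i) (ω j))).card : ℝ) ≤ ρ * Fintype.card ι / 8
        then (1:ℝ) else 0) ≤
      Real.exp (Fintype.card ι * (12 * θ * ((S.card:ℝ) * (q:ℝ)⁻¹)^2) - θ * (δ * (S.card:ℝ)^2))
       + Real.exp (-(ρ * Fintype.card ι / 4)) + Real.exp (-(ρ * Fintype.card ι / 64)) := by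
  have := col_nonempty (s := s) (by omega) hq
  have b1 := chern_up (ι := ι) (fun c : V → Fin s × Fin q => if (S ∩ Bl c).card ≤ N then ((S ∩ Bl c).offDiag.card : ℝ) else 0)
    θ _ (δ * (S.card:ℝ)^2) hθ (exp_moment (by omega) hq S N θ hθ hN hmp)
  have b2 := chern_low (ι := ι) (typ (s := s) (q := q) S) ρ (hρ.trans (Ex_typ (by omega) hq S)) hρ0
  have b3 := hit_lemma (ι := ι) (typ (s := s) (q := q) S) (hit S) (δ * ((S.card:ℝ) * (q:ℝ)⁻¹)^s) (ρ * Fintype.card ι / 8) (by positivity)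
  have b4 : Real.exp (2 * (δ * ((S.card:ℝ) * (q:ℝ)⁻¹)^s) * Fintype.card ι - (ρ * Fintype.card ι / 8)/4) ≤ Real.exp (-(ρ * Fintype.card ι / 64)) := by
    refine Real.exp_le_exp.2 ?_
    have : (0:ℝ) ≤ Fintype.card ι := by positivity
    nlinarith
  refine le_trans ?_ (add_le_add (add_le_add b1 b2) (b3.trans b4))
  rw [← Ex_add, ← Ex_add]
  refine Ex_mono fun ω => ?_
  have hnn : ∀ (P : Prop) (inst : Decidable P), (0:ℝ) ≤ if P then 1 else 0 := fun P inst => by split_ifs <;> norm_num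
  by_cases h1 : δ * (S.card:ℝ)^2 ≤ ∑ i, if (S ∩ Bl (ω i)).card ≤ N then ((S ∩ Bl (ω i)).offDiag.card : ℝ) else 0
  · rw [if_pos h1]
    refine le_trans ?_ (le_add_of_nonneg_right (hnn _ _))
    refine le_trans ?_ (le_add_of_nonneg_right (hnn _ _))
    split_ifs <;> norm_num
  by_cases h2 : ((univ.filter (fun i => typ S (ω i))).card : ℝ) ≤ ρ * Fintype.card ι / 4
  · rw [if_neg h1, if_pos h2]
    have : (if (∀ j, (Bl (ω j)).card ≤ N) ∧
        ((univ.filter (fun i => typ S (ω i) ∧ ∀ j, j ≠ i → ¬ hit S (ω i) (ω j))).card : ℝ) ≤ ρ * Fintype.card ι / 8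
        then (1:ℝ) else 0) ≤ 1 := by split_ifs <;> norm_num
    refine this.trans ?_
    rw [zero_add]
    exact le_add_of_nonneg_right (hnn _ _)
  rw [if_neg h1, if_neg h2, zero_add, zero_add]
  split_ifs with h3 h4 h4
  · exact le_rfl
  · exfalso
    apply h4
    push Not at h1 h2
    refine ⟨cov_bound hs hq S ω δ ?_, ?_⟩
    · refine le_trans (le_of_eq ?_) h1.le
      refine sum_congr rfl fun i _ => ?_
      rw [if_pos ((card_le_card inter_subset_right).trans (h3.1 i))]
    · have hsplit : (univ.filter (fun i => typ S (ω i))).card ≤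
          (univ.filter (fun i => typ S (ω i) ∧ ∀ j, j ≠ i → ¬ hit S (ω i) (ω j))).card +
          (univ.filter (fun i => typ S (ω i) ∧ ∃ j, j ≠ i ∧ hit S (ω i) (ω j))).card := by
        refine le_trans (card_le_card ?_) (card_union_le _ _)
        intro i hi
        simp only [mem_filter, mem_univ, true_and, mem_union] at hi ⊢
        by_cases hc : ∃ j, j ≠ i ∧ hit S (ω i) (ω j)
        · exact Or.inr ⟨hi, hc⟩
        · push Not at hc; exact Or.inl ⟨hi, hc⟩
      have hsplit' : ((univ.filter (fun i => typ S (ω i))).card : ℝ) ≤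
          (univ.filter (fun i => typ S (ω i) ∧ ∀ j, j ≠ i → ¬ hit S (ω i) (ω j))).card +
          (univ.filter (fun i => typ S (ω i) ∧ ∃ j, j ≠ i ∧ hit S (ω i) (ω j))).card := by exact_mod_cast hsplit
      have := h3.2
      linarith
  · norm_num
  · exact le_rfl

/-- blocks are not too large -/
theorem big_block (hs : 0 < s) (hq : 0 < q) (N : ℕ) (hN : 4 * ((Fintype.card V : ℝ) * (q:ℝ)⁻¹) ≤ N) :
    Ex (fun ω : ι → V → Fin s × Fin q => if (∀ j, (Bl (ω j)).card ≤ N) then (0:ℝ) else 1) ≤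
      Fintype.card ι * Real.exp (-((N:ℝ)/4)) := by
  have := col_nonempty hs hq
  have h1 : ∀ ω : ι → V → Fin s × Fin q, (if (∀ j, (Bl (ω j)).card ≤ N) then (0:ℝ) else 1) ≤
      ∑ j, (2:ℝ)^(univ ∩ Bl (ω j)).card * ((2:ℝ)^N)⁻¹ := by
    intro ω
    split_ifs with h
    · exact sum_nonneg fun j _ => by positivity
    · push Not at h
      obtain ⟨j, hj⟩ := h
      refine le_trans ?_ (single_le_sum (f := fun j => (2:ℝ)^(univ ∩ Bl (ω j)).card * ((2:ℝ)^N)⁻¹) (fun j _ => by positivity) (mem_univ j))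
      simp only [univ_inter]
      rw [← div_eq_mul_inv, le_div_iff₀ (by positivity), one_mul]
      exact pow_le_pow_right₀ (by norm_num) hj.le
  refine (Ex_mono h1).trans ?_
  rw [Ex_sum]
  have h2 : ∀ j : ι, Ex (fun ω : ι → V → Fin s × Fin q => (2:ℝ)^(univ ∩ Bl (ω j)).card * ((2:ℝ)^N)⁻¹) ≤ Real.exp (-((N:ℝ)/4)) := by
    intro j
    rw [Ex_mul_right]
    have e1 : Ex (fun ω : ι → V → Fin s × Fin q => (2:ℝ)^(univ ∩ Bl (ω j)).card) = (1 + (q:ℝ)⁻¹)^Fintype.card V := by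
      rw [← card_univ, ← Ex_pow_Bl hs hq univ]
      have : ∀ ω : ι → V → Fin s × Fin q, (2:ℝ)^(univ ∩ Bl (ω j)).card = ∏ i, if i = j then (2:ℝ)^(univ ∩ Bl (ω i)).card else 1 := by
        intro ω; rw [prod_ite_eq' univ j]; simp
      simp only [this]
      rw [Ex_prod (fun i (c : V → Fin s × Fin q) => if i = j then (2:ℝ)^(univ ∩ Bl c).card else 1)]
      simp only [Ex_ite, Ex_const]
      rw [prod_ite_eq' univ j]; simp
    rw [e1]
    have e2 : (1 + (q:ℝ)⁻¹)^Fintype.card V ≤ Real.exp ((N:ℝ)/4) := by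
      have e1 : 1 + (q:ℝ)⁻¹ ≤ Real.exp ((q:ℝ)⁻¹) := by linarith [Real.add_one_le_exp ((q:ℝ)⁻¹)]
      refine (pow_le_pow_left₀ (by positivity) e1 _).trans ?_
      rw [← Real.exp_nat_mul]
      refine Real.exp_le_exp.2 (by linarith)
    have e3 : ((2:ℝ)^N)⁻¹ ≤ Real.exp (-((N:ℝ)/2)) := by
      rw [Real.exp_neg]
      refine inv_anti₀ (Real.exp_pos _) ?_
      rw [show (N:ℝ)/2 = N * (1/2) by ring, Real.exp_nat_mul]
      refine pow_le_pow_left₀ (Real.exp_pos _).le ?_ _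
      have h4 := Real.exp_one_lt_d9
      have h5 : Real.exp (1/2) * Real.exp (1/2) = Real.exp 1 := by rw [← Real.exp_add]; norm_num
      nlinarith [Real.exp_pos (1/2)]
    calc _ ≤ Real.exp ((N:ℝ)/4) * Real.exp (-((N:ℝ)/2)) := by gcongr
      _ = _ := by rw [← Real.exp_add]; congr 1; ring
  refine (sum_le_sum fun j _ => h2 j).trans ?_
  simp [card_univ]

/-- flags -/
def Fl (ω : ι → V → Fin s × Fin q) : Finset (V × ι) := univ.filter fun x => x.1 ∈ Bl (ω x.2)

theorem Ex_Fl (hs : 0 < s) (hq : 0 < q) (U : Finset (V × ι)) :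
    Ex (fun ω : ι → V → Fin s × Fin q => if U ⊆ Fl ω then (1:ℝ) else 0) = ((q:ℝ)⁻¹)^U.card := by
  have h : ∀ ω : ι → V → Fin s × Fin q, (if U ⊆ Fl ω then (1:ℝ) else 0) =
      ∏ j, if (U.filter (fun x => x.2 = j)).image Prod.fst ⊆ Bl (ω j) then (1:ℝ) else 0 := by
    intro ω
    split_ifs with h
    · symm; refine prod_eq_one fun j _ => ?_
      rw [if_pos]
      intro v hv
      obtain ⟨x, hx, rfl⟩ := mem_image.1 hv
      obtain ⟨hx1, rfl⟩ := mem_filter.1 hx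
      exact (mem_filter.1 (h hx1)).2
    · rw [not_subset] at h
      obtain ⟨x, hx, hx2⟩ := h
      symm; refine prod_eq_zero (mem_univ x.2) ?_
      rw [if_neg]
      intro hh
      apply hx2
      refine mem_filter.2 ⟨mem_univ _, hh (mem_image.2 ⟨x, mem_filter.2 ⟨hx, rfl⟩, rfl⟩)⟩
  simp only [h]
  rw [Ex_prod (fun j (c : V → Fin s × Fin q) => if (U.filter (fun x => x.2 = j)).image Prod.fst ⊆ Bl c then (1:ℝ) else 0)]
  simp only [Ex_sub_Bl hs hq]
  rw [prod_pow_eq_pow_sum]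
  congr 1
  rw [card_eq_sum_card_fiberwise (s := U) (t := univ) (f := fun x : V × ι => x.2) (by intro x _; simp)]
  refine sum_congr rfl fun j _ => ?_
  refine card_image_of_injOn ?_
  intro x hx y hy hxy
  simp only [coe_filter, Set.mem_ofPred_eq] at hx hy
  exact Prod.ext hxy (hx.2.trans hy.2.symm)
end
end ModPT3

section ModPF1
set_option linter.unusedSectionVars false
set_option linter.unusedVariables false
open Finset

section
variable {V ι : Type*} [Fintype V] [DecidableEq V] [Fintype ι] [DecidableEq ι] {s q : ℕ}

def GG (ω : ι → V → Fin s × Fin q) : SimpleGraph V where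
  Adj u v := u ≠ v ∧ (univ.filter (fun b => u ∈ Bl (ω b) ∧ v ∈ Bl (ω b))).card = 1 ∧
    ∀ b, u ∈ Bl (ω b) → v ∈ Bl (ω b) → (ω b u).1 ≠ (ω b v).1
  symm := by
    constructor
    rintro u v ⟨h1, h2, h3⟩
    refine ⟨h1.symm, ?_, fun b hu hv => (h3 b hv hu).symm⟩
    rw [← h2]; congr 1; ext b; simp [and_comm]
  loopless := by
    constructor
    rintro u ⟨h, -⟩
    exact h rfl

open Classical in
theorem det_part (H h K a bL f D m M : ℕ) (hs : 4 ≤ s)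
    (hH : 10*(s+3)^4 ≤ H) (hh : h = (3*s+1)*H) (hK : (K:ℤ) = (s+3)*H - 2*s) (ha : (a:ℤ) = 2*h - (2*H+3))
    (hb : (bL:ℤ) = 2*h - K) (hf : (s+3)^2 ≤ f)
    (ω : ι → V → Fin s × Fin q)
    (hdeg : ∀ u v : V, ((CA (ι := ι) (a:ℤ) bL h f u v).filter (fun A => A ⊆ Fl ω)).card ≤ D)
    (hgood : ∀ S : Finset V, S.card = m → M ≤ (univ.filter (fun i => typ S (ω i) ∧ ∀ j, j ≠ i → ¬ hit S (ω i) (ω j))).card)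
    (hnum : ((Fintype.card V : ℝ)^m) *
      (1 - (1/2)^(s^2 + s^2*D*(s+3)^2))^(M/((s^2+s^2*D*(s+3)^2)*(1+D*(s+3)^2)+1)) < 1) :
    ∃ G : SimpleGraph V, G.CliqueFree (s+3) ∧ ∀ S : Finset V, S.card = m → ¬ G.CliqueFreeOn S s := by
  set B : ι → Finset V := fun j => Bl (ω j) with hB
  have hHpos : 0 < H := lt_of_lt_of_le (by positivity) hH
  have hHs : s ≤ H := by
    have : (s+3)^1 ≤ (s+3)^4 := Nat.pow_le_pow_right (by omega) (by norm_num)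
    rw [pow_one] at this
    omega
  have hhZ : (h:ℤ) = (3*s+1)*H := by rw [hh]; push_cast; ring
  have hsZ : (4:ℤ) ≤ s := by exact_mod_cast hs
  have hHZ : (s:ℤ) ≤ H := by exact_mod_cast hHs
  have hK0 : 0 < (K:ℤ) := by rw [hK]; nlinarith
  have hKh : (K:ℤ) < h := by rw [hK, hhZ]; nlinarith
  have hah : (h:ℤ) ≤ a := by rw [ha, hhZ]; nlinarith
  have hh0 : (0:ℤ) < h := by linarith
  refine bits (GG ω) (univ.filter (fun P => Crit (a:ℤ) bL h (s+3) B P)) s (s+3) (s+3) D m M (by omega) ?_ ?_ ?_ ?_ ?_ hnum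
  · intro P hP; exact (mem_filter.1 hP).2.two
  · intro P hP; exact (mem_filter.1 hP).2.le
  · intro T hT
    rw [SimpleGraph.isNClique_iff] at hT
    have hadj : ∀ u ∈ T, ∀ v ∈ T, u ≠ v → (GG ω).Adj u v := fun u hu v hv huv => hT.1 hu hv huv
    have hlin : Lin B T := fun u hu v hv huv => (hadj u hu v hv huv).2.1
    have hle : ∀ b, ((T ∩ B b).card : ℤ) ≤ s := by
      intro b
      have : (T ∩ B b).card ≤ (univ : Finset (Fin s)).card := by
        refine card_le_card_of_injOn (fun v => (ω b v).1) (fun _ _ => by simp) ?_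
        intro u hu v hv he
        by_contra huv
        rw [mem_coe, mem_inter] at hu hv
        exact (hadj u hu.1 v hv.1 huv).2.2 b hu.2 hv.2 he
      rw [card_univ, Fintype.card_fin] at this
      exact_mod_cast this
    have hci := config_ineq (s:ℤ) H h K a hsZ (by exact_mod_cast hH) hhZ hK ha B T (by rw [hT.2]; push_cast; ring) hlin hle
    rw [← hb] at hci
    obtain ⟨P, h1, h2⟩ := crit_exists (a:ℤ) bL h (s+3) B T hlin hT.2 (by omega) hah (by linarith)
    exact ⟨P, mem_filter.2 ⟨mem_univ _, h2⟩, h1⟩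
  · intro e
    induction e using Sym2.ind with
    | _ u v =>
    refine le_trans ?_ (hdeg u v)
    refine card_le_card_of_injOn (flg B) ?_ ?_
    · intro P hP
      rw [mem_coe, mem_filter, mem_filter, mem_prs] at hP
      obtain ⟨⟨-, hc⟩, hu, hv, huv⟩ := hP
      rw [mem_coe, mem_filter, CA, mem_filter]
      refine ⟨⟨mem_univ _, ?_, ?_⟩, ?_⟩
      · refine (flg_card hc.lin).trans (le_trans ?_ hf)
        exact Nat.pow_le_pow_left hc.le 2
      · intro A hA hne
        exact crit_flg hc hh0 (by linarith) (by linarith) hu hv huv A (lt_of_le_of_ne (mem_powerset.1 hA) hne)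
      · intro x hx
        exact mem_filter.2 ⟨mem_univ _, (mem_filter.1 hx).2.2.1⟩
    · intro P hP P' hP' he
      rw [mem_coe, mem_filter, mem_filter] at hP hP'
      rw [← flg_pts hP.1.2.lin hP.1.2.two, he, flg_pts hP'.1.2.lin hP'.1.2.two]
  · intro S hS
    set I := univ.filter (fun i => typ S (ω i) ∧ ∀ j, j ≠ i → ¬ hit S (ω i) (ω j)) with hI
    have hpair : ∀ i ∈ I, ∀ j, ∀ u v, u ≠ v → u ∈ S ∩ B i → v ∈ S ∩ B i → u ∈ B j → v ∈ B j → j = i := by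
      intro i hi j u v huv hu hv hu' hv'
      by_contra hne
      rw [mem_inter] at hu hv
      exact (mem_filter.1 hi).2.2 j hne ⟨u, v, hu.1, hv.1, huv, ⟨hu.2, hv.2⟩, hu', hv'⟩
    refine ⟨I.image (fun i => S ∩ B i), ?_, ?_, ?_⟩
    · rw [card_image_of_injOn]
      · exact hgood S hS
      · intro i hi j hj he
        simp only at he
        have hc : (S ∩ B i).card = s := (mem_filter.1 hi).2.1.1
        obtain ⟨u, hu, v, hv, huv⟩ := Finset.one_lt_card.1 (show 1 < (S ∩ B i).card by omega)
        have hu' := hu; have hv' := hv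
        rw [he, mem_inter] at hu' hv'
        exact (hpair i hi j u v huv hu hv hu'.2 hv'.2).symm
    · intro R hR
      obtain ⟨i, hi, rfl⟩ := mem_image.1 hR
      refine ⟨inter_subset_left, ?_, ?_⟩
      · rw [SimpleGraph.isNClique_iff]
        refine ⟨?_, (mem_filter.1 hi).2.1.1⟩
        intro u hu v hv huv
        rw [mem_coe] at hu hv
        refine ⟨huv, ?_, ?_⟩
        · rw [card_eq_one]
          refine ⟨i, ?_⟩
          ext j
          simp only [mem_filter, mem_univ, true_and, mem_singleton]
          constructor
          · rintro ⟨h1, h2⟩; exact hpair i hi j u v huv hu hv h1 h2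
          · rintro rfl; exact ⟨(mem_inter.1 hu).2, (mem_inter.1 hv).2⟩
        · intro j h1 h2
          obtain rfl := hpair i hi j u v huv hu hv h1 h2
          exact (mem_filter.1 hi).2.1.2 u hu v hv huv
      · intro P hP hsub
        exact (mem_filter.1 hP).2.nb i (hsub.trans inter_subset_right)
    · intro R hR R' hR' hne
      obtain ⟨i, hi, rfl⟩ := mem_image.1 hR
      obtain ⟨j, hj, rfl⟩ := mem_image.1 hR'
      rw [Finset.disjoint_left]
      intro e
      induction e using Sym2.ind with
      | _ u v =>
      intro h1 h2
      rw [mem_prs] at h1 h2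
      apply hne
      have := hpair i hi j u v h1.2.2 h1.1 h1.2.1 (mem_inter.1 h2.1).2 (mem_inter.1 h2.2.1).2
      rw [this]
end
end ModPF1

section ModPF2
set_option linter.unusedSectionVars false
set_option linter.unusedVariables false
open Finset

section
variable {V ι : Type*} [Fintype V] [DecidableEq V] [Fintype ι] [DecidableEq ι] {s q : ℕ}

theorem ind_zero {P : Prop} [Decidable P] (h : (if P then (0:ℝ) else 1) < 1) : P := by
  by_contra hP; simp [hP] at h

open Classical in
theorem comb (hs : 0 < s) (hq : 0 < q) (m N : ℕ) (T E1 E2 E3 : ℝ) (Deg : (ι → V → Fin s × Fin q) → Prop)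
    (hE1 : 0 ≤ E1)
    (h1 : ∀ S : Finset V, S.card = m → Ex (fun ω : ι → V → Fin s × Fin q => if (∀ j, (Bl (ω j)).card ≤ N) ∧
      ((univ.filter (fun i => typ S (ω i) ∧ ∀ j, j ≠ i → ¬ hit S (ω i) (ω j))).card:ℝ) ≤ T then (1:ℝ) else 0) ≤ E1)
    (h2 : Ex (fun ω : ι → V → Fin s × Fin q => if (∀ j, (Bl (ω j)).card ≤ N) then (0:ℝ) else 1) ≤ E2)
    (h3 : Ex (fun ω : ι → V → Fin s × Fin q => if Deg ω then (0:ℝ) else 1) ≤ E3)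
    (hE : (Fintype.card V : ℝ)^m * E1 + E2 + E3 < 1) :
    ∃ ω : ι → V → Fin s × Fin q, Deg ω ∧ ∀ S : Finset V, S.card = m →
      T < ((univ.filter (fun i => typ S (ω i) ∧ ∀ j, j ≠ i → ¬ hit S (ω i) (ω j))).card:ℝ) := by
  have := col_nonempty hs hq
  set X : Finset V → (ι → V → Fin s × Fin q) → ℝ := fun S ω => if (∀ j, (Bl (ω j)).card ≤ N) ∧
      ((univ.filter (fun i => typ S (ω i) ∧ ∀ j, j ≠ i → ¬ hit S (ω i) (ω j))).card:ℝ) ≤ T then (1:ℝ) else 0 with hX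
  set Y : (ι → V → Fin s × Fin q) → ℝ := fun ω => if (∀ j, (Bl (ω j)).card ≤ N) then (0:ℝ) else 1 with hY
  set W : (ι → V → Fin s × Fin q) → ℝ := fun ω => if Deg ω then (0:ℝ) else 1 with hW
  have hX0 : ∀ S ω, 0 ≤ X S ω := by intro S ω; simp only [hX]; split_ifs <;> norm_num
  have hY0 : ∀ ω, 0 ≤ Y ω := by intro ω; simp only [hY]; split_ifs <;> norm_num
  have hW0 : ∀ ω, 0 ≤ W ω := by intro ω; simp only [hW]; split_ifs <;> norm_num
  have hlt : Ex (fun ω => (∑ S ∈ powersetCard m (univ : Finset V), X S ω) + Y ω + W ω) < 1 := by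
    rw [Ex_add, Ex_add, Ex_sum]
    refine lt_of_le_of_lt (add_le_add (add_le_add ?_ h2) h3) hE
    calc _ ≤ ∑ S ∈ powersetCard m (univ : Finset V), E1 :=
          sum_le_sum fun S hS => h1 S (mem_powersetCard.1 hS).2
      _ = ((Fintype.card V).choose m : ℝ) * E1 := by
          rw [sum_const, card_powersetCard, card_univ, nsmul_eq_mul]
      _ ≤ _ := by
          refine mul_le_mul_of_nonneg_right ?_ hE1
          exact_mod_cast Nat.choose_le_pow _ _
  obtain ⟨ω, hω⟩ := exists_lt_of_Ex_lt hlt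
  have hs0 : 0 ≤ ∑ S ∈ powersetCard m (univ : Finset V), X S ω := sum_nonneg fun S _ => hX0 S ω
  have hYl : ∀ j, (Bl (ω j)).card ≤ N := ind_zero (by linarith [hW0 ω] : Y ω < 1)
  refine ⟨ω, ind_zero (by linarith [hY0 ω] : W ω < 1), ?_⟩
  intro S hS
  by_contra hc
  push Not at hc
  have h4 := single_le_sum (f := fun S => X S ω) (fun S _ => hX0 S ω) (mem_powersetCard.2 ⟨subset_univ S, hS⟩)
  have h5 : X S ω = 1 := if_pos ⟨hYl, hc⟩
  simp only [h5] at h4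
  linarith [hY0 ω, hW0 ω]
end
end ModPF2

section ModPF3
set_option linter.unusedSectionVars false
set_option linter.unusedVariables false
open Finset

set_option maxHeartbeats 1000000 in
open Classical in
theorem perz {V ι : Type*} [Fintype V] [DecidableEq V] [Fintype ι] [DecidableEq ι] (s H h K a bL μ f R D z : ℕ) (c : ℝ) (hs : 4 ≤ s)
    (hV : Fintype.card V = z^a) (hι : Fintype.card ι = z^bL)
    (hH : 10*(s+3)^4 ≤ H) (hh : h = (3*s+1)*H) (hK : K + 2*s = (s+3)*H) (ha : a + (2*H+3) = 2*h)
    (hb : bL + K = 2*h) (hμ : μ + (2*H+2) = h) (hf : f = (s+3)^2) (hD : D = 2^(R*f))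
    (hK1 : 1 ≤ K) (hμ2 : 2 ≤ μ)
    (hR : R = 2*a+1)
    (hc : c = 1/(2*(2*s)^s*(s.factorial)))
    (e1 : 2*s ≤ z) (e2 : 8 ≤ c*z) (e3 : 24*128 ≤ c*z)
    (e4 : (z:ℝ)^a * (1 - (1/2)^(s^2 + s^2*D*(s+3)^2))^(z/((s^2+s^2*D*(s+3)^2)*(1+D*(s+3)^2)+1)) < 1)
    (e5 : (z:ℝ)^a * Real.exp (-(c/2048*z)) ≤ 1/12)
    (e6 : (z:ℝ)^bL * Real.exp (-(z:ℝ)) ≤ 1/4)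
    (e7 : (2^(R*f) * ((f+1)^2 * 2^((2*f+2)*(2*f))):ℝ)^R * 4 ≤ z) :
    ∃ G : SimpleGraph V, G.CliqueFree (s+3) ∧ ∀ A : Finset V, G.CliqueFreeOn A s → A.card ≤ z^μ := by
  have hz0 : 0 < z := by omega
  have hzR : (0:ℝ) < z := by exact_mod_cast hz0
  have hz8 : (8:ℝ) ≤ z := by exact_mod_cast (show 8 ≤ z by omega)
  have hz1 : (1:ℝ) ≤ z := by linarith
  have hc0 : 0 < c := by rw [hc]; have : (0:ℝ) < s := by (exact_mod_cast (by omega : 0 < s))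
                         positivity
  have hzm : z ≤ z^μ := Nat.le_self_pow (by omega) z
  have hm0 : (0:ℝ) < (z:ℝ)^μ := by positivity
  have hm1 : (1:ℝ) ≤ (z:ℝ)^μ := one_le_pow₀ hz1
  -- the graph statement
  suffices hG : ∃ G : SimpleGraph V, G.CliqueFree (s+3) ∧ ∀ S : Finset V, S.card = z^μ → ¬ G.CliqueFreeOn S s by
    obtain ⟨G, h1, h2⟩ := hG
    refine ⟨G, h1, fun A hA => ?_⟩
    by_contra hlt
    push Not at hlt
    obtain ⟨S, hSA, hS⟩ := exists_subset_card_eq hlt.le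
    refine h2 S hS ?_
    intro T hT
    exact hA (hT.trans (by exact_mod_cast hSA))
  have hq : 0 < z^h := by positivity
  have hmp : ((z^μ : ℕ):ℝ) * ((z^h : ℕ):ℝ)⁻¹ = ((z:ℝ)^(2*H+2))⁻¹ := by
    rw [← hμ]; push_cast; rw [pow_add]; field_simp
  have hqh : ((z^h : ℕ):ℝ) = (z:ℝ)^μ * (z:ℝ)^(2*H+2) := by rw [← hμ, ← pow_add]; push_cast; ring
  set x : ℝ := ((z:ℝ)^(2*H+2))⁻¹ with hx
  have hx0 : 0 < x := by positivity
  have hzx : (z:ℝ) ≤ (z:ℝ)^(2*H+2) := le_self_pow₀ hz1 (by omega)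
  have hx8 : x ≤ 1/8 := by
    rw [hx, inv_le_comm₀ (by positivity) (by norm_num)]; norm_num; linarith
  have hbL : bL = (2*H+2)*s + (μ + 2) := by
    zify at hh hK ha hb hμ ⊢
    linear_combination hb - hK - hμ + hh
  have hLx : (z:ℝ)^bL * x^s = (z:ℝ)^μ * (z:ℝ)^2 := by
    rw [hbL, hx, inv_pow, ← pow_mul, pow_add, pow_add]; field_simp
  have hLx2 : (z:ℝ)^bL * x^2 = ((z:ℝ)^μ)^2 * ((z:ℝ)^K)⁻¹ := by
    have : bL + K = μ*2 + (2*H+2)*2 := by omega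
    have h2 : (z:ℝ)^bL * (z:ℝ)^K = ((z:ℝ)^μ)^2 * ((z:ℝ)^(2*H+2))^2 := by
      rw [← pow_add, this, pow_add, pow_mul, pow_mul]
    rw [hx]; field_simp; linarith
  set N : ℕ := 4 * z^(μ-1) with hN
  set θ : ℝ := z/(8*(z:ℝ)^μ) with hθ
  have hzμ : (z:ℝ)^μ = (z:ℝ)^(μ-1) * z := by rw [← pow_succ]; congr 1; omega
  have hθN : θ * N ≤ 1/2 := by
    rw [hθ, hN, hzμ]; push_cast; apply le_of_eq; field_simp; norm_num
  set ρ : ℝ := c * x^s with hρ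
  have hkz : (0:ℝ) < c/2048*z := by positivity
  set E : ℝ := Real.exp (-(c/2048*z*(z:ℝ)^μ)) with hE
  have hfix : ∀ S : Finset V, S.card = z^μ →
      Ex (fun ω : ι → V → Fin s × Fin (z^h) => if (∀ j, (Bl (ω j)).card ≤ N) ∧
      ((univ.filter (fun i => typ S (ω i) ∧ ∀ j, j ≠ i → ¬ hit S (ω i) (ω j))).card:ℝ) ≤ ρ*Fintype.card ι/8 then (1:ℝ) else 0) ≤ 3*E := by
    intro S hS
    have hS' : (S.card:ℝ) * ((z^h : ℕ):ℝ)⁻¹ = x := by rw [hS, hmp]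
    have hρc : ρ ≤ (S.card.choose s:ℝ) * ((((s:ℝ)*(z^h:ℕ))⁻¹)^s * (1-((z^h:ℕ):ℝ)⁻¹)^S.card) := by
      have hsR : (0:ℝ) < s := by exact_mod_cast (by omega : 0 < s)
      have hqR : (1:ℝ) ≤ ((z^h:ℕ):ℝ) := by exact_mod_cast hq
      have a1 : (1/2:ℝ) ≤ (1-((z^h:ℕ):ℝ)⁻¹)^S.card := by
        have := one_add_mul_le_pow (a := -((z^h:ℕ):ℝ)⁻¹) (by have := inv_le_one_of_one_le₀ hqR; linarith) S.card
        rw [← sub_eq_add_neg] at this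
        refine le_trans ?_ this
        have : (S.card:ℝ) * -((z^h:ℕ):ℝ)⁻¹ = -x := by rw [← hS']; ring
        rw [this]; linarith
      have a2 : ((S.card:ℝ)/2)^s / s.factorial ≤ (S.card.choose s:ℝ) := by
        have b1 := Nat.pow_le_choose (α := ℝ) s S.card
        refine le_trans ?_ b1
        have : (S.card:ℝ)/2 ≤ ((S.card + 1 - s : ℕ):ℝ) := by
          rw [Nat.cast_sub (by omega)]
          have : (2*s:ℝ) ≤ S.card := by exact_mod_cast (by omega : 2*s ≤ S.card)
          push_cast; linarith
        gcongr
      calc ρ = ((S.card:ℝ)/2)^s / s.factorial * ((((s:ℝ)*(z^h:ℕ))⁻¹)^s * (1/2)) := by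
            rw [hρ, hc, ← hS']
            simp only [mul_pow, inv_pow, div_pow]
            field_simp
        _ ≤ _ := by gcongr
    have key := fixS (ι := ι) (s := s) (q := z^h) (by omega) hq S N θ (c/128) ρ (by positivity) hθN (by positivity) (by positivity)
      (by rw [hS']; linarith) hρc (by rw [hS', hρ]; apply le_of_eq; ring)
    rw [hS'] at key
    refine key.trans ?_
    simp only [hι, hS]
    push_cast
    have t0 : ρ * (z:ℝ)^bL = c * ((z:ℝ)^μ * (z:ℝ)^2) := by rw [hρ, ← hLx]; ring
    have hzz : (z:ℝ) ≤ (z:ℝ)^2 := by nlinarith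
    have hcm : 0 < c * (z:ℝ)^μ := by positivity
    have hcz : c * (z:ℝ)^μ * z ≤ c * (z:ℝ)^μ * (z:ℝ)^2 := by gcongr
    have hcz0 : 0 < c * (z:ℝ)^μ * z := by positivity
    have t2 : Real.exp (-(ρ * (z:ℝ)^bL/4)) ≤ E := by
      rw [t0, hE]; apply Real.exp_le_exp.2; linarith
    have t3 : Real.exp (-(ρ * (z:ℝ)^bL/64)) ≤ E := by
      rw [t0, hE]; apply Real.exp_le_exp.2; linarith
    have t1 : Real.exp ((z:ℝ)^bL * (12*θ*x^2) - θ*(c/128*((z:ℝ)^μ)^2)) ≤ E := by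
      rw [hE]; apply Real.exp_le_exp.2
      have hzK : (z:ℝ) ≤ (z:ℝ)^K := le_self_pow₀ hz1 (by omega)
      have hKi : 12*((z:ℝ)^K)⁻¹ ≤ c/256 := by
        have : ((z:ℝ)^K)⁻¹ ≤ (z:ℝ)⁻¹ := inv_anti₀ hzR hzK
        have h3 : (z:ℝ)⁻¹ ≤ c/(24*128) := by
          rw [inv_eq_one_div, div_le_div_iff₀ hzR (by norm_num)]; linarith
        linarith
      have e : (z:ℝ)^bL * (12*θ*x^2) - θ*(c/128*((z:ℝ)^μ)^2) = θ*((z:ℝ)^μ)^2 * (12*((z:ℝ)^K)⁻¹ - c/128) := by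
        linear_combination 12*θ*hLx2
      have e' : θ*((z:ℝ)^μ)^2 = z*(z:ℝ)^μ/8 := by rw [hθ]; field_simp
      rw [e, e']
      have : z*(z:ℝ)^μ/8 * (12*((z:ℝ)^K)⁻¹ - c/128) ≤ z*(z:ℝ)^μ/8 * (-(c/256)) := by
        apply mul_le_mul_of_nonneg_left _ (by positivity); linarith
      linarith
    linarith
  have hbig := big_block (V := V) (ι := ι) (s := s) (q := z^h) (by omega) hq N (by
    rw [hV, hN]
    have : a = h + (μ-1) := by omega
    rw [this, pow_add]; push_cast; apply le_of_eq; field_simp)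
  obtain ⟨Deg, hDeg⟩ : ∃ Deg : (ι → V → Fin s × Fin (z^h)) → Prop, ∀ ω, Deg ω ↔
      ∀ u v, ((CA (ι:=ι) (a:ℤ) bL h f u v).filter (fun A => A ⊆ Fl ω)).card ≤ 2^(R*f) := ⟨_, fun _ => Iff.rfl⟩
  have hdeg := deg_main (V := V) (ι := ι) a bL h z f R hz0 hV.le hι.le
    (fun ω : ι → V → Fin s × Fin (z^h) => Fl ω)
    (fun U => by rw [Ex_Fl (by omega) hq]; push_cast; rfl)
    Deg (fun ω hω => (hDeg ω).2 hω)
  have hsum : (Fintype.card V : ℝ)^(z^μ) * (3*E) + 1/4 + 1/4 < 1 := by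
    have : (Fintype.card V : ℝ)^(z^μ) * E = ((z:ℝ)^a * Real.exp (-(c/2048*z)))^(z^μ) := by
      rw [hV, mul_pow, ← Real.exp_nat_mul, hE]; push_cast; congr 2; ring
    have h2 : ((z:ℝ)^a * Real.exp (-(c/2048*z)))^(z^μ) ≤ 1/12 := by
      refine le_trans (pow_le_of_le_one (by positivity) (by linarith) (by positivity)) e5
    linarith
  obtain ⟨ω, hω1, hω2⟩ := comb (by omega) hq (z^μ) N _ (3*E) (1/4) (1/4) Deg (by positivity) hfix (hbig.trans (by
      refine le_trans ?_ e6
      rw [hι, hN]; push_cast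
      gcongr
      have : (z:ℝ) ≤ (z:ℝ)^(μ-1) := le_self_pow₀ hz1 (by omega)
      linarith)) (hdeg.trans (by
      rw [div_pow]
      have hpz : (z:ℝ)^R = (z:ℝ)^(2*a) * z := by rw [hR, pow_succ]
      rw [hpz]
      generalize ((2^(R*f) * ((f+1)^2 * 2^((2*f+2)*(2*f))):ℝ)^R) = Q at e7 ⊢
      have : (z:ℝ)^(2*a) * (Q / ((z:ℝ)^(2*a)*z)) = Q / z := by field_simp
      rw [this, div_le_iff₀ hzR]; linarith)) hsum
  refine det_part (s := s) (q := z^h) H h K a bL f D (z^μ) (z^μ*z) hs hH hh (by push_cast [← Nat.cast_mul]; zify at hK; linarith) (by zify at ha; linarith) (by zify at hb; linarith) hf.ge ω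
    (by rw [hD]; exact (hDeg ω).1 hω1) ?_ ?_
  · intro S hS
    have h1 := hω2 S hS
    rw [hι] at h1
    push_cast at h1
    have t0 : ρ * (z:ℝ)^bL = c * ((z:ℝ)^μ * (z:ℝ)^2) := by rw [hρ, ← hLx]; ring
    rw [t0] at h1
    have h2 : (z:ℝ)^μ * z ≤ c * ((z:ℝ)^μ * (z:ℝ)^2) / 8 := by
      have : (z:ℝ)^μ * z * 8 ≤ (z:ℝ)^μ * z * (c*z) := by gcongr
      nlinarith
    have h3 := h2.trans h1.le
    exact_mod_cast h3
  · set c2 := (s^2+s^2*D*(s+3)^2)*(1+D*(s+3)^2)+1 with hc2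
    set β : ℝ := (1/2)^(s^2 + s^2*D*(s+3)^2) with hβ
    have hβ1 : β ≤ 1 := pow_le_one₀ (by norm_num) (by norm_num)
    have hβ0 : 0 < β := by positivity
    rw [hV]
    have hdiv : z^μ * (z/c2) ≤ z^μ*z/c2 := Nat.mul_div_le_mul_div_assoc _ _ _
    calc _ ≤ ((z^a:ℕ):ℝ)^(z^μ) * (1-β)^(z^μ*(z/c2)) := by
          gcongr ?_ * ?_
          exact pow_le_pow_of_le_one (by linarith) (by linarith) hdiv
      _ = ((z:ℝ)^a * (1-β)^(z/c2))^(z^μ) := by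
          rw [mul_pow, ← pow_mul, ← pow_mul]; push_cast; rw [← pow_mul]; congr 2; ring
      _ < 1 := by
          refine pow_lt_one₀ ?_ e4 (by positivity)
          have : 0 ≤ 1 - β := by linarith
          positivity
end ModPF3

section ModPF4
open Filter

theorem ev_exp (k : ℕ) (κ ε : ℝ) (hκ : 0 < κ) (hε : 0 < ε) :
    ∀ᶠ z : ℕ in atTop, (z:ℝ)^k * Real.exp (-(κ*z)) < ε := by
  have h1 := (Real.tendsto_pow_mul_exp_neg_atTop_nhds_zero k).comp
    ((tendsto_natCast_atTop_atTop (R := ℝ)).const_mul_atTop hκ)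
  have h2 := h1.eventually (gt_mem_nhds (show (0:ℝ) < κ^k*ε by positivity))
  filter_upwards [h2] with z hz
  simp only [Function.comp] at hz
  rw [mul_pow, mul_assoc] at hz
  exact lt_of_mul_lt_mul_left hz (by positivity)

theorem ev_pow (k c2 : ℕ) (β : ℝ) (hc : 0 < c2) (hβ : 0 < β) (hβ1 : β ≤ 1) :
    ∀ᶠ z : ℕ in atTop, (z:ℝ)^k * (1-β)^(z/c2) < 1 := by
  have hcR : (0:ℝ) < c2 := by exact_mod_cast hc
  filter_upwards [ev_exp k (β/c2) (Real.exp (-β)) (by positivity) (Real.exp_pos _)] with z hz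
  have h1 : (1-β)^(z/c2) ≤ Real.exp (-β*(z/c2 : ℕ)) := by
    rw [mul_comm, Real.exp_nat_mul]
    refine pow_le_pow_left₀ (by linarith) ?_ _
    have := Real.add_one_le_exp (-β); linarith
  have h2 : (z:ℝ)/c2 - 1 ≤ ((z/c2 : ℕ):ℝ) := by
    have := Nat.lt_div_mul_add (a := z) hc
    have : (z:ℝ) < (z/c2:ℕ) * c2 + c2 := by exact_mod_cast this
    rw [sub_le_iff_le_add, div_le_iff₀ hcR]; nlinarith
  have h3 : Real.exp (-β*(z/c2 : ℕ)) ≤ Real.exp (-(β/c2*z)) * Real.exp β := by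
    rw [← Real.exp_add]; apply Real.exp_le_exp.2
    have : β * ((z:ℝ)/c2 - 1) ≤ β * ((z/c2 : ℕ):ℝ) := by gcongr
    have e : β/c2*z = β * ((z:ℝ)/c2) := by ring
    rw [e]; linarith
  calc _ ≤ (z:ℝ)^k * (Real.exp (-(β/c2*z)) * Real.exp β) := by gcongr; exact h1.trans h3
    _ = (z:ℝ)^k * Real.exp (-(β/c2*z)) * Real.exp β := by ring
    _ < Real.exp (-β) * Real.exp β := by gcongr
    _ = 1 := by rw [← Real.exp_add]; simp

theorem partB (s : ℕ) (hs : 4 ≤ s) : ∃ a μ : ℕ, 0 < a ∧ 6*s*μ < (3*s-1)*a ∧ ∃ Z : ℕ, ∀ z ≥ Z,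
    ∃ G : SimpleGraph (Fin (z^a)), G.CliqueFree (s+3) ∧
      ∀ A : Finset (Fin (z^a)), G.CliqueFreeOn A s → A.card ≤ z^μ := by
  obtain ⟨H, hH⟩ : ∃ H, H = 10*(s+3)^4 := ⟨_, rfl⟩
  have hHs : s + 3 ≤ H := by
    have : (s+3)^1 ≤ (s+3)^4 := Nat.pow_le_pow_right (by omega) (by norm_num)
    rw [pow_one] at this
    omega
  obtain ⟨h, hh⟩ : ∃ h, h = (3*s+1)*H := ⟨_, rfl⟩
  obtain ⟨K, hK⟩ : ∃ K, K + 2*s = (s+3)*H := ⟨(s+3)*H-2*s, Nat.sub_add_cancel (by nlinarith)⟩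
  have hK1 : 1 ≤ K := by nlinarith
  have hhH : 13*H ≤ h := by nlinarith
  obtain ⟨a, ha⟩ : ∃ a, a + (2*H+3) = 2*h := ⟨2*h-(2*H+3), by omega⟩
  obtain ⟨μ, hμ⟩ : ∃ μ, μ + (2*H+2) = h := ⟨h-(2*H+2), by omega⟩
  obtain ⟨bL, hb⟩ : ∃ bL, bL + K = 2*h := ⟨2*h-K, Nat.sub_add_cancel (by nlinarith)⟩
  obtain ⟨f, hf⟩ : ∃ f, f = (s+3)^2 := ⟨_, rfl⟩
  obtain ⟨R, hR⟩ : ∃ R, R = 2*a+1 := ⟨_, rfl⟩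
  obtain ⟨D, hD⟩ : ∃ D, D = 2^(R*f) := ⟨_, rfl⟩
  obtain ⟨c, hc⟩ : ∃ c : ℝ, c = 1/(2*(2*s)^s*(s.factorial)) := ⟨_, rfl⟩
  have hc0 : 0 < c := by
    have : (0:ℝ) < s := by exact_mod_cast (by omega : 0 < s)
    rw [hc]; positivity
  refine ⟨a, μ, by omega, ?_, ?_⟩
  · zify [show 1 ≤ 3*s by omega]
    have e1 : (μ:ℤ) = (3*s-1)*H - 2 := by zify at hμ hh; linear_combination hμ + hh
    have e2 : (a:ℤ) = 6*s*H - 3 := by zify at ha hh; linear_combination ha + 2*hh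
    rw [e1, e2]; nlinarith
  have hcast := tendsto_natCast_atTop_atTop (R := ℝ)
  have hcz := hcast.const_mul_atTop hc0
  rw [← eventually_atTop]
  filter_upwards [eventually_ge_atTop (2*s), hcz.eventually_ge_atTop 8, hcz.eventually_ge_atTop (24*128),
    ev_pow a ((s^2+s^2*D*(s+3)^2)*(1+D*(s+3)^2)+1) ((1/2)^(s^2 + s^2*D*(s+3)^2)) (by omega) (by positivity)
      (pow_le_one₀ (by norm_num) (by norm_num)),
    ev_exp a (c/2048) (1/12) (by positivity) (by norm_num),
    ev_exp bL 1 (1/4) (by norm_num) (by norm_num),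
    hcast.eventually_ge_atTop ((2^(R*f) * ((f+1)^2 * 2^((2*f+2)*(2*f))):ℝ)^R * 4)] with z e1 e2 e3 e4 e5 e6 e7
  exact perz (V := Fin (z^a)) (ι := Fin (z^bL)) s H h K a bL μ f R D z c hs (by simp) (by simp) hH.ge hh hK ha hb hμ hf hD hK1 (by omega) hR hc
    e1 e2 e3 e4 e5.le (by rw [one_mul] at e6; exact e6.le) e7
end ModPF4

/-- For every integer `s ≥ 4`, the ratio `f_{s+1,s+3}(n)/f_{s,s+3}(n)` tends to infinity
as `n → ∞`. -/
theorem erdosRogers_ratio_tendsto_atTop_sPlusThree (s : ℕ) (hs : 4 ≤ s) :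
    Filter.Tendsto
      (fun n : ℕ => (erdosRogers (s + 1) (s + 3) n : ℝ) / (erdosRogers s (s + 3) n : ℝ))
      Filter.atTop Filter.atTop :=
  finish s hs (partB s hs)
end

section
/- Let s ≥ 3 and s+2 ≤ t ≤ 2s-1 be integers. Then every colour scheme Q for K_t with parameter s satisfies v(Q) ≤ 0. -/
/-- The pair `(s,t)` is regular if `s ≥ 11` and `s+3 ≤ t ≤ 2s-4`, or if
`(s,t) ∈ {(10,14),(10,15)}`. -/
def IsRegularPair (s t : ℕ) : Prop :=
  (11 ≤ s ∧ s + 3 ≤ t ∧ t ≤ 2 * s - 4) ∨ (s = 10 ∧ t = 14) ∨ (s = 10 ∧ t = 15)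

open Classical in
/-- The exponent `α = α_{s,t}`. -/
noncomputable def ERalpha (s t : ℕ) : ℝ :=
  if IsRegularPair s t then
    (((s : ℝ) - 2) * ((t : ℝ) - (s : ℝ)) * ((t : ℝ) + (s : ℝ) - 1) + 2 * (t : ℝ) - 2 * (s : ℝ)) /
      ((2 * (s : ℝ) - 3) * ((t : ℝ) - (s : ℝ)) * ((t : ℝ) + (s : ℝ) - 1) - 2 * (s : ℝ) + 4)
  else
    (((s : ℝ) - 2) * ((t : ℝ) - (s : ℝ)) * ((s : ℝ) - 1) + (s : ℝ) - 1) /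
      ((2 * (s : ℝ) - 3) * ((t : ℝ) - (s : ℝ)) * ((s : ℝ) - 1) + 2 * (s : ℝ) - (t : ℝ))

/-- `δ = s - (2s-1)α`. -/
noncomputable def ERdelta (s t : ℕ) : ℝ := (s : ℝ) - (2 * (s : ℝ) - 1) * ERalpha s t

/-- `η = 2(1-α) - δ`. -/
noncomputable def EReta (s t : ℕ) : ℝ := 2 * (1 - ERalpha s t) - ERdelta s t

/-- A colour scheme for `K_t` with parameter `s`: a set of `t` nodes together with a
family of blocks (colours), each of size at least `2` and at most `s`, such that every
pair of distinct nodes is contained in exactly one block. -/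
structure ColourScheme (s t : ℕ) where
  blocks : Finset (Finset (Fin t))
  two_le_card : ∀ D ∈ blocks, 2 ≤ D.card
  card_le_s : ∀ D ∈ blocks, D.card ≤ s
  existsUnique_block : ∀ x y : Fin t, x ≠ y → ∃! D, D ∈ blocks ∧ x ∈ D ∧ y ∈ D

/-- The value `v(Q) = t - 2 + (b-1)δ + (l-2)(α-1)` of a scheme, where `b` is the number
of blocks and `l` the number of labels. -/
noncomputable def schemeValue {s t : ℕ} (Q : ColourScheme s t) : ℝ :=
  (t : ℝ) - 2 + ((Q.blocks.card : ℝ) - 1) * ERdelta s t +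
    ((∑ D ∈ Q.blocks, (D.card : ℝ)) - 2) * (ERalpha s t - 1)

theorem scheme_pair_count {s t : ℕ} (Q : ColourScheme s t) (S : Finset (Fin t × Fin t))
    (hS : ∀ p ∈ S, p.1 ≠ p.2) :
    ∑ D ∈ Q.blocks, ((S.filter (fun p => p.1 ∈ D ∧ p.2 ∈ D)).card) = S.card := by
  simp_rw [Finset.card_filter]
  rw [Finset.sum_comm]
  rw [Finset.card_eq_sum_ones]
  refine Finset.sum_congr rfl fun p hp => ?_
  obtain ⟨D, ⟨hD, hx⟩, hu⟩ := Q.existsUnique_block p.1 p.2 (hS p hp)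
  rw [← Finset.card_filter, Finset.card_eq_one]
  refine ⟨D, ?_⟩
  ext E
  simp only [Finset.mem_filter, Finset.mem_singleton]
  constructor
  · rintro ⟨h1, h2⟩
    exact hu E ⟨h1, h2⟩
  · rintro rfl
    exact ⟨hD, hx⟩

theorem offDiag_card_real {β : Type*} [DecidableEq β] (A : Finset β) :
    ((A.offDiag.card : ℕ) : ℝ) = (A.card : ℝ) * ((A.card : ℝ) - 1) := by
  rw [Finset.offDiag_card, Nat.cast_sub (Nat.le_mul_self _)]
  push_cast; ring

/-- Counting ordered pairs inside a set `U` of nodes. -/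
theorem scheme_count_inside {s t : ℕ} (Q : ColourScheme s t) (U : Finset (Fin t)) :
    ∑ D ∈ Q.blocks, ((D ∩ U).card : ℝ) * (((D ∩ U).card : ℝ) - 1)
      = (U.card : ℝ) * ((U.card : ℝ) - 1) := by
  have h := scheme_pair_count Q U.offDiag (fun p hp => (Finset.mem_offDiag.1 hp).2.2)
  have h' := congrArg (Nat.cast : ℕ → ℝ) h
  push_cast at h'
  rw [offDiag_card_real] at h'
  rw [← h']
  refine Finset.sum_congr rfl fun D _ => ?_
  rw [← offDiag_card_real]
  congr 2
  ext p
  simp only [Finset.mem_offDiag, Finset.mem_filter, Finset.mem_inter]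
  tauto

/-- Counting pairs between `U` and its complement. -/
theorem scheme_count_cross {s t : ℕ} (Q : ColourScheme s t) (U : Finset (Fin t)) :
    ∑ D ∈ Q.blocks, ((D ∩ U).card : ℝ) * ((D ∩ Uᶜ).card : ℝ)
      = (U.card : ℝ) * ((Uᶜ).card : ℝ) := by
  have h := scheme_pair_count Q (U ×ˢ Uᶜ) (fun p hp hq => by
    rw [Finset.mem_product, Finset.mem_compl, ← hq] at hp
    exact hp.2 hp.1)
  have h' := congrArg (Nat.cast : ℕ → ℝ) h
  push_cast [Finset.card_product] at h'
  rw [← h']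
  refine Finset.sum_congr rfl fun D _ => ?_
  rw [← Nat.cast_mul, ← Finset.card_product]
  congr 2
  ext p
  simp only [Finset.mem_product, Finset.mem_filter, Finset.mem_inter]
  tauto

theorem scheme_inter_le_one {s t : ℕ} (Q : ColourScheme s t) {D E : Finset (Fin t)}
    (hD : D ∈ Q.blocks) (hE : E ∈ Q.blocks) (hne : D ≠ E) : (D ∩ E).card ≤ 1 := by
  rw [Finset.card_le_one]
  intro x hx y hy
  by_contra hxy
  rw [Finset.mem_inter] at hx hy
  exact hne ((Q.existsUnique_block x y hxy).unique ⟨hD, hx.1, hy.1⟩ ⟨hE, hx.2, hy.2⟩)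

/-- Small blocks: every block pays for its share of the pairs. -/
theorem block_bound_small (t e g k : ℝ) (ht : 5 ≤ t) (he : 2 ≤ e * (t + 1)) (he0 : 0 ≤ e)
    (hg : 1 / 2 ≤ g) (hk : 2 ≤ k) (hk2 : 2 * k ≤ t - 1) :
    (t - 2 + e) * (k * (k - 1)) ≤ (e + g * (k - 2)) * (t * (t - 1)) := by
  have h1 : (e + (1 / 2) * (k - 2)) * (t * (t - 1)) ≤ (e + g * (k - 2)) * (t * (t - 1)) := by
    have : 0 ≤ t * (t - 1) := by nlinarith
    apply mul_le_mul_of_nonneg_right _ this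
    nlinarith
  refine le_trans ?_ h1
  have f2 : (0 : ℝ) ≤ e * (t * (t - 1)) - (t - 2 + e) * 2 := by nlinarith
  have fM : (0 : ℝ) ≤ (e + (1 / 2) * ((t - 1) / 2 - 2)) * (t * (t - 1))
      - (t - 2 + e) * ((t - 1) / 2 * ((t - 1) / 2 - 1)) := by
    have : (e + (1 / 2) * ((t - 1) / 2 - 2)) * (t * (t - 1))
      - (t - 2 + e) * ((t - 1) / 2 * ((t - 1) / 2 - 1)) = 3 * (t - 1) / 4 * (e * (t + 1) - 2) := by
      ring
    rw [this]
    apply mul_nonneg <;> linarith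
  rcases eq_or_lt_of_le ht with h5 | h5
  · have hk' : k = 2 := by linarith
    subst hk'
    nlinarith
  have key : ((t - 1) / 2 - 2) * ((e + (1 / 2) * (k - 2)) * (t * (t - 1))
      - (t - 2 + e) * (k * (k - 1))) =
      ((t - 1) / 2 - k) * (e * (t * (t - 1)) - (t - 2 + e) * 2) +
      (k - 2) * ((e + (1 / 2) * ((t - 1) / 2 - 2)) * (t * (t - 1))
      - (t - 2 + e) * ((t - 1) / 2 * ((t - 1) / 2 - 1))) +
      (t - 2 + e) * ((t - 1) / 2 - 2) * (((t - 1) / 2 - k) * (k - 2)) := by ring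
  have hpos : 0 < (t - 1) / 2 - 2 := by linarith
  have a1 : 0 ≤ (t - 1) / 2 - k := by linarith
  have a2 : 0 ≤ k - 2 := by linarith
  have a3 : 0 ≤ t - 2 + e := by linarith
  have : 0 ≤ (e + (1 / 2) * (k - 2)) * (t * (t - 1)) - (t - 2 + e) * (k * (k - 1)) := by
    refine nonneg_of_mul_nonneg_right ?_ hpos
    rw [key]
    positivity
  linarith

/-- The combinatorial heart, for abstract values `e` of `η` and `g` of `1 - α`. -/
theorem scheme_sum_ge {s t : ℕ} (hs : 3 ≤ s) (ht1 : s + 2 ≤ t) (ht2 : t ≤ 2 * s - 1)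
    (Q : ColourScheme s t) (e g : ℝ) (he0 : 0 ≤ e) (he2 : e ≤ 1 / 2) (hg : 1 / 2 ≤ g)
    (hA : 2 ≤ e * ((t : ℝ) + 1))
    (hB : (t : ℝ) - 2 ≤ g * ((s : ℝ) - 2) + e * (((t : ℝ) - s) * ((t : ℝ) + s - 1) / 2))
    (hC : (t : ℝ) - 2 ≤ g * ((t : ℝ) - 3) + e * (((t : ℝ) - s) * ((s : ℝ) - 1) + 1))
    (hD : g ≤ e * ((t : ℝ) - s)) :
    (t : ℝ) - 2 + e ≤ ∑ D ∈ Q.blocks, (e + g * ((D.card : ℝ) - 2)) := by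
  have hs' : (3 : ℝ) ≤ s := by exact_mod_cast hs
  have ht1' : (s : ℝ) + 2 ≤ t := by exact_mod_cast ht1
  have ht2' : (t : ℝ) ≤ 2 * s - 1 := by
    have : t + 1 ≤ 2 * s := by omega
    have : (t : ℝ) + 1 ≤ 2 * s := by exact_mod_cast this
    linarith
  by_cases hall : ∀ D ∈ Q.blocks, s + D.card ≤ t
  · -- all blocks small
    have hcount := scheme_count_inside Q Finset.univ
    simp only [Finset.inter_univ, Finset.card_univ, Fintype.card_fin] at hcount
    have hT : (0 : ℝ) < (t : ℝ) * ((t : ℝ) - 1) := by nlinarith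
    have hsum : ((t : ℝ) - 2 + e) * ((t : ℝ) * ((t : ℝ) - 1)) ≤
        (∑ D ∈ Q.blocks, (e + g * ((D.card : ℝ) - 2))) * ((t : ℝ) * ((t : ℝ) - 1)) := by
      rw [← hcount, Finset.mul_sum, hcount, Finset.sum_mul]
      refine Finset.sum_le_sum fun D hDm => ?_
      have h2 : (2 : ℝ) ≤ D.card := by exact_mod_cast Q.two_le_card D hDm
      have h3 : (s : ℝ) + D.card ≤ t := by exact_mod_cast hall D hDm
      exact block_bound_small t e g D.card (by linarith) hA he0 hg h2 (by linarith)
    exact le_of_mul_le_mul_right hsum hT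
  · -- there is a large block `D₀`
    push Not at hall
    obtain ⟨D₀, hD₀, hbig⟩ := hall
    have hms := Q.card_le_s D₀ hD₀
    have hm2 := Q.two_le_card D₀ hD₀
    have hin := scheme_count_inside Q D₀ᶜ
    have hcr := scheme_count_cross Q D₀
    have hr : ((D₀ᶜ.card : ℕ) : ℝ) = (t : ℝ) - D₀.card := by
      rw [Finset.card_compl, Fintype.card_fin, Nat.cast_sub (by omega)]
    have hm2' : (2 : ℝ) ≤ D₀.card := by exact_mod_cast hm2
    have hms' : (D₀.card : ℝ) ≤ s := by exact_mod_cast hms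
    have hbig' : (t : ℝ) + 1 ≤ s + D₀.card := by exact_mod_cast hbig
    set m : ℝ := (D₀.card : ℝ) with hm
    set r : ℝ := ((D₀ᶜ.card : ℕ) : ℝ) with hrdef
    have hr2 : 2 ≤ r := by linarith
    have main : ∀ c : ℝ, 0 ≤ c → c ≤ e → c * r ≤ 2 * (g - e) →
        e + g * (m - 2) + e * (m * r) + c / 2 * (r * (r - 1)) ≤
          ∑ D ∈ Q.blocks, (e + g * ((D.card : ℝ) - 2)) := by
      intro c hc0 hce hcr2
      rw [← hin, ← hcr, Finset.mul_sum, Finset.mul_sum]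
      rw [← Finset.add_sum_erase _ _ hD₀, ← Finset.add_sum_erase _ _ hD₀,
        ← Finset.add_sum_erase _ (fun D => e + g * ((D.card : ℝ) - 2)) hD₀]
      simp only [Finset.inter_compl, Finset.card_empty, Nat.cast_zero, mul_zero, zero_mul,
        zero_add]
      have : ∀ D ∈ Q.blocks.erase D₀,
          e * (((D ∩ D₀).card : ℝ) * ((D ∩ D₀ᶜ).card : ℝ)) +
          c / 2 * (((D ∩ D₀ᶜ).card : ℝ) * (((D ∩ D₀ᶜ).card : ℝ) - 1)) ≤
          e + g * ((D.card : ℝ) - 2) := by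
        intro D hDm
        rw [Finset.mem_erase] at hDm
        have hi := scheme_inter_le_one Q hDm.2 hD₀ hDm.1
        have h2 := Q.two_le_card D hDm.2
        have hk : (D ∩ D₀).card + (D ∩ D₀ᶜ).card = D.card := by
          rw [← Finset.sdiff_eq_inter_compl]
          exact Finset.card_inter_add_card_sdiff D D₀
        have hjr : (((D ∩ D₀ᶜ).card : ℕ) : ℝ) ≤ r := by
          rw [hrdef]
          exact_mod_cast Finset.card_le_card Finset.inter_subset_right
        rw [← hk] at h2 ⊢
        generalize (D ∩ D₀ᶜ).card = j at *
        generalize (D ∩ D₀).card = i at *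
        have hi' : i = 0 ∨ i = 1 := by omega
        rcases hi' with rfl | rfl
        · have hj2 : (2 : ℝ) ≤ j := by
            have : 2 ≤ j := by omega
            exact_mod_cast this
          push_cast
          generalize (j : ℝ) = x at *
          have her : g ≤ e * r := hD.trans (mul_le_mul_of_nonneg_left (by linarith) he0)
          rcases eq_or_lt_of_le hr2 with h | h
          · have : x = 2 := by linarith
            subst this
            nlinarith
          · have hend : 0 ≤ e + g * (r - 2) - c / 2 * (r * (r - 1)) := by
              nlinarith
            have key : (r - 2) * (e + g * (x - 2) - c / 2 * (x * (x - 1))) =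
                (r - x) * (e - c) + (x - 2) * (e + g * (r - 2) - c / 2 * (r * (r - 1))) +
                c / 2 * (r - 2) * ((r - x) * (x - 2)) := by ring
            have a1 : 0 ≤ r - x := by linarith
            have a2 : 0 ≤ x - 2 := by linarith
            have a3 : 0 < r - 2 := by linarith
            have a4 : 0 ≤ e - c := by linarith
            have : 0 ≤ e + g * (x - 2) - c / 2 * (x * (x - 1)) := by
              refine nonneg_of_mul_nonneg_right ?_ a3
              rw [key]
              positivity
            linarith
        · have hj1 : (1 : ℝ) ≤ j := by
            have : 1 ≤ j := by omega
            exact_mod_cast this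
          push_cast
          generalize (j : ℝ) = x at *
          have h1 : c * x ≤ 2 * (g - e) := (mul_le_mul_of_nonneg_left hjr hc0).trans hcr2
          have h2 : c * x * (x - 1) ≤ 2 * (g - e) * (x - 1) :=
            mul_le_mul_of_nonneg_right h1 (by linarith)
          linarith
      have h := Finset.sum_le_sum this
      rw [Finset.sum_add_distrib] at h
      linarith
    have hm' : m = t - r := by linarith
    rcases le_total (e * r) (2 * (g - e)) with hcase | hcase
    · refine le_trans ?_ (main e he0 le_rfl hcase)
      have F2 : 0 ≤ e * (((t : ℝ) - 2) * (t + 1) / 2) - (t - 2) := by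
        have : 0 ≤ ((t : ℝ) - 2) * (e * (t + 1) - 2) := mul_nonneg (by linarith) (by linarith)
        linarith
      have Fs : 0 ≤ g * ((s : ℝ) - 2) + e * (((t : ℝ) - s) * ((t : ℝ) + s - 1) / 2) - (t - 2) := by
        linarith
      have key : ((s : ℝ) - 2) * (g * (m - 2) + e * (m * r) + e / 2 * (r * (r - 1)) - (t - 2)) =
          (s - m) * (e * (((t : ℝ) - 2) * (t + 1) / 2) - (t - 2)) +
          (m - 2) * (g * ((s : ℝ) - 2) + e * (((t : ℝ) - s) * ((t : ℝ) + s - 1) / 2) - (t - 2)) +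
          e / 2 * ((s : ℝ) - 2) * ((s - m) * (m - 2)) := by
        rw [hm']; ring
      have a1 : 0 ≤ (s : ℝ) - m := by linarith
      have a2 : 0 ≤ m - 2 := by linarith
      have a3 : 0 < (s : ℝ) - 2 := by linarith
      have : 0 ≤ g * (m - 2) + e * (m * r) + e / 2 * (r * (r - 1)) - (t - 2) := by
        refine nonneg_of_mul_nonneg_right ?_ a3
        rw [key]
        positivity
      linarith
    · have hr0 : (0 : ℝ) < r := by linarith
      have h := main (2 * (g - e) / r) (div_nonneg (by linarith) hr0.le)
        (by rw [div_le_iff₀ hr0]; exact hcase) (by rw [div_mul_cancel₀ _ hr0.ne'])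
      refine le_trans ?_ h
      have e1 : 2 * (g - e) / r / 2 * (r * (r - 1)) = (g - e) * (r - 1) := by
        field_simp
      rw [e1]
      have h3 : 0 ≤ e * ((s - m) * (s + m - t - 1)) :=
        mul_nonneg he0 (mul_nonneg (by linarith) (by linarith))
      rw [hm'] at h3 ⊢
      nlinarith

theorem mul_ge_of_cross {e N D X Y : ℝ} (hD : 0 < D) (h : e * D = N) (hc : Y * D ≤ N * X) :
    Y ≤ e * X := by
  refine le_of_mul_le_mul_right ?_ hD
  calc Y * D ≤ N * X := hc
    _ = e * X * D := by rw [← h]; ring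

/-- Numerical facts, exceptional case; `s = u + a + 3`, `t = 2u + a + 5`. -/
theorem numeric_exceptional (u a : ℕ) (s t e : ℝ) (hsv : s = u + a + 3) (htv : t = 2 * u + a + 5)
    (hex : u = 0 ∨ a ≤ 2 ∨ (u + a + 3 ≤ 10 ∧ ¬ (u + a = 7 ∧ (2 * u + a = 9 ∨ 2 * u + a = 10))))
    (h : e * ((2 * s - 3) * (t - s) * (s - 1) + 2 * s - t) = s * t - 2 * t - s + 3) :
    0 < (2 * s - 3) * (t - s) * (s - 1) + 2 * s - t ∧
    2 ≤ e * (t + 1) ∧ s - 1 ≤ e * ((2 * s - 3) * (t - s) + 1) ∧ 2 * e ≤ 1 ∧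
    s * t - 2 * t - s + 3 ≤ e * ((2 * s - 3) * (t - s) * (s - 1) + 2 * s - t) ∧
    2 * (2 * s * t - 3 * t - s - s * s + 4) ≤
      e * ((2 * s - 3) * (t - s) * (t + s - 1) - 2 * s + 4) := by
  have hu : (0 : ℝ) ≤ u := Nat.cast_nonneg _
  have ha : (0 : ℝ) ≤ a := Nat.cast_nonneg _
  have hD : 0 < (2 * s - 3) * (t - s) * (s - 1) + 2 * s - t := by
    subst hsv htv; ring_nf; positivity
  refine ⟨hD, mul_ge_of_cross hD h ?_, mul_ge_of_cross hD h ?_, ?_, h.ge, mul_ge_of_cross hD h ?_⟩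
  · subst hsv htv; rw [← sub_nonneg]; ring_nf; positivity
  · subst hsv htv; rw [← sub_nonneg]; ring_nf; positivity
  · have : -(1 : ℝ) ≤ e * (-2) := by
      refine mul_ge_of_cross hD h ?_
      subst hsv htv; rw [← sub_nonneg]; ring_nf; positivity
    linarith
  · rcases hex with hex | hex | hex
    · subst hex hsv htv; rw [← sub_nonneg]; push_cast; ring_nf; positivity
    · subst hsv htv; rw [← sub_nonneg]
      interval_cases a
      · push_cast; ring_nf; positivity
      · push_cast; ring_nf; positivity
      · push_cast; ring_nf; positivity
    · obtain ⟨h1, h2⟩ := hex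
      have h3 : u ≤ 7 := by omega
      have h4 : a ≤ 7 := by omega
      subst hsv htv
      interval_cases u <;> interval_cases a <;> first | (exfalso; omega) | norm_num

/-- Numerical facts, regular case. -/
theorem numeric_regular (u a : ℕ) (s t e : ℝ) (hsv : s = u + a + 3) (htv : t = 2 * u + a + 5)
    (hex : (8 ≤ u + a ∧ 1 ≤ u ∧ 3 ≤ a) ∨ (u + a = 7 ∧ (2 * u + a = 9 ∨ 2 * u + a = 10)))
    (h : e * ((2 * s - 3) * (t - s) * (t + s - 1) - 2 * s + 4) =
      2 * (2 * s * t - 3 * t - s - s * s + 4)) :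
    0 < (2 * s - 3) * (t - s) * (t + s - 1) - 2 * s + 4 ∧
    2 ≤ e * (t + 1) ∧ s - 1 ≤ e * ((2 * s - 3) * (t - s) + 1) ∧ 2 * e ≤ 1 ∧
    s * t - 2 * t - s + 3 ≤ e * ((2 * s - 3) * (t - s) * (s - 1) + 2 * s - t) ∧
    2 * (2 * s * t - 3 * t - s - s * s + 4) ≤
      e * ((2 * s - 3) * (t - s) * (t + s - 1) - 2 * s + 4) := by
  have hu : (0 : ℝ) ≤ u := Nat.cast_nonneg _
  have ha : (0 : ℝ) ≤ a := Nat.cast_nonneg _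
  have hD : 0 < (2 * s - 3) * (t - s) * (t + s - 1) - 2 * s + 4 := by
    subst hsv htv; ring_nf; positivity
  refine ⟨hD, mul_ge_of_cross hD h ?_, mul_ge_of_cross hD h ?_, ?_, mul_ge_of_cross hD h ?_, h.ge⟩
  · subst hsv htv; rw [← sub_nonneg]; ring_nf; positivity
  · subst hsv htv; rw [← sub_nonneg]; ring_nf; positivity
  · have : -(1 : ℝ) ≤ e * (-2) := by
      refine mul_ge_of_cross hD h ?_
      subst hsv htv; rw [← sub_nonneg]; ring_nf; positivity
    linarith
  · rcases hex with ⟨h1, h2, h3⟩ | hex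
    · obtain ⟨x, rfl⟩ := Nat.exists_eq_add_of_le h2
      obtain ⟨y, rfl⟩ := Nat.exists_eq_add_of_le h3
      have hx : (0 : ℝ) ≤ x := Nat.cast_nonneg _
      have hy : (0 : ℝ) ≤ y := Nat.cast_nonneg _
      have hxy : (4 : ℝ) ≤ x + y := by
        have : 4 ≤ x + y := by omega
        exact_mod_cast this
      subst hsv htv
      rw [← sub_nonneg]
      rcases Nat.lt_or_ge x 4 with hx4 | hx4
      · obtain ⟨z, hz⟩ := Nat.exists_eq_add_of_le (show 4 ≤ x + y by omega)
        interval_cases x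
        · obtain rfl : y = 4 + z := by omega
          push_cast; ring_nf; positivity
        · obtain rfl : y = 3 + z := by omega
          push_cast; ring_nf; positivity
        · obtain rfl : y = 2 + z := by omega
          push_cast; ring_nf; positivity
        · obtain rfl : y = 1 + z := by omega
          push_cast; ring_nf; positivity
      · obtain ⟨z, rfl⟩ := Nat.exists_eq_add_of_le hx4
        push_cast; ring_nf; positivity
    · have h3 : (u = 2 ∧ a = 5) ∨ (u = 3 ∧ a = 4) := by omega
      subst hsv htv
      rcases h3 with ⟨rfl, rfl⟩ | ⟨rfl, rfl⟩ <;> norm_num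

/-- **Lemma (negscheme).** Let `s ≥ 3` and `s+2 ≤ t ≤ 2s-1`. Then every colour scheme
`Q` for `K_t` with parameter `s` satisfies `v(Q) ≤ 0`. -/
theorem schemeValue_nonpos (s t : ℕ) (hs : 3 ≤ s) (ht1 : s + 2 ≤ t) (ht2 : t ≤ 2 * s - 1)
    (Q : ColourScheme s t) : schemeValue Q ≤ 0 := by
  obtain ⟨u, ht_def⟩ : ∃ u, t = s + 2 + u := Nat.exists_eq_add_of_le ht1
  obtain ⟨a, hs_def⟩ : ∃ a, s = u + 3 + a := Nat.exists_eq_add_of_le (by omega)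
  have hsv : (s : ℝ) = u + a + 3 := by rw [hs_def]; push_cast; ring
  have htv : (t : ℝ) = 2 * u + a + 5 := by rw [ht_def]; push_cast; rw [hsv]; ring
  have hs3 : (3 : ℝ) ≤ s := by exact_mod_cast hs
  have hst : (s : ℝ) + 2 ≤ t := by exact_mod_cast ht1
  have heta : EReta s t = (2 * (s : ℝ) - 3) * ERalpha s t - (s - 2) := by
    unfold EReta ERdelta; ring
  have hnum : 2 ≤ EReta s t * ((t : ℝ) + 1) ∧
      (s : ℝ) - 1 ≤ EReta s t * ((2 * s - 3) * (t - s) + 1) ∧ 2 * EReta s t ≤ 1 ∧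
      (s : ℝ) * t - 2 * t - s + 3 ≤ EReta s t * ((2 * s - 3) * (t - s) * (s - 1) + 2 * s - t) ∧
      2 * (2 * (s : ℝ) * t - 3 * t - s - s * s + 4) ≤
        EReta s t * ((2 * s - 3) * (t - s) * (t + s - 1) - 2 * s + 4) := by
    have hu : (0 : ℝ) ≤ u := Nat.cast_nonneg _
    have ha : (0 : ℝ) ≤ a := Nat.cast_nonneg _
    by_cases hreg : IsRegularPair s t
    · refine (numeric_regular u a s t _ hsv htv ?_ ?_).2
      · unfold IsRegularPair at hreg; omega
      · rw [heta]
        unfold ERalpha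
        rw [if_pos hreg]
        have hD : (2 * (s : ℝ) - 3) * (t - s) * (t + s - 1) - 2 * s + 4 ≠ 0 := by
          apply ne_of_gt
          rw [hsv, htv]; ring_nf; positivity
        field_simp
        ring
    · refine (numeric_exceptional u a s t _ hsv htv ?_ ?_).2
      · unfold IsRegularPair at hreg; omega
      · rw [heta]
        unfold ERalpha
        rw [if_neg hreg]
        have hD : (2 * (s : ℝ) - 3) * (t - s) * (s - 1) + 2 * s - t ≠ 0 := by
          apply ne_of_gt
          rw [hsv, htv]; ring_nf; positivity
        field_simp
        ring
  obtain ⟨hA, hDD, hH, hC, hB⟩ := hnum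
  have h23 : (0 : ℝ) < 2 * s - 3 := by linarith
  have hg : (1 - ERalpha s t) * (2 * s - 3) = s - 1 - EReta s t := by rw [heta]; ring
  have hval : schemeValue Q = (t : ℝ) - 2 + EReta s t -
      ∑ D ∈ Q.blocks, (EReta s t + (1 - ERalpha s t) * ((D.card : ℝ) - 2)) := by
    rw [Finset.sum_add_distrib, ← Finset.mul_sum, Finset.sum_sub_distrib]
    simp only [Finset.sum_const, nsmul_eq_mul]
    unfold schemeValue EReta
    ring
  rw [hval]
  have he0 : 0 ≤ EReta s t := by
    by_contra hneg
    push Not at hneg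
    nlinarith
  generalize EReta s t = e at *
  generalize 1 - ERalpha s t = g at *
  have := scheme_sum_ge hs ht1 ht2 Q e g he0 (by linarith)
    (by refine le_of_mul_le_mul_right ?_ h23; rw [hg]; linarith) hA
    (by
      refine le_of_mul_le_mul_right ?_ h23
      have : (g * ((s : ℝ) - 2) + e * (((t : ℝ) - s) * ((t : ℝ) + s - 1) / 2)) * (2 * s - 3) =
        (g * (2 * s - 3)) * (s - 2) + e * (((t : ℝ) - s) * ((t : ℝ) + s - 1) / 2) * (2 * s - 3) := by
        ring
      rw [this, hg]; linarith)
    (by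
      refine le_of_mul_le_mul_right ?_ h23
      have : (g * ((t : ℝ) - 3) + e * (((t : ℝ) - s) * ((s : ℝ) - 1) + 1)) * (2 * s - 3) =
        (g * (2 * s - 3)) * (t - 3) + e * (((t : ℝ) - s) * ((s : ℝ) - 1) + 1) * (2 * s - 3) := by
        ring
      rw [this, hg]; linarith)
    (by refine le_of_mul_le_mul_right ?_ h23; rw [hg]; linarith)
  linarith
end
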